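/- Every quasi-hyperbolic toral automorphism is fully universal: for every invertible ergodic measure-preserving transformation T of a non-atomic Lebesgue probability space (X, μ) with h_μ(T) strictly less than the topological entropy of the automorphism, there exists an embedding of (X, μ, T) into the toral automorphism system such that the push-forward of μ under the embedding has full support on the torus. -/

import Mathlib

open MeasureTheory Filter Set
open scoped ENNReal

/-- Shannon entropy of the finite-valued observable `P` with respect to `μ`. -/
noncomputable def infoEntropy {X : Type*} [MeasurableSpace X] (μ : Measure X)
    {α : Type*} [Fintype α] (P : X → α) : ℝ :=
  ∑ a : α, Real.negMulLog (μ (P ⁻¹' {a})).toReal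

/-- Entropy of the transformation `T` with respect to the observable (finite partition) `P`. -/
noncomputable def entropyWrt {X : Type*} [MeasurableSpace X] (μ : Measure X) (T : X → X)
    {α : Type*} [Fintype α] (P : X → α) : ℝ :=
  Filter.atTop.liminf fun n : ℕ =>
    infoEntropy μ (fun x => fun i : Fin n => P (T^[(i : ℕ)] x)) / n

/-- Kolmogorov–Sinai (measure-theoretic) entropy of `T` with respect to `μ`. -/
noncomputable def ksEntropy {X : Type*} [MeasurableSpace X] (μ : Measure X) (T : X → X) : ℝ≥0∞ :=
  ⨆ (k : ℕ) (P : X → Fin k) (_ : Measurable P), ENNReal.ofReal (entropyWrt μ T P)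

/-- Topological entropy (Bowen–Dinaburg, via dynamical covers). -/
noncomputable def topEntropy {Y : Type*} [UniformSpace Y] (S : Y → Y) : EReal :=
  Dynamics.coverEntropy S Set.univ

/-- `Ψ` is an embedding of the measure-preserving system `(X, μ, T)` into `(Y, S)`:
it is measurable, and on some set of full measure it is injective and equivariant. -/
def IsMeasEmbedding {X Y : Type*} [MeasurableSpace X] [MeasurableSpace Y]
    (μ : Measure X) (T : X → X) (S : Y → Y) (Ψ : X → Y) : Prop :=
  Measurable Ψ ∧ ∃ X' : Set X, MeasurableSet X' ∧ μ X'ᶜ = 0 ∧ Set.InjOn Ψ X' ∧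
    ∀ x ∈ X', Ψ (T x) = S (Ψ x)

/-- A measure on a topological space has full support. -/
def FullSupport {Y : Type*} [TopologicalSpace Y] [MeasurableSpace Y] (ν : Measure Y) : Prop :=
  ∀ U : Set Y, IsOpen U → U.Nonempty → 0 < ν U

/-- `(Y, S)` is fully universal: every invertible ergodic measure-preserving transformation of a
non-atomic Lebesgue (standard Borel) probability space with entropy strictly less than the
topological entropy of `S` embeds into `(Y, S)`, with fully supported push-forward measure. -/
def FullyUniversal {Y : Type*} [UniformSpace Y] [MeasurableSpace Y] (S : Y → Y) : Prop :=
  ∀ (X : Type) [MeasurableSpace X] (μ : Measure X) (T : X ≃ᵐ X),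
    StandardBorelSpace X → IsProbabilityMeasure μ → NoAtoms μ → Ergodic (⇑T) μ →
    (ksEntropy μ (⇑T) : EReal) < topEntropy S →
    ∃ Ψ : X → Y, IsMeasEmbedding μ (⇑T) S Ψ ∧ FullSupport (μ.map Ψ)

/-- The `d`-dimensional torus `ℝ^d/ℤ^d`. -/
abbrev Torus (d : ℕ) := Fin d → AddCircle (1 : ℝ)

/-- The automorphism of the torus induced by an integer matrix `A`. -/
noncomputable def toralAut {d : ℕ} (A : Matrix (Fin d) (Fin d) ℤ) : Torus d → Torus d :=
  fun x i => ∑ j : Fin d, A i j • x j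

/-- `A` is quasi-hyperbolic: no eigenvalue of `A` (i.e. no root of its characteristic
polynomial over `ℂ`) is a root of unity. -/
def QuasiHyperbolic {d : ℕ} (A : Matrix (Fin d) (Fin d) ℤ) : Prop :=
  ∀ z : ℂ, (A.charpoly.map (Int.castRingHom ℂ)).IsRoot z → ∀ n : ℕ, 0 < n → z ^ n ≠ 1

set_option linter.unusedSectionVars false

section MeanErgodic

variable {X : Type*} [MeasurableSpace X] {μ : Measure X} {T : X → X}

/-- The Koopman averages of `f` in `L²` are represented by the pointwise Birkhoff averages. -/
theorem coeFn_birkhoffAverage_koopman [IsProbabilityMeasure μ] (hT : MeasurePreserving T μ μ)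
    {f : X → ℝ} (hf : MemLp f 2 μ) (n : ℕ) :
    (birkhoffAverage ℝ (Lp.compMeasurePreserving T hT) _root_.id n (hf.toLp f) : Lp ℝ 2 μ)
      =ᵐ[μ] birkhoffAverage ℝ T f n := by
  have h1 : ∀ k, ((Lp.compMeasurePreserving T hT)^[k] (hf.toLp f) : Lp ℝ 2 μ)
      =ᵐ[μ] fun x => f (T^[k] x) := by
    intro k
    have h0 : (Lp.compMeasurePreserving T hT)^[k] (hf.toLp f) =
        Lp.compMeasurePreserving T^[k] (hT.iterate k) (hf.toLp f) := by
      rw [Lp.compMeasurePreserving_iterate hT k]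
    rw [h0, Lp.toLp_compMeasurePreserving hf (hT.iterate k)]
    exact MemLp.coeFn_toLp _
  have h2 : ∀ n, (birkhoffSum (Lp.compMeasurePreserving T hT) _root_.id n (hf.toLp f) : Lp ℝ 2 μ)
      =ᵐ[μ] birkhoffSum T f n := by
    intro n
    induction n with
    | zero =>
      simp only [birkhoffSum_zero]
      exact Lp.coeFn_zero ℝ 2 μ
    | succ n ih =>
      rw [birkhoffSum_succ]
      filter_upwards [Lp.coeFn_add (birkhoffSum (Lp.compMeasurePreserving T hT) _root_.id n (hf.toLp f))
        (_root_.id ((Lp.compMeasurePreserving T hT)^[n] (hf.toLp f))), ih, h1 n] with x h3 h4 h5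
      rw [h3, birkhoffSum_succ, Pi.add_apply, h4]
      simp only [_root_.id]
      rw [h5]
  rw [birkhoffAverage]
  filter_upwards [Lp.coeFn_smul ((n : ℝ)⁻¹) (birkhoffSum (Lp.compMeasurePreserving T hT) _root_.id n
    (hf.toLp f)), h2 n] with x h3 h4
  rw [h3, birkhoffAverage, Pi.smul_apply, h4]

/-- Mean ergodic theorem: Birkhoff averages of a bounded function converge in probability. -/
theorem Ergodic.tendsto_measureReal_birkhoffAverage [IsProbabilityMeasure μ] (hT : Ergodic T μ)
    {f : X → ℝ} (hf : Measurable f) {C : ℝ} (hC : ∀ x, |f x| ≤ C) {ε : ℝ} (hε : 0 < ε) :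
    Tendsto (fun N : ℕ => μ.real {x | ε ≤ |birkhoffAverage ℝ T f N x - ∫ y, f y ∂μ|})
      atTop (nhds 0) := by
  have hTm := hT.toMeasurePreserving
  have hfL : MemLp f 2 μ := MemLp.of_bound hf.aestronglyMeasurable C (ae_of_all _ (by simpa using hC))
  set L : Lp ℝ 2 μ →L[ℝ] Lp ℝ 2 μ :=
    (Lp.compMeasurePreservingₗᵢ ℝ T hTm).toContinuousLinearMap with hL
  have hL1 : ‖L‖ ≤ 1 := LinearIsometry.norm_toContinuousLinearMap_le _
  obtain ⟨G, hGinv, hlim⟩ : ∃ G, L G = G ∧ Tendsto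
      (birkhoffAverage ℝ L _root_.id · (hfL.toLp f)) atTop (nhds G) := by
    have hlim := L.tendsto_birkhoffAverage_orthogonalProjection hL1 (hfL.toLp f)
    refine ⟨_, ?_, hlim⟩
    exact LinearMap.mem_eqLocus.1 (Subtype.prop _)
  obtain ⟨c, hc⟩ : ∃ c, (G : X → ℝ) =ᵐ[μ] Function.const X c := by
    apply hT.ae_eq_const_of_ae_eq_comp_ae (Lp.aestronglyMeasurable G)
    have := Lp.coeFn_compMeasurePreserving G hTm
    have h2 : Lp.compMeasurePreserving T hTm G = G := hGinv
    rw [h2] at this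
    exact this.symm
  have hav : ∀ n, (birkhoffAverage ℝ L _root_.id n (hfL.toLp f) : Lp ℝ 2 μ)
      =ᵐ[μ] birkhoffAverage ℝ T f n := fun n => coeFn_birkhoffAverage_koopman hTm hfL n
  have hinM := tendstoInMeasure_of_tendsto_Lp hlim
  have hinM2 : TendstoInMeasure μ (fun n => birkhoffAverage ℝ T f n) atTop (fun _ => c) :=
    hinM.congr hav hc
  have hmeas : ∀ n, Measurable (birkhoffAverage ℝ T f n) := by
    intro n
    unfold birkhoffAverage birkhoffSum
    refine Measurable.fun_const_smul ?_ _
    exact Finset.measurable_sum _ fun i _ => hf.comp (hTm.measurable.iterate i)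
  have hfi : Integrable f μ := hfL.integrable (by norm_num)
  have hii : ∀ i, Integrable (fun x => f (T^[i] x)) μ := fun i =>
    ((hTm.iterate i).integrable_comp hf.aestronglyMeasurable).2 hfi
  have hint : ∀ n, 0 < n → ∫ x, birkhoffAverage ℝ T f n x ∂μ = ∫ x, f x ∂μ := by
    intro n hn
    unfold birkhoffAverage birkhoffSum
    rw [integral_smul, integral_finsetSum _ fun i _ => hii i]
    have : ∀ i, ∫ x, f (T^[i] x) ∂μ = ∫ x, f x ∂μ := fun i => by
      rw [← integral_map (hTm.iterate i).aemeasurable hf.aestronglyMeasurable,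
        (hTm.iterate i).map_eq]
    simp only [this]
    have : (n : ℝ) ≠ 0 := by positivity
    simp [this]
  have hcf : c = ∫ x, f x ∂μ := by
    have hL2 := (Lp.tendsto_Lp_iff_tendsto_eLpNorm' _ _).1 hlim
    have hL1 : Tendsto (fun n => eLpNorm (birkhoffAverage ℝ T f n - fun _ => c) 1 μ) atTop
        (nhds 0) := by
      refine tendsto_of_tendsto_of_tendsto_of_le_of_le tendsto_const_nhds hL2
        (fun n => zero_le) fun n => ?_
      refine (eLpNorm_le_eLpNorm_of_exponent_le (p := 1) (q := 2) (by norm_num)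
        ((hmeas n).sub measurable_const).aestronglyMeasurable).trans ?_
      refine (eLpNorm_congr_ae ?_).le
      filter_upwards [hav n, hc] with x h1 h2
      simp only [Pi.sub_apply]
      rw [h1, h2]; rfl
    have := tendsto_integral_of_L1' (μ := μ) (fun _ => c)
      (aestronglyMeasurable_const) (F := fun n => birkhoffAverage ℝ T f n) (l := atTop) ?_ hL1
    · have h2 : Tendsto (fun n => ∫ x, birkhoffAverage ℝ T f n x ∂μ) atTop
          (nhds (∫ x, f x ∂μ)) := by
        refine tendsto_const_nhds.congr' ?_
        filter_upwards [eventually_gt_atTop 0] with n hn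
        exact (hint n hn).symm
      have := tendsto_nhds_unique this h2
      simpa using this
    · refine Eventually.of_forall fun n => ?_
      unfold birkhoffAverage birkhoffSum
      exact (integrable_finsetSum _ fun i _ => hii i).fun_smul _
  have := hinM2 (ENNReal.ofReal ε) (by simpa using hε)
  rw [← ENNReal.tendsto_toReal_iff (by simp) (by simp)] at this
  simp only [ENNReal.toReal_zero] at this
  convert this using 3 with N
  unfold Measure.real
  congr 2 with x
  rw [mem_ofPred_eq, mem_ofPred_eq, edist_dist, ENNReal.ofReal_le_ofReal_iff dist_nonneg,
    Real.dist_eq, hcf]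

end MeanErgodic

section FiniteObservables

variable {X : Type*} [MeasurableSpace X] {μ : Measure X}
  {β : Type*} [Fintype β] [MeasurableSpace β] [MeasurableSingletonClass β]

/-- The mass of the atom of the finite partition `Q` that contains `x`. -/
noncomputable def atomMass (μ : Measure X) (Q : X → β) (x : X) : ℝ := μ.real (Q ⁻¹' {Q x})

/-- The information function of the finite partition `Q`. -/
noncomputable def infoFun (μ : Measure X) (Q : X → β) (x : X) : ℝ := -Real.log (atomMass μ Q x)

/-- The name of length `N` of the point `x`. -/
def itinerary {α : Type*} (T : X → X) (P : X → α) (N : ℕ) (x : X) : Fin N → α :=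
  fun i => P (T^[(i : ℕ)] x)

theorem measurable_itinerary {α : Type*} [MeasurableSpace α] {T : X → X} (hT : Measurable T)
    {P : X → α} (hP : Measurable P) (N : ℕ) : Measurable (itinerary T P N) :=
  measurable_pi_lambda _ fun i => hP.comp (hT.iterate i)

theorem integral_comp_fintype [IsProbabilityMeasure μ] {Q : X → β} (hQ : Measurable Q)
    (g : β → ℝ) : ∫ x, g (Q x) ∂μ = ∑ b, μ.real (Q ⁻¹' {b}) * g b := by
  rw [← integral_map hQ.aemeasurable (Measurable.of_discrete (f := g)).aestronglyMeasurable]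
  have : IsProbabilityMeasure (μ.map Q) := Measure.isProbabilityMeasure_map hQ.aemeasurable
  rw [integral_fintype Integrable.of_finite]
  refine Finset.sum_congr rfl fun b _ => ?_
  rw [map_measureReal_apply hQ (measurableSet_singleton b), smul_eq_mul]

theorem sum_measureReal_preimage [IsProbabilityMeasure μ] {Q : X → β} (hQ : Measurable Q) :
    ∑ b, μ.real (Q ⁻¹' {b}) = 1 := by
  have := integral_comp_fintype (μ := μ) hQ (fun _ => 1)
  simpa using this.symm

theorem measureReal_setOf_comp [IsProbabilityMeasure μ] {Q : X → β} (hQ : Measurable Q)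
    (p : β → Prop) [DecidablePred p] :
    μ.real {x | p (Q x)} = ∑ b, if p b then μ.real (Q ⁻¹' {b}) else 0 := by
  have := integral_comp_fintype (μ := μ) hQ (fun b => if p b then 1 else 0)
  simp only [mul_ite, mul_one, mul_zero] at this
  rw [← this, ← integral_indicator_one]
  · refine integral_congr_ae (ae_of_all _ fun x => ?_)
    simp [Set.indicator_apply]
  · exact hQ (Set.toFinite {b | p b}).measurableSet

theorem measurable_infoFun {Q : X → β} (hQ : Measurable Q) : Measurable (infoFun μ Q) :=
  (Measurable.of_discrete (f := fun b => -Real.log (μ.real (Q ⁻¹' {b})))).comp hQ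

theorem exists_abs_infoFun_le (Q : X → β) : ∃ C, ∀ x, |infoFun μ Q x| ≤ C := by
  obtain ⟨C, hC⟩ := (Set.finite_range fun b => |Real.log (μ.real (Q ⁻¹' {b}))|).bddAbove
  exact ⟨C, fun x => by rw [infoFun, abs_neg]; exact hC ⟨Q x, rfl⟩⟩

theorem infoFun_nonneg [IsProbabilityMeasure μ] (Q : X → β) (x : X) : 0 ≤ infoFun μ Q x := by
  have := Real.log_nonpos (x := atomMass μ Q x) measureReal_nonneg measureReal_le_one
  rw [infoFun]; linarith

theorem integrable_infoFun [IsProbabilityMeasure μ] {Q : X → β} (hQ : Measurable Q) :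
    Integrable (infoFun μ Q) μ := by
  obtain ⟨C, hC⟩ := exists_abs_infoFun_le (μ := μ) Q
  exact Integrable.of_bound (measurable_infoFun hQ).aestronglyMeasurable C (ae_of_all _ hC)

theorem integral_infoFun [IsProbabilityMeasure μ] {Q : X → β} (hQ : Measurable Q) :
    ∫ x, infoFun μ Q x ∂μ = infoEntropy μ Q := by
  have := integral_comp_fintype (μ := μ) hQ (fun b => -Real.log (μ.real (Q ⁻¹' {b})))
  refine this.trans (Finset.sum_congr rfl fun b _ => ?_)
  simp [Real.negMulLog, Measure.real]

theorem ae_atomMass_pos [IsProbabilityMeasure μ] {Q : X → β} :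
    ∀ᵐ x ∂μ, 0 < atomMass μ Q x := by
  have : ∀ b, ∀ᵐ x ∂μ, Q x = b → 0 < atomMass μ Q x := by
    intro b
    by_cases hb : μ (Q ⁻¹' {b}) = 0
    · filter_upwards [measure_eq_zero_iff_ae_notMem.1 hb] with x hx h
      exact (hx h).elim
    · refine ae_of_all _ fun x hx => ?_
      rw [atomMass, hx]
      exact ENNReal.toReal_pos hb (measure_ne_top _ _)
  filter_upwards [ae_all_iff.2 this] with x hx
  exact hx _ rfl

/-- `-p log p ≤ p log m + 1 / m`. -/
theorem negMulLog_le_mul_log_add {p m : ℝ} (hp : 0 ≤ p) (hm : 0 < m) :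
    -(p * Real.log p) ≤ p * Real.log m + 1 / m := by
  rcases hp.eq_or_lt with rfl | hp
  · simp; positivity
  · have h1 := Real.log_le_self (x := 1 / (p * m)) (by positivity)
    rw [one_div, Real.log_inv, Real.log_mul hp.ne' hm.ne'] at h1
    have h2 := mul_le_mul_of_nonneg_left h1 hp.le
    have : p * (p * m)⁻¹ = 1 / m := by field_simp
    rw [this] at h2
    linarith

theorem integral_infoFun_indicator_le [IsProbabilityMeasure μ] {Q : X → β} (hQ : Measurable Q)
    (p : β → Prop) [DecidablePred p] :
    ∫ x, (if p (Q x) then infoFun μ Q x else 0) ∂μ ≤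
      μ.real {x | p (Q x)} * Real.log (Fintype.card β) + 1 := by
  have hne : Nonempty X := nonempty_of_isProbabilityMeasure μ
  have : Nonempty β := hne.map Q
  have hc : (0 : ℝ) < Fintype.card β := by exact_mod_cast Fintype.card_pos
  have := integral_comp_fintype (μ := μ) hQ
    (fun b => if p b then -Real.log (μ.real (Q ⁻¹' {b})) else 0)
  refine this.le.trans ?_
  rw [measureReal_setOf_comp hQ, Finset.sum_mul]
  have h1 : (1 : ℝ) = ∑ b : β, 1 / (Fintype.card β : ℝ) := by
    simp [hc.ne']
  rw [h1, ← Finset.sum_add_distrib]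
  refine Finset.sum_le_sum fun b _ => ?_
  split_ifs
  · have := negMulLog_le_mul_log_add (p := μ.real (Q ⁻¹' {b})) measureReal_nonneg hc
    linarith
  · simp

theorem infoEntropy_nonneg [IsProbabilityMeasure μ] (Q : X → β) : 0 ≤ infoEntropy μ Q :=
  Finset.sum_nonneg fun _ _ => Real.negMulLog_nonneg measureReal_nonneg measureReal_le_one

theorem infoEntropy_le [IsProbabilityMeasure μ] {Q : X → β} (hQ : Measurable Q) :
    infoEntropy μ Q ≤ Real.log (Fintype.card β) + 1 := by
  have := integral_infoFun_indicator_le (μ := μ) hQ (fun _ => True)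
  simpa [integral_infoFun hQ] using this

end FiniteObservables

section EntropyLiminf

variable {X : Type*} [MeasurableSpace X] {μ : Measure X} [IsProbabilityMeasure μ] {T : X → X}
  {α : Type*} [Fintype α] [MeasurableSpace α] [MeasurableSingletonClass α] {P : X → α}

theorem entropyWrt_eq (T : X → X) (P : X → α) :
    entropyWrt μ T P = atTop.liminf fun n : ℕ => infoEntropy μ (itinerary T P n) / n := rfl

theorem infoEntropy_itinerary_div_nonneg (n : ℕ) :
    0 ≤ infoEntropy μ (itinerary T P n) / n :=
  div_nonneg (infoEntropy_nonneg _) (Nat.cast_nonneg n)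

theorem infoEntropy_itinerary_div_le (hT : Measurable T) (hP : Measurable P) (n : ℕ) :
    infoEntropy μ (itinerary T P n) / n ≤ Real.log (Fintype.card α) + 1 := by
  have hlog : 0 ≤ Real.log (Fintype.card α) := Real.log_natCast_nonneg _
  rcases Nat.eq_zero_or_pos n with rfl | hn
  · simp; linarith
  · have hn1 : (1 : ℝ) ≤ n := by exact_mod_cast hn
    rw [div_le_iff₀ (by positivity)]
    refine (infoEntropy_le (measurable_itinerary hT hP n)).trans ?_
    simp only [Fintype.card_pi, Finset.prod_const, Finset.card_univ, Fintype.card_fin,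
      Nat.cast_pow, Real.log_pow]
    nlinarith

theorem isBoundedUnder_ge_entropy :
    IsBoundedUnder (· ≥ ·) atTop fun n : ℕ => infoEntropy μ (itinerary T P n) / n :=
  isBoundedUnder_of ⟨0, fun _ => infoEntropy_itinerary_div_nonneg _⟩

theorem isCoboundedUnder_ge_entropy (hT : Measurable T) (hP : Measurable P) :
    IsCoboundedUnder (· ≥ ·) atTop fun n : ℕ => infoEntropy μ (itinerary T P n) / n :=
  (isBoundedUnder_of ⟨_, fun n => infoEntropy_itinerary_div_le hT hP n⟩ :
    IsBoundedUnder (· ≤ ·) atTop _).isCoboundedUnder_ge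

theorem entropyWrt_nonneg (hT : Measurable T) (hP : Measurable P) : 0 ≤ entropyWrt μ T P := by
  rw [entropyWrt_eq]
  exact le_liminf_of_le (isCoboundedUnder_ge_entropy hT hP)
    (Eventually.of_forall fun n => infoEntropy_itinerary_div_nonneg n)

theorem frequently_infoEntropy_lt (hT : Measurable T) (hP : Measurable P) {δ : ℝ} (hδ : 0 < δ) :
    ∃ᶠ n : ℕ in atTop, infoEntropy μ (itinerary T P n) / n < entropyWrt μ T P + δ := by
  apply frequently_lt_of_liminf_lt (isCoboundedUnder_ge_entropy hT hP)
  rw [← entropyWrt_eq]; linarith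

theorem eventually_lt_infoEntropy {δ : ℝ} (hδ : 0 < δ) :
    ∀ᶠ n : ℕ in atTop, entropyWrt μ T P - δ < infoEntropy μ (itinerary T P n) / n := by
  apply eventually_lt_of_lt_liminf _ isBoundedUnder_ge_entropy
  rw [← entropyWrt_eq]; linarith

end EntropyLiminf

section AEP

/-- Extension of a finite word by a constant letter. -/
def wordExt {α : Type*} (a0 : α) {N : ℕ} (w : Fin N → α) (t : ℕ) : α :=
  if h : t < N then w ⟨t, h⟩ else a0

theorem wordExt_of_lt {α : Type*} (a0 : α) {N : ℕ} (w : Fin N → α) {t : ℕ} (h : t < N) :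
    wordExt a0 w t = w ⟨t, h⟩ := dif_pos h

/-- The block of length `n` of the word `w` that starts at position `t`. -/
def wordBlock {α : Type*} (a0 : α) (n : ℕ) {N : ℕ} (w : Fin N → α) (t : ℕ) : Fin n → α :=
  fun i => wordExt a0 w (t + i)

/-- Summing, over all words of length `N`, the product of the weights of consecutive
`n`-blocks at phase `s` gives at most the number of words of length `3 * n`. -/
theorem sum_prod_block_le {α : Type*} [Fintype α] (a0 : α) {n M N s : ℕ} (hs : s < n)
    (hN2 : N ≤ (M + 2) * n) (p : (Fin n → α) → ℝ) (hp : ∀ b, 0 ≤ p b)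
    (hp1 : ∑ b, p b ≤ 1) :
    ∑ w : Fin N → α, ∏ j : Fin M, p (wordBlock a0 n w (s + j * n)) ≤
      (Fintype.card α : ℝ) ^ (3 * n) := by
  classical
  let F : (Fin N → α) → (Fin M → Fin n → α) × ((Fin n → α) × (Fin (2 * n) → α)) := fun w =>
    (fun j => wordBlock a0 n w (s + j * n), fun i => wordExt a0 w i,
      fun i => wordExt a0 w (N - 2 * n + i))
  have hF : Function.Injective F := by
    intro w w' h
    ext ⟨t, ht⟩
    rw [← wordExt_of_lt a0 w ht, ← wordExt_of_lt a0 w' ht]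
    have h1 := congrArg Prod.fst h
    have h2 := congrArg (fun z => z.2.1) h
    have h3 := congrArg (fun z => z.2.2) h
    rcases lt_or_ge t n with h4 | h4
    · exact congrFun h2 ⟨t, h4⟩
    rcases lt_or_ge t (N - 2 * n) with h5 | h5
    · have hn : 0 < n := by omega
      have h6 : (t - s) / n < M := by
        rw [Nat.div_lt_iff_lt_mul hn]
        have : (M + 2) * n = M * n + 2 * n := by ring
        omega
      have h7 := congrFun (congrFun h1 ⟨(t - s) / n, h6⟩) ⟨(t - s) % n, Nat.mod_lt _ hn⟩
      have h8 : s + (t - s) / n * n + (t - s) % n = t := by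
        have := Nat.div_add_mod' (t - s) n
        omega
      simp only [F, wordBlock] at h7
      rwa [h8] at h7
    · have h7 := congrFun h3 ⟨t - (N - 2 * n), by omega⟩
      simp only [F] at h7
      rwa [Nat.add_sub_cancel' h5] at h7
  calc ∑ w : Fin N → α, ∏ j : Fin M, p (wordBlock a0 n w (s + j * n))
      = ∑ w : Fin N → α, (fun z : (Fin M → Fin n → α) × ((Fin n → α) × (Fin (2 * n) → α)) =>
          ∏ j : Fin M, p (z.1 j)) (F w) := rfl
    _ = ∑ z ∈ Finset.univ.image F, (fun z : (Fin M → Fin n → α) × ((Fin n → α) × (Fin (2 * n) → α)) =>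
          ∏ j : Fin M, p (z.1 j)) z := by
        rw [Finset.sum_image fun _ _ _ _ h => hF h]
    _ ≤ ∑ z : (Fin M → Fin n → α) × ((Fin n → α) × (Fin (2 * n) → α)), ∏ j : Fin M, p (z.1 j) :=
        Finset.sum_le_sum_of_subset_of_nonneg (Finset.subset_univ _) fun z _ _ =>
          Finset.prod_nonneg fun j _ => hp _
    _ = (Fintype.card α : ℝ) ^ (3 * n) * ∏ _j : Fin M, ∑ b, p b := by
        rw [Finset.prod_univ_sum, Fintype.piFinset_univ, Fintype.sum_prod_type, Finset.mul_sum]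
        refine Finset.sum_congr rfl fun z _ => ?_
        simp only [Finset.sum_const, Finset.card_univ, Fintype.card_prod, Fintype.card_pi,
          Finset.prod_const, Fintype.card_fin, nsmul_eq_mul]
        push_cast
        ring
    _ ≤ (Fintype.card α : ℝ) ^ (3 * n) * 1 := by
        gcongr
        exact Finset.prod_le_one (fun _ _ => Finset.sum_nonneg fun b _ => hp b) fun _ _ => hp1
    _ = _ := mul_one _

variable {X : Type*} [MeasurableSpace X] {μ : Measure X} [IsProbabilityMeasure μ] {T : X → X}
  {α : Type*} [Fintype α] [MeasurableSpace α] [MeasurableSingletonClass α] {P : X → α}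

/-- A sub-probability (up to a constant) on words is rarely much larger than the distribution. -/
theorem measureReal_atomMass_lt_le {β : Type*} [Fintype β] [MeasurableSpace β]
    [MeasurableSingletonClass β] {Q : X → β} (hQ : Measurable Q) (q : β → ℝ)
    {C c : ℝ} (hq0 : ∀ b, 0 ≤ q b) (hq : ∑ b, q b ≤ C) (hc : 0 ≤ c) :
    μ.real {x | atomMass μ Q x < c * q (Q x)} ≤ c * C := by
  classical
  have := measureReal_setOf_comp (μ := μ) hQ (fun b => μ.real (Q ⁻¹' {b}) < c * q b)
  refine this.le.trans ?_
  calc _ ≤ ∑ b, c * q b := Finset.sum_le_sum fun b _ => by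
        split_ifs with h
        · exact h.le
        · exact mul_nonneg hc (hq0 b)
    _ ≤ c * C := by rw [← Finset.mul_sum]; gcongr

theorem ae_infoFun_le_aux (hT : MeasurePreserving T μ μ) (a0 : α)
    {n M N : ℕ} (hn : 0 < n) (hN : (M + 1) * n ≤ N) :
    ∀ᵐ x ∂μ, Real.exp (-((∑ t ∈ Finset.range N, infoFun μ (itinerary T P n) (T^[t] x)) / n)) ≤
      ∑ s ∈ Finset.range n, ∏ j : Fin M, μ.real (itinerary T P n ⁻¹'
        {wordBlock a0 n (itinerary T P N x) (s + j * n)}) := by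
  have h1 : ∀ᵐ x ∂μ, ∀ t, 0 < atomMass μ (itinerary T P n) (T^[t] x) := by
    rw [ae_all_iff]
    intro t
    exact (hT.iterate t).quasiMeasurePreserving.ae ae_atomMass_pos
  filter_upwards [h1] with x hx
  set I := fun t => infoFun μ (itinerary T P n) (T^[t] x) with hI
  have hI0 : ∀ t, 0 ≤ I t := fun t => infoFun_nonneg _ _
  have h2 : ∀ s ∈ Finset.range n, ∏ j : Fin M, μ.real (itinerary T P n ⁻¹'
        {wordBlock a0 n (itinerary T P N x) (s + j * n)}) =
        Real.exp (-∑ j ∈ Finset.range M, I (s + j * n)) := by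
    intro s hs
    rw [← Finset.sum_neg_distrib, Real.exp_sum, ← Fin.prod_univ_eq_prod_range
      (fun j => Real.exp (-I (s + j * n)))]
    refine Finset.prod_congr rfl fun j _ => ?_
    simp only [hI, infoFun, neg_neg]
    rw [Real.exp_log (hx _), atomMass]
    congr 3
    ext i
    have hlt : s + (j : ℕ) * n + i < N := by
      have h3 := Finset.mem_range.1 hs
      have h4 := j.2
      have h5 := i.2
      have : (j + 1 : ℕ) * n ≤ M * n := Nat.mul_le_mul_right _ h4
      have h6 : (M + 1) * n = M * n + n := by ring
      have h7 : (j + 1 : ℕ) * n = j * n + n := by ring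
      omega
    rw [wordBlock, wordExt_of_lt _ _ hlt, itinerary, itinerary, ← Function.iterate_add_apply]
    congr 2
    simp only []
    ring_nf
  rw [Finset.sum_congr rfl h2]
  have h3 : ∑ s ∈ Finset.range n, ∑ j ∈ Finset.range M, I (s + j * n) ≤
      ∑ t ∈ Finset.range N, I t := by
    rw [← Finset.sum_product']
    rw [← Finset.sum_image (s := Finset.range n ×ˢ Finset.range M)
      (g := fun z : ℕ × ℕ => z.1 + z.2 * n) (f := I)]
    · refine Finset.sum_le_sum_of_subset_of_nonneg ?_ fun t _ _ => hI0 t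
      intro t ht
      simp only [Finset.mem_image, Finset.mem_product, Finset.mem_range, Prod.exists] at ht ⊢
      obtain ⟨s, j, ⟨h4, h5⟩, rfl⟩ := ht
      have : (j + 1 : ℕ) * n ≤ M * n := Nat.mul_le_mul_right _ h5
      have h6 : (M + 1) * n = M * n + n := by ring
      have h7 : (j + 1 : ℕ) * n = j * n + n := by ring
      omega
    · rintro ⟨s, j⟩ h ⟨s', j'⟩ h' heq
      simp only [Finset.coe_product, Finset.coe_range, mem_prod, mem_Iio] at h h' heq
      have e1 := congrArg (· % n) heq
      have e2 := congrArg (· / n) heq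
      simp only [Nat.add_mul_mod_self_right, Nat.mod_eq_of_lt h.1, Nat.mod_eq_of_lt h'.1,
        Nat.add_mul_div_right _ _ hn, Nat.div_eq_of_lt h.1, Nat.div_eq_of_lt h'.1, zero_add] at e1 e2
      rw [e1, e2]
  obtain ⟨s, hs, hs2⟩ : ∃ s ∈ Finset.range n, ∑ j ∈ Finset.range M, I (s + j * n) ≤
      (∑ t ∈ Finset.range N, I t) / n := by
    by_contra! hcon
    have := Finset.sum_lt_sum_of_nonempty (Finset.nonempty_range_iff.2 hn.ne') hcon
    rw [Finset.sum_const, Finset.card_range, nsmul_eq_mul, mul_div_cancel₀] at this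
    · linarith
    · positivity
  calc _ ≤ Real.exp (-∑ j ∈ Finset.range M, I (s + j * n)) := by
        apply Real.exp_le_exp.2; linarith
    _ ≤ _ := Finset.single_le_sum (f := fun s => Real.exp (-∑ j ∈ Finset.range M, I (s + j * n)))
        (fun _ _ => (Real.exp_pos _).le) hs

/-- Upper half of the Shannon–McMillan theorem. -/
theorem eventually_measureReal_infoFun_gt_le (hT : Ergodic T μ) (hP : Measurable P) {δ : ℝ}
    (hδ : 0 < δ) {β : ℝ} (hβ : 0 < β) :
    ∀ᶠ N : ℕ in atTop, μ.real {x | N * (entropyWrt μ T P + δ) <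
      infoFun μ (itinerary T P N) x} ≤ β := by
  have hTm := hT.measurable
  obtain ⟨x0⟩ := nonempty_of_isProbabilityMeasure μ
  set h := entropyWrt μ T P
  obtain ⟨n, hn, hn1⟩ := ((frequently_infoEntropy_lt (μ := μ) hTm hP
    (show 0 < δ / 4 by positivity)).and_eventually (eventually_gt_atTop 0)).exists
  have hn' : (0 : ℝ) < n := by exact_mod_cast hn1
  set I := infoFun μ (itinerary T P n)
  obtain ⟨C, hC⟩ := exists_abs_infoFun_le (μ := μ) (itinerary T P n)
  have hmean := hT.tendsto_measureReal_birkhoffAverage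
    (measurable_infoFun (measurable_itinerary hTm hP n)) hC (ε := n * (δ / 4)) (by positivity)
  set K : ℝ := n * (Fintype.card α : ℝ) ^ (3 * n)
  have hexp : Tendsto (fun N : ℕ => Real.exp (-((δ / 4) * N)) * K) atTop (nhds (0 * K)) := by
    refine Tendsto.mul_const _ (Real.tendsto_exp_neg_atTop_nhds_zero.comp ?_)
    exact tendsto_natCast_atTop_atTop.const_mul_atTop (by positivity)
  rw [zero_mul] at hexp
  filter_upwards [hmean.eventually_le_const (show 0 < β / 2 by positivity),
    hexp.eventually_le_const (show 0 < β / 2 by positivity), eventually_ge_atTop (3 * n)]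
    with N hN1 hN2 hN3
  set M := N / n - 1 with hM
  have hNn : N / n * n + N % n = N := Nat.div_add_mod' N n
  have hdiv : 1 ≤ N / n := (Nat.one_le_div_iff hn1).2 (by omega)
  have hMn : M + 1 = N / n := by omega
  have hMN : (M + 1) * n ≤ N := by rw [hMn]; exact Nat.div_mul_le_self N n
  have hMN2 : N ≤ (M + 2) * n := by
    have : (M + 2) * n = (M + 1) * n + n := by ring
    have h2 := Nat.mod_lt N hn1
    rw [this, hMn]; omega
  set q : (Fin N → α) → ℝ := fun w => ∑ s ∈ Finset.range n, ∏ j : Fin M,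
    μ.real (itinerary T P n ⁻¹' {wordBlock (P x0) n w (s + j * n)})
  have hq : ∑ w, q w ≤ K := by
    rw [Finset.sum_comm]
    calc _ ≤ ∑ s ∈ Finset.range n, (Fintype.card α : ℝ) ^ (3 * n) := by
          refine Finset.sum_le_sum fun s hs => ?_
          exact sum_prod_block_le (P x0) (Finset.mem_range.1 hs) hMN2
            (fun b => μ.real (itinerary T P n ⁻¹' {b})) (fun _ => measureReal_nonneg)
            (sum_measureReal_preimage (measurable_itinerary hTm hP n)).le
      _ = K := by simp [K]
  have hb1 := measureReal_atomMass_lt_le (μ := μ) (measurable_itinerary hTm hP N) q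
    (c := Real.exp (-((δ / 4) * N))) (fun w => Finset.sum_nonneg fun s _ =>
      Finset.prod_nonneg fun _ _ => measureReal_nonneg) hq (Real.exp_pos _).le
  have hae := ae_infoFun_le_aux (P := P) hT.toMeasurePreserving (P x0) hn1 hMN
  have hint : ∫ y, I y ∂μ ≤ n * (h + δ / 4) := by
    rw [integral_infoFun (measurable_itinerary hTm hP n)]
    rw [div_lt_iff₀ hn'] at hn
    linarith
  have hpos : (0 : ℝ) < N := by
    have : 0 < N := by omega
    exact_mod_cast this
  have hsub : μ.real {x | N * (h + δ) < infoFun μ (itinerary T P N) x} ≤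
      μ.real ({x | n * (δ / 4) ≤ |birkhoffAverage ℝ T I N x - ∫ y, I y ∂μ|} ∪
        {x | atomMass μ (itinerary T P N) x < Real.exp (-((δ / 4) * N)) *
          q (itinerary T P N x)}) := by
    apply ENNReal.toReal_mono (measure_ne_top _ _)
    apply measure_mono_ae
    filter_upwards [hae, ae_atomMass_pos (μ := μ) (Q := itinerary T P N)] with x hx hx2 hx3
    by_contra hcon
    obtain ⟨hc1, hc2⟩ := not_or.1 hcon
    simp only [mem_ofPred_eq, not_le, not_lt] at hc1 hc2
    have hc1' := hc1
    have hc2' := hc2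
    have h1 := (abs_lt.1 hc1').2
    have h2 : (∑ t ∈ Finset.range N, I (T^[t] x)) ≤ N * (n * (h + δ / 2)) := by
      have : birkhoffAverage ℝ T I N x = (∑ t ∈ Finset.range N, I (T^[t] x)) / N := by
        rw [birkhoffAverage, birkhoffSum, smul_eq_mul, inv_mul_eq_div]
      rw [this] at h1
      have h3 : (∑ t ∈ Finset.range N, I (T^[t] x)) / N ≤ n * (h + δ / 2) := by linarith
      rw [div_le_iff₀ hpos] at h3
      linarith
    have h4 : Real.exp (-(N * (h + δ * (3 / 4)))) ≤ atomMass μ (itinerary T P N) x := by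
      refine le_trans ?_ hc2'
      refine le_trans ?_ (mul_le_mul_of_nonneg_left hx (Real.exp_pos _).le)
      rw [← Real.exp_add]
      apply Real.exp_le_exp.2
      have h5 : (∑ t ∈ Finset.range N, I (T^[t] x)) / n ≤ N * (h + δ / 2) := by
        rw [div_le_iff₀ hn']; linarith
      linarith
    have h6 := Real.log_le_log (Real.exp_pos _) h4
    rw [Real.log_exp] at h6
    have h7 : N * (h + δ) < infoFun μ (itinerary T P N) x := hx3
    rw [infoFun] at h7
    nlinarith
  refine hsub.trans ((measureReal_union_le _ _).trans ?_)
  linarith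

/-- Lower half of the Shannon–McMillan theorem. -/
theorem eventually_measureReal_infoFun_lt_le (hT : Ergodic T μ) (hP : Measurable P) {δ : ℝ}
    (hδ : 0 < δ) {β : ℝ} (hβ : 0 < β) :
    ∀ᶠ N : ℕ in atTop, μ.real {x | infoFun μ (itinerary T P N) x <
      N * (entropyWrt μ T P - δ)} ≤ β := by
  classical
  have hTm := hT.measurable
  set h := entropyWrt μ T P
  have hh : 0 ≤ h := entropyWrt_nonneg hTm hP
  set Lk := Real.log (Fintype.card α)
  have hLk : 0 ≤ Lk := Real.log_natCast_nonneg _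
  -- small parameters
  set η := β * δ / (4 * (Lk + 2)) with hη
  have hηpos : 0 < η := by positivity
  have hηle : η * (Lk + 2) ≤ β * δ / 4 := by
    rw [hη]; apply le_of_eq; field_simp
  have hNη : ∀ᶠ N : ℕ in atTop, 1 / (N : ℝ) ≤ η :=
    tendsto_one_div_atTop_nhds_zero_nat.eventually_le_const hηpos
  filter_upwards [eventually_measureReal_infoFun_gt_le hT hP (show 0 < β * δ / 8 by positivity)
    hηpos, eventually_lt_infoEntropy (μ := μ) (T := T) (P := P) (show 0 < β * δ / 8 by positivity),
    hNη, eventually_gt_atTop 0] with N hN1 hN2 hN3 hN0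
  have hN : (0 : ℝ) < N := by exact_mod_cast hN0
  set Q := itinerary T P N
  have hQ : Measurable Q := measurable_itinerary hTm hP N
  set g : (Fin N → α) → ℝ := fun b => -Real.log (μ.real (Q ⁻¹' {b}))
  set u := N * (h + β * δ / 8)
  set D := {x | u < infoFun μ Q x}
  set A := {x | infoFun μ Q x < N * (h - δ)}
  have hD : MeasurableSet D := measurableSet_lt measurable_const (measurable_infoFun hQ)
  have hA : MeasurableSet A := measurableSet_lt (measurable_infoFun hQ) measurable_const
  have hI := integrable_infoFun (μ := μ) hQ
  have hgD := integral_infoFun_indicator_le (μ := μ) hQ (fun b => u < g b)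
  have hu : 0 ≤ u := by positivity
  have hpt : ∀ x, infoFun μ Q x ≤ u - (N * δ) * A.indicator (fun _ => 1) x +
      (if u < g (Q x) then infoFun μ Q x else 0) := by
    intro x
    have hgx : g (Q x) = infoFun μ Q x := rfl
    rw [hgx]
    by_cases h1 : u < infoFun μ Q x
    · have : x ∉ A := by
        intro hx
        have hx' : infoFun μ Q x < N * (h - δ) := hx
        have : 0 < N * (β * δ / 8) := by positivity
        have : 0 < N * δ := by positivity
        have : u = N * h + N * (β * δ / 8) := mul_add _ _ _
        nlinarith
      rw [if_pos h1, Set.indicator_of_notMem this]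
      linarith
    · rw [if_neg h1]
      by_cases h2 : x ∈ A
      · rw [Set.indicator_of_mem h2]
        have hx' : infoFun μ Q x < N * (h - δ) := h2
        have : 0 < N * (β * δ / 8) := by positivity
        have : u = N * h + N * (β * δ / 8) := mul_add _ _ _
        linarith
      · rw [Set.indicator_of_notMem h2]; linarith
  have hint1 : Integrable (fun x => if u < g (Q x) then infoFun μ Q x else 0) μ := by
    have : (fun x => if u < g (Q x) then infoFun μ Q x else 0) = D.indicator (infoFun μ Q) := by
      ext x; simp [Set.indicator_apply, D, g, infoFun, atomMass]
    rw [this]; exact hI.indicator hD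
  have hint2 : Integrable (fun x => u - (N * δ) * A.indicator (fun _ => (1 : ℝ)) x) μ :=
    (integrable_const _).sub (((integrable_const _).indicator hA).const_mul _)
  have hle := integral_mono hI (hint2.add hint1) hpt
  simp only [Pi.add_apply] at hle
  rw [integral_add hint2 hint1, integral_sub (integrable_const _)
    (((integrable_const _).indicator hA).const_mul _), integral_const_mul (N * δ),
    integral_indicator hA, integral_infoFun hQ] at hle
  simp only [integral_const, probReal_univ, smul_eq_mul, one_mul, mul_one,
    measureReal_restrict_apply_univ] at hle
  rw [lt_div_iff₀ hN] at hN2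
  have hcard : Real.log (Fintype.card (Fin N → α)) = N * Lk := by simp [Lk]
  have hDm : μ.real {x | u < g (Q x)} ≤ η := hN1
  rw [hcard] at hgD
  have h6 : μ.real {x | u < g (Q x)} * (N * Lk) ≤ η * (N * Lk) := by gcongr
  have h7 : 1 ≤ N * η := by
    rw [div_le_iff₀ hN] at hN3; linarith
  have h8 : N * δ * μ.real A ≤ N * δ * β := by
    have : u = N * h + N * (β * δ / 8) := mul_add _ _ _
    have : N * (η * (Lk + 2)) ≤ N * (β * δ / 4) := by gcongr
    nlinarith [mul_pos hN (mul_pos hβ hδ), mul_pos hN hηpos]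
  exact le_of_mul_le_mul_left h8 (by positivity)

/-- The Shannon–McMillan theorem (convergence in probability). -/
theorem eventually_measureReal_atomMass_le (hT : Ergodic T μ) (hP : Measurable P) {δ : ℝ}
    (hδ : 0 < δ) {β : ℝ} (hβ : 0 < β) :
    ∀ᶠ N : ℕ in atTop, μ.real {x | ¬ (Real.exp (-(N * (entropyWrt μ T P + δ))) ≤
      atomMass μ (itinerary T P N) x ∧ atomMass μ (itinerary T P N) x ≤
        Real.exp (-(N * (entropyWrt μ T P - δ))))} ≤ β := by
  filter_upwards [eventually_measureReal_infoFun_gt_le hT hP hδ (half_pos hβ),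
    eventually_measureReal_infoFun_lt_le hT hP hδ (half_pos hβ)] with N h1 h2
  refine le_trans (ENNReal.toReal_mono (measure_ne_top _ _) (measure_mono_ae ?_))
    ((measureReal_union_le _ _).trans ((add_le_add h1 h2).trans_eq (add_halves β)))
  filter_upwards [ae_atomMass_pos (μ := μ) (Q := itinerary T P N)] with x hx hx2
  by_contra hcon
  obtain ⟨h3, h4⟩ := not_or.1 hcon
  simp only [mem_ofPred_eq, not_lt, infoFun] at h3 h4
  refine hx2 ⟨?_, ?_⟩
  · rw [← Real.le_log_iff_exp_le hx]; linarith
  · rw [← Real.log_le_iff_le_exp hx]; linarith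

end AEP

section EntropyMonotone

variable {X : Type*} [MeasurableSpace X] {μ : Measure X} [IsProbabilityMeasure μ] {T : X → X}
  {α : Type*} [Fintype α] [MeasurableSpace α] [MeasurableSingletonClass α] {P : X → α}
  {β : Type*} [Fintype β] [MeasurableSpace β] [MeasurableSingletonClass β]

theorem infoEntropy_comp_le (hP : Measurable P) (f : α → β) :
    infoEntropy μ (f ∘ P) ≤ infoEntropy μ P := by
  have hf : Measurable (f ∘ P) := (Measurable.of_discrete (f := f)).comp hP
  rw [← integral_infoFun hP, ← integral_infoFun hf]
  refine integral_mono_ae (integrable_infoFun hf) (integrable_infoFun hP) ?_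
  filter_upwards [ae_atomMass_pos (μ := μ) (Q := P)] with x hx
  refine neg_le_neg (Real.log_le_log hx ?_)
  refine measureReal_mono ?_
  intro y hy
  simp only [mem_preimage, mem_singleton_iff, Function.comp] at hy ⊢
  rw [hy]

theorem entropyWrt_comp_le (hT : Measurable T) (hP : Measurable P) (f : α → β) :
    entropyWrt μ T (f ∘ P) ≤ entropyWrt μ T P := by
  rw [entropyWrt_eq, entropyWrt_eq]
  refine liminf_le_liminf (Eventually.of_forall fun n => ?_) isBoundedUnder_ge_entropy
    (isCoboundedUnder_ge_entropy hT hP)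
  have := infoEntropy_comp_le (μ := μ) (measurable_itinerary hT hP n)
    (fun w : Fin n → α => fun i => f (w i))
  exact div_le_div_of_nonneg_right this (Nat.cast_nonneg n)

theorem entropyWrt_le_ksEntropy (hT : Measurable T) (hP : Measurable P)
    (hfin : ksEntropy μ T ≠ ⊤) : entropyWrt μ T P ≤ (ksEntropy μ T).toReal := by
  set e := Fintype.equivFin α
  have h1 : entropyWrt μ T P ≤ entropyWrt μ T (e ∘ P) := by
    have := entropyWrt_comp_le (μ := μ) hT (P := e ∘ P)
      ((Measurable.of_discrete (f := e)).comp hP) e.symm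
    convert this using 2
    ext x; simp
  refine h1.trans ?_
  have h2 : ENNReal.ofReal (entropyWrt μ T (e ∘ P)) ≤ ksEntropy μ T :=
    le_iSup_of_le _ (le_iSup_of_le (e ∘ P)
      (le_iSup_of_le ((Measurable.of_discrete (f := e)).comp hP) le_rfl))
  exact (ENNReal.ofReal_le_iff_le_toReal hfin).1 h2

theorem exists_lt_entropyWrt (hT : Measurable T) (hfin : ksEntropy μ T ≠ ⊤) {ε : ℝ} (hε : 0 < ε) :
    ∃ (k : ℕ) (P : X → Fin k), Measurable P ∧ (ksEntropy μ T).toReal - ε < entropyWrt μ T P := by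
  by_cases h0 : (ksEntropy μ T).toReal - ε < 0
  · refine ⟨1, fun _ => 0, measurable_const, h0.trans_le ?_⟩
    exact entropyWrt_nonneg hT measurable_const
  · have h1 : ENNReal.ofReal ((ksEntropy μ T).toReal - ε) < ksEntropy μ T := by
      rw [ENNReal.ofReal_lt_iff_lt_toReal (not_lt.1 h0) hfin]; linarith
    rw [ksEntropy] at h1
    simp only [lt_iSup_iff] at h1
    obtain ⟨k, P, hP, h2⟩ := h1
    refine ⟨k, P, hP, ?_⟩
    exact (ENNReal.ofReal_lt_ofReal_iff_of_nonneg (not_lt.1 h0)).1 (by rw [ksEntropy]; exact h2)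

end EntropyMonotone

section Rokhlin

variable {X : Type*} [MeasurableSpace X] {μ : Measure X}

/-- The first return times to `B` are at least `n`. -/
def ReturnGE (T : X → X) (B : Set X) (n : ℕ) : Prop :=
  ∀ x ∈ B, ∀ i, 0 < i → i < n → T^[i] x ∉ B

theorem ReturnGE.mono {T : X → X} {B C : Set X} {m n : ℕ} (h : ReturnGE T B n) (hC : C ⊆ B)
    (hmn : m ≤ n) : ReturnGE T C m :=
  fun x hx i hi him hxi => h x (hC hx) i hi (him.trans_le hmn) (hC hxi)

theorem symm_iterate_iterate (T : X ≃ᵐ X) (i : ℕ) (x : X) : T.symm^[i] (T^[i] x) = x :=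
  (Function.LeftInverse.iterate T.symm_apply_apply i) x

theorem iterate_symm_iterate (T : X ≃ᵐ X) (i : ℕ) (x : X) : T^[i] (T.symm^[i] x) = x :=
  (Function.RightInverse.iterate T.apply_symm_apply i) x

theorem iterate_symm_iterate_of_le (T : X ≃ᵐ X) {i j : ℕ} (h : i ≤ j) (x : X) :
    T^[i] (T.symm^[j] x) = T.symm^[j - i] x := by
  obtain ⟨k, rfl⟩ := Nat.exists_eq_add_of_le h
  rw [Function.iterate_add_apply, iterate_symm_iterate, Nat.add_sub_cancel_left]

theorem iterate_symm_iterate_of_ge (T : X ≃ᵐ X) {i j : ℕ} (h : j ≤ i) (x : X) :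
    T^[i] (T.symm^[j] x) = T^[i - j] x := by
  obtain ⟨k, rfl⟩ := Nat.exists_eq_add_of_le' h
  rw [Function.iterate_add_apply, iterate_symm_iterate, Nat.add_sub_cancel]

theorem symm_iterate_iterate_of_ge (T : X ≃ᵐ X) {i j : ℕ} (h : j ≤ i) (x : X) :
    T.symm^[i] (T^[j] x) = T.symm^[i - j] x :=
  iterate_symm_iterate_of_ge T.symm h x

theorem symm_iterate_iterate_of_le (T : X ≃ᵐ X) {i j : ℕ} (h : i ≤ j) (x : X) :
    T.symm^[i] (T^[j] x) = T^[j - i] x :=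
  iterate_symm_iterate_of_le T.symm h x

/-- The levels `i ∈ I` of the tower over `C`. -/
def towerOver (T : X ≃ᵐ X) (C : Set X) (I : Finset ℕ) : Set X :=
  ⋃ i ∈ I, T.symm^[i] ⁻¹' C

theorem mem_towerOver {T : X ≃ᵐ X} {C : Set X} {I : Finset ℕ} {x : X} :
    x ∈ towerOver T C I ↔ ∃ i ∈ I, T.symm^[i] x ∈ C := by
  simp [towerOver]

theorem measurableSet_towerOver {T : X ≃ᵐ X} {C : Set X} (hC : MeasurableSet C) (I : Finset ℕ) :
    MeasurableSet (towerOver T C I) :=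
  Finset.measurableSet_biUnion _ fun i _ => (T.symm.measurable.iterate i) hC

theorem measurePreserving_symm {T : X ≃ᵐ X} (hT : MeasurePreserving T μ μ) :
    MeasurePreserving T.symm μ μ := hT.symm T

variable [IsProbabilityMeasure μ]

theorem measureReal_towerOver {T : X ≃ᵐ X} (hT : MeasurePreserving T μ μ) {C : Set X}
    (hC : MeasurableSet C) {n : ℕ} (hr : ReturnGE T C n) {I : Finset ℕ} (hI : ∀ i ∈ I, i < n) :
    μ.real (towerOver T C I) = I.card * μ.real C := by
  rw [towerOver, measureReal_biUnion_finset]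
  · have : ∀ i ∈ I, μ.real (T.symm^[i] ⁻¹' C) = μ.real C := fun i _ =>
      ((measurePreserving_symm hT).iterate i).measureReal_preimage hC.nullMeasurableSet
    rw [Finset.sum_congr rfl this]; simp
  · have key : ∀ i j, i < j → j < n → Disjoint (T.symm^[i] ⁻¹' C) (T.symm^[j] ⁻¹' C) := by
      intro i j hij hj
      rw [Set.disjoint_left]
      intro x hx hx'
      refine hr _ hx' (j - i) (by omega) (by omega) ?_
      rw [iterate_symm_iterate_of_le T (by omega)]
      rwa [show j - (j - i) = i by omega]
    intro i hi j hj hij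
    rcases lt_or_gt_of_ne hij with h | h
    · exact key i j h (hI j hj)
    · exact (key j i h (hI i hi)).symm
  · exact fun i _ => (T.symm.measurable.iterate i) hC

theorem measureReal_towerOver_le {T : X ≃ᵐ X} (hT : MeasurePreserving T μ μ) {C : Set X}
    (hC : MeasurableSet C) (I : Finset ℕ) :
    μ.real (towerOver T C I) ≤ I.card * μ.real C := by
  refine (measureReal_biUnion_finset_le _ _).trans ?_
  have : ∀ i ∈ I, μ.real (T.symm^[i] ⁻¹' C) = μ.real C := fun i _ =>
    ((measurePreserving_symm hT).iterate i).measureReal_preimage hC.nullMeasurableSet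
  rw [Finset.sum_congr rfl this]; simp

theorem card_mul_measureReal_le_one {T : X ≃ᵐ X} (hT : MeasurePreserving T μ μ) {C : Set X}
    (hC : MeasurableSet C) {n : ℕ} (hr : ReturnGE T C n) : n * μ.real C ≤ 1 := by
  have := measureReal_towerOver hT hC hr (I := Finset.range n) (by simp)
  rw [Finset.card_range] at this
  rw [← this]; exact measureReal_le_one

theorem exists_measurableSet_small [StandardBorelSpace X] [NullSingletonClass μ] {δ : ℝ} (hδ : 0 < δ) :
    ∃ A : Set X, MeasurableSet A ∧ μ A ≠ 0 ∧ μ.real A < δ := by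
  let _ := upgradeStandardBorel X
  let _ := TopologicalSpace.upgradeIsCompletelyMetrizable X
  obtain ⟨x, -, hx⟩ := exists_mem_forall_mem_nhdsWithin_pos_measure (μ := μ) (s := univ) (by simp)
  obtain ⟨U, hU, hUo, hUm⟩ := ({x} : Set X).exists_isOpen_lt_of_lt (μ := μ) (ENNReal.ofReal δ)
    (by simpa using hδ)
  refine ⟨U, hUo.measurableSet, (hx U ?_).ne', ?_⟩
  · rw [nhdsWithin_univ]; exact hUo.mem_nhds (hU rfl)
  · exact ENNReal.toReal_lt_of_lt_ofReal hUm

theorem ae_exists_iterate_mem {T : X → X} (hT : Ergodic T μ) {A : Set X} (hA : MeasurableSet A)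
    (hA0 : μ A ≠ 0) : ∀ᵐ x ∂μ, ∃ n, T^[n] x ∈ A := by
  set E := ⋃ n, T^[n] ⁻¹' A
  have hE : MeasurableSet E := MeasurableSet.iUnion fun n => (hT.measurable.iterate n) hA
  have hsub : T ⁻¹' E ⊆ E := by
    intro x hx
    simp only [E, mem_preimage, mem_iUnion] at hx ⊢
    obtain ⟨n, hn⟩ := hx
    exact ⟨n + 1, by rwa [Function.iterate_succ_apply]⟩
  have h := hT.ae_empty_or_univ_of_preimage_ae_le hE.nullMeasurableSet (LE.le.eventuallyLE hsub)
  rcases h with h | h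
  · exfalso
    apply hA0
    have h2 : μ E = 0 := ae_eq_empty.1 h
    refine measure_mono_null (fun x hx => ?_) h2
    exact mem_iUnion.2 ⟨0, hx⟩
  · filter_upwards [eventuallyEq_univ.1 h] with x hx
    simpa [E] using hx

/-- The Rokhlin lemma. -/
theorem exists_rokhlin [StandardBorelSpace X] [NullSingletonClass μ] {T : X ≃ᵐ X} (hT : Ergodic T μ)
    {n : ℕ} (hn : 0 < n) {δ : ℝ} (hδ : 0 < δ) :
    ∃ B : Set X, MeasurableSet B ∧ ReturnGE T B n ∧ 1 - δ ≤ n * μ.real B := by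
  classical
  have hn' : (0 : ℝ) < n := by exact_mod_cast hn
  obtain ⟨A, hA, hA0, hAδ⟩ := exists_measurableSet_small (μ := μ) (show 0 < δ / n by positivity)
  have hTs : Ergodic T.symm μ := hT.symm
  set R : ℕ → Set X := fun r => (T.symm^[r] ⁻¹' A) ∩ ⋂ j ∈ Finset.range r, (T.symm^[j] ⁻¹' A)ᶜ
  have hR : ∀ r, MeasurableSet (R r) := fun r => ((T.symm.measurable.iterate r) hA).inter
    (Finset.measurableSet_biInter _ fun j _ => ((T.symm.measurable.iterate j) hA).compl)
  have hRmem : ∀ r x, x ∈ R r ↔ T.symm^[r] x ∈ A ∧ ∀ j < r, T.symm^[j] x ∉ A := by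
    intro r x; simp [R]
  set F : Set X := ⋂ i ∈ Finset.Ico 1 n, (T^[i] ⁻¹' A)ᶜ
  have hF : MeasurableSet F := Finset.measurableSet_biInter _ fun j _ =>
    ((T.measurable.iterate j) hA).compl
  have hFmem : ∀ x, x ∈ F ↔ ∀ i, 1 ≤ i → i < n → T^[i] x ∉ A := by
    intro x; simp [F]
  refine ⟨(⋃ q : ℕ, R (q * n)) ∩ F, (MeasurableSet.iUnion fun q => hR _).inter hF, ?_, ?_⟩
  · rintro x ⟨hx, hxF⟩ i hi hin ⟨hy, -⟩
    obtain ⟨q, hq⟩ := mem_iUnion.1 hx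
    obtain ⟨q', hq'⟩ := mem_iUnion.1 hy
    rw [hRmem] at hq hq'
    rw [hFmem] at hxF
    -- first hitting time of `T^[i] x` is `q * n + i`
    have h1 : T.symm^[q * n + i] (T^[i] x) ∈ A := by
      rw [symm_iterate_iterate_of_ge T (by omega), Nat.add_sub_cancel]; exact hq.1
    have h2 : ∀ j < q * n + i, T.symm^[j] (T^[i] x) ∉ A := by
      intro j hj
      rcases lt_or_ge j i with h | h
      · rw [symm_iterate_iterate_of_le T h.le]
        exact hxF _ (by omega) (by omega)
      · rw [symm_iterate_iterate_of_ge T h]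
        exact hq.2 _ (by omega)
    have h3 : q' * n = q * n + i := by
      rcases lt_trichotomy (q' * n) (q * n + i) with h | h | h
      · exact (h2 _ h hq'.1).elim
      · exact h
      · exact (hq'.2 _ h h1).elim
    have h4 := congrArg (· % n) h3
    simp [Nat.add_mod, Nat.mod_eq_of_lt hin] at h4
    omega
  · set B := (⋃ q : ℕ, R (q * n)) ∩ F
    have hcov : ∀ᵐ y ∂μ, y ∈ towerOver T B (Finset.range n) ∨
        y ∈ ⋃ j ∈ Finset.Ico 1 n, T^[j] ⁻¹' A := by
      filter_upwards [ae_exists_iterate_mem hTs hA hA0] with y hy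
      by_contra hcon
      obtain ⟨hc1, hc2⟩ := not_or.1 hcon
      set r := Nat.find hy
      have hr1 : T.symm^[r] y ∈ A := Nat.find_spec hy
      have hr2 : ∀ j < r, T.symm^[j] y ∉ A := fun j hj => Nat.find_min hy hj
      have hdm := Nat.div_add_mod' r n
      have hm := Nat.mod_lt r hn
      apply hc1
      rw [mem_towerOver]
      refine ⟨r % n, Finset.mem_range.2 hm, mem_iUnion.2 ⟨r / n, ?_⟩, ?_⟩
      · rw [hRmem]
        simp only [← Function.iterate_add_apply]
        rw [hdm]
        exact ⟨hr1, fun j hj => hr2 _ (by omega)⟩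
      · rw [hFmem]
        intro l hl1 hl2
        rcases le_or_gt l (r % n) with h | h
        · rw [iterate_symm_iterate_of_le T h]
          exact hr2 _ (by omega)
        · rw [iterate_symm_iterate_of_ge T h.le]
          intro h5
          apply hc2
          simp only [mem_iUnion, mem_preimage]
          exact ⟨l - r % n, by simp; omega, h5⟩
    have hBm : MeasurableSet B := (MeasurableSet.iUnion fun q => hR _).inter hF
    have h1 : (1 : ℝ) ≤ μ.real (towerOver T B (Finset.range n) ∪
        ⋃ j ∈ Finset.Ico 1 n, T^[j] ⁻¹' A) := by
      have h0 : (towerOver T B (Finset.range n) ∪ ⋃ j ∈ Finset.Ico 1 n, T^[j] ⁻¹' A : Set X)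
          =ᵐ[μ] univ := eventuallyEq_univ.2 hcov
      rw [measureReal_def, measure_congr h0]
      simp
    have h2 := measureReal_towerOver_le hT.toMeasurePreserving hBm (Finset.range n)
    rw [Finset.card_range] at h2
    have h3 : μ.real (⋃ j ∈ Finset.Ico 1 n, T^[j] ⁻¹' A) ≤ δ := by
      refine (measureReal_biUnion_finset_le _ _).trans ?_
      have : ∀ j ∈ Finset.Ico 1 n, μ.real (T^[j] ⁻¹' A) = μ.real A := fun j _ =>
        (hT.toMeasurePreserving.iterate j).measureReal_preimage hA.nullMeasurableSet
      rw [Finset.sum_congr rfl this]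
      simp only [Finset.sum_const, Nat.card_Ico, nsmul_eq_mul]
      rw [lt_div_iff₀ hn'] at hAδ
      have h4 : ((n - 1 : ℕ) : ℝ) ≤ n := by exact_mod_cast Nat.sub_le n 1
      nlinarith [measureReal_nonneg (μ := μ) (s := A)]
    have h4 := measureReal_union_le (μ := μ) (towerOver T B (Finset.range n))
      (⋃ j ∈ Finset.Ico 1 n, T^[j] ⁻¹' A)
    linarith

end Rokhlin

section FinObs

variable {X : Type*} [MeasurableSpace X]

/-- A map with finite range and measurable fibres. -/
def IsFinObs {Z : Type*} (f : X → Z) : Prop := (range f).Finite ∧ ∀ z, MeasurableSet (f ⁻¹' {z})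

theorem IsFinObs.measurableSet_preimage {Z : Type*} {f : X → Z} (hf : IsFinObs f) (s : Set Z) :
    MeasurableSet (f ⁻¹' s) := by
  have : f ⁻¹' s = ⋃ z ∈ s ∩ range f, f ⁻¹' {z} := by
    ext x; simp
  rw [this]
  exact ((hf.1.subset inter_subset_right).measurableSet_biUnion fun z _ => hf.2 z)

theorem IsFinObs.measurable {Z : Type*} [MeasurableSpace Z] {f : X → Z} (hf : IsFinObs f) :
    Measurable f := fun s _ => hf.measurableSet_preimage s

theorem IsFinObs.comp {Z W : Type*} {f : X → Z} (hf : IsFinObs f) (φ : Z → W) :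
    IsFinObs (fun x => φ (f x)) := by
  refine ⟨?_, fun w => hf.measurableSet_preimage (φ ⁻¹' {w})⟩
  have := hf.1.image φ
  rwa [← range_comp] at this

theorem IsFinObs.comp_measurable {Z X' : Type*} [MeasurableSpace X'] {f : X → Z} (hf : IsFinObs f)
    {t : X' → X} (ht : Measurable t) : IsFinObs (fun x => f (t x)) :=
  ⟨hf.1.subset (range_comp_subset_range t f), fun z => ht (hf.2 z)⟩

theorem IsFinObs.pi {ι : Type*} [Finite ι] {Z : ι → Type*} {f : ∀ i, X → Z i}
    (hf : ∀ i, IsFinObs (f i)) : IsFinObs (fun x i => f i x) := by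
  refine ⟨?_, fun z => ?_⟩
  · refine (Set.Finite.pi' fun i => (hf i).1).subset ?_
    rintro _ ⟨x, rfl⟩ i
    exact ⟨x, rfl⟩
  · have : (fun x i => f i x) ⁻¹' {z} = ⋂ i, f i ⁻¹' {z i} := by
      ext x; simp [funext_iff]
    rw [this]
    have := Fintype.ofFinite ι
    exact MeasurableSet.iInter fun i => (hf i).2 _

theorem IsFinObs.prodMk {Z W : Type*} {f : X → Z} {g : X → W} (hf : IsFinObs f) (hg : IsFinObs g) :
    IsFinObs (fun x => (f x, g x)) := by
  refine ⟨(hf.1.prod hg.1).subset ?_, fun z => ?_⟩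
  · rintro _ ⟨x, rfl⟩
    exact ⟨⟨x, rfl⟩, ⟨x, rfl⟩⟩
  · have : (fun x => (f x, g x)) ⁻¹' {z} = f ⁻¹' {z.1} ∩ g ⁻¹' {z.2} := by
      ext x; simp [Prod.ext_iff]
    rw [this]
    exact (hf.2 _).inter (hg.2 _)

theorem isFinObs_mem {B : Set X} (hB : MeasurableSet B) : IsFinObs (fun x => x ∈ B) := by
  refine ⟨Set.toFinite _, fun p => ?_⟩
  by_cases hp : p
  · convert hB using 1; ext x; simp [hp]
  · convert hB.compl using 1; ext x; simp [hp]

theorem isFinObs_of_finite {Z : Type*} [Finite Z] [MeasurableSpace Z] [MeasurableSingletonClass Z]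
    {f : X → Z} (hf : Measurable f) : IsFinObs f :=
  ⟨Set.toFinite _, fun z => hf (measurableSet_singleton z)⟩

theorem IsFinObs.exists_choice {Z Y : Type*} [Nonempty Y] {f : X → Z} (hf : IsFinObs f)
    (R : X → Y → Prop) (hR : ∀ x, ∃ y, R x y)
    (hinv : ∀ x x', f x = f x' → ∀ y, R x y → R x' y) : ∃ g : X → Y, IsFinObs g ∧ ∀ x, R x (g x) := by
  classical
  choose y hy using hR
  refine ⟨fun x => (fun z => if h : ∃ x, f x = z then y h.choose else Classical.arbitrary Y) (f x),
    hf.comp (fun z => if h : ∃ x, f x = z then y h.choose else Classical.arbitrary Y), fun x => ?_⟩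
  have h : ∃ x', f x' = f x := ⟨x, rfl⟩
  simp only [dif_pos h]
  exact hinv _ _ h.choose_spec _ (hy _)

end FinObs

section Specification

variable {Y : Type*} [MetricSpace Y]

/-- Orbit segments of length at most `L`, separated by gaps of length at least `m`, can be
simultaneously `ε`-shadowed. -/
def SpecAt (S : Y → Y) (ε : ℝ) (L m : ℕ) : Prop :=
  ∀ (J : Finset ℕ) (len : ℕ → ℕ) (x : ℕ → Y), (∀ s ∈ J, len s ≤ L) →
    (∀ s ∈ J, ∀ s' ∈ J, s < s' → s + len s + m ≤ s') →
    ∃ y, ∀ s ∈ J, ∀ i < len s, dist (S^[s + i] y) (S^[i] (x s)) ≤ ε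

/-- Specification with gaps that are sublinear in the length of the segments. -/
def HasSpec (S : Y → Y) : Prop :=
  ∀ ε : ℝ, 0 < ε → ∀ κ : ℝ, 0 < κ → ∃ ℓ₀ : ℕ, ∀ L ≥ ℓ₀, ∃ m : ℕ, (m : ℝ) ≤ κ * L ∧ SpecAt S ε L m

end Specification

section Exactify

variable {X : Type*} [MeasurableSpace X] {μ : Measure X} [IsProbabilityMeasure μ]
  {Y : Type*} [MetricSpace Y]

/-- One refinement step: nest the columns over `B` into much longer columns. -/
theorem exists_longer_columns [StandardBorelSpace X] [NullSingletonClass μ] [Nonempty Y]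
    {T : X ≃ᵐ X} (hT : Ergodic T μ) {S : Y → Y} (hS : HasSpec S) {η η' τ : ℝ} (hη' : 0 < η')
    (hτ : 0 < τ) {N m : ℕ} (hsp : SpecAt S η N m) {B : Set X} (hB : MeasurableSet B)
    (hr : ReturnGE T B (N + m)) {g : X → Y} (hg : IsFinObs g) :
    ∃ (N' m' : ℕ) (B' : Set X) (g' : X → Y), SpecAt S η' N' m' ∧ MeasurableSet B' ∧
      ReturnGE T B' (N' + m') ∧ IsFinObs g' ∧ N + 1 ≤ N' ∧
      (N + 1) * (1 - (N' - N - 1) * μ.real B') ≤ τ ∧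
      ∀ x t, T^[t] x ∈ B → t + N ≤ N' → ∀ i < N,
        dist (S^[t + i] (g' x)) (S^[i] (g (T^[t] x))) ≤ η := by
  classical
  set σ : ℝ := τ / (N + 1) with hσ
  have hσ0 : 0 < σ := by positivity
  obtain ⟨ℓ₀, hℓ⟩ := hS η' hη' (σ / 4) (by positivity)
  obtain ⟨n1, hn1⟩ := exists_nat_ge (4 * (N + 1) / σ)
  set N' := max (max ℓ₀ n1) (N + 1)
  have hN'1 : ℓ₀ ≤ N' := le_trans (le_max_left _ _) (le_max_left _ _)
  have hN'2 : n1 ≤ N' := le_trans (le_max_right _ _) (le_max_left _ _)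
  have hN'3 : N + 1 ≤ N' := le_max_right _ _
  obtain ⟨m', hm', hsp'⟩ := hℓ N' hN'1
  obtain ⟨B', hB', hr', hμ⟩ := exists_rokhlin hT (n := N' + m') (by omega)
    (show 0 < σ / 4 by positivity)
  have hpat : IsFinObs (fun x (t : Fin (N' + 1)) => (T^[(t : ℕ)] x ∈ B, g (T^[(t : ℕ)] x))) :=
    IsFinObs.pi fun t => ((isFinObs_mem hB).prodMk hg).comp_measurable (T.measurable.iterate t)
  have hex : ∀ x, ∃ y, ∀ t, T^[t] x ∈ B → t + N ≤ N' → ∀ i < N,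
      dist (S^[t + i] y) (S^[i] (g (T^[t] x))) ≤ η := by
    intro x
    have hJ : ∀ s ∈ (Finset.range (N' + 1)).filter fun t => T^[t] x ∈ B,
        ∀ s' ∈ (Finset.range (N' + 1)).filter fun t => T^[t] x ∈ B, s < s' → s + N + m ≤ s' := by
      intro s hs s' hs' hlt
      simp only [Finset.mem_filter, Finset.mem_range] at hs hs'
      by_contra hcon
      refine hr _ hs.2 (s' - s) (by omega) (by omega) ?_
      rw [← Function.iterate_add_apply, Nat.sub_add_cancel hlt.le]
      exact hs'.2
    obtain ⟨y, hy⟩ := hsp _ (fun _ => N) (fun t => g (T^[t] x)) (fun _ _ => le_rfl) hJ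
    refine ⟨y, fun t ht htN i hi => hy t ?_ i hi⟩
    simp only [Finset.mem_filter, Finset.mem_range]
    exact ⟨by omega, ht⟩
  obtain ⟨g', hg', hgR⟩ := hpat.exists_choice (Y := Y)
    (fun x y => ∀ t, T^[t] x ∈ B → t + N ≤ N' → ∀ i < N,
        dist (S^[t + i] y) (S^[i] (g (T^[t] x))) ≤ η) hex (by
    intro x x' hxx y hy t ht htN i hi
    have := congrFun hxx ⟨t, by omega⟩
    simp only [Prod.mk.injEq] at this
    rw [← this.2]
    exact hy t (this.1.symm ▸ ht) htN i hi)
  refine ⟨N', m', B', g', hsp', hB', hr', hg', hN'3, ?_, hgR⟩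
  have h1 := card_mul_measureReal_le_one hT.toMeasurePreserving hB'
    (hr'.mono subset_rfl (Nat.le_add_right N' m'))
  have h2 : (4 * (N + 1) : ℝ) ≤ N' * σ := by
    rw [← div_le_iff₀ hσ0]
    exact hn1.trans (by exact_mod_cast hN'2)
  push_cast at hμ
  have h0 := measureReal_nonneg (μ := μ) (s := B')
  have h3 : (m' : ℝ) * μ.real B' ≤ σ / 4 * N' * μ.real B' := by gcongr
  have h4 : (N + 1 : ℝ) * μ.real B' ≤ N' * σ / 4 * μ.real B' := by
    gcongr; linarith
  have h6 : σ / 4 * (N' * μ.real B') ≤ σ / 4 * 1 := by gcongr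
  have h7 : (N + 1 : ℝ) * (1 - (N' - N - 1) * μ.real B') ≤ (N + 1) * σ := by
    gcongr
    nlinarith
  refine h7.trans (le_of_eq ?_)
  rw [hσ]; field_simp

/-- The map that follows the orbit of `g b` along the column of length `n` over `b ∈ B`. -/
noncomputable def columnMap (T : X ≃ᵐ X) (S : Y → Y) (B : Set X) (g : X → Y) (o : Y) : ℕ → X → Y
  | 0 => fun _ => o
  | n + 1 => by
      classical
      exact fun x => if T.symm^[n] x ∈ B then S^[n] (g (T.symm^[n] x))
        else columnMap T S B g o n x

theorem measurable_columnMap [MeasurableSpace Y] {T : X ≃ᵐ X} {S : Y → Y} (hS : Measurable S)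
    {B : Set X} (hB : MeasurableSet B) {g : X → Y} (hg : Measurable g) (o : Y) (n : ℕ) :
    Measurable (columnMap T S B g o n) := by
  induction n with
  | zero => exact measurable_const
  | succ n ih =>
    have hs := T.symm.measurable.iterate n
    exact Measurable.ite (hs hB) ((hS.iterate n).comp (hg.comp hs)) ih

theorem columnMap_apply {T : X ≃ᵐ X} {S : Y → Y} {B : Set X} {g : X → Y} (o : Y) {N : ℕ}
    (hr : ReturnGE T B N) {b : X} (hb : b ∈ B) {i n : ℕ} (hi : i < n) (hn : n ≤ N) :
    columnMap T S B g o n (T^[i] b) = S^[i] (g b) := by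
  induction n with
  | zero => omega
  | succ n ih =>
    rw [columnMap]; beta_reduce
    rcases Nat.lt_succ_iff_lt_or_eq.1 hi with h | rfl
    · rw [if_neg, ih h (by omega)]
      intro hx
      refine hr _ hx (n - i) (by omega) (by omega) ?_
      rw [symm_iterate_iterate_of_ge T h.le, iterate_symm_iterate]
      exact hb
    · rw [symm_iterate_iterate, if_pos hb]

end Exactify

theorem exists_dependent_seq {D : Type*} (G : ℕ → D → Prop) (R : ℕ → D → D → Prop) {d₀ : D}
    (h₀ : G 0 d₀) (h : ∀ k d, G k d → ∃ d', G (k + 1) d' ∧ R k d d') :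
    ∃ f : ℕ → D, f 0 = d₀ ∧ ∀ k, G k (f k) ∧ R k (f k) (f (k + 1)) := by
  classical
  choose! nxt hn using h
  let f : ℕ → D := fun k => Nat.rec d₀ (fun k d => nxt k d) k
  have hG : ∀ k, G k (f k) := fun k => by
    induction k with
    | zero => exact h₀
    | succ k ih => exact (hn k _ ih).1
  exact ⟨f, rfl, fun k => ⟨hG k, (hn k _ (hG k)).2⟩⟩

theorem measurableSet_setOf_eventually_mem {X : Type*} [MeasurableSpace X] {V : ℕ → Set X}
    (hV : ∀ k, MeasurableSet (V k)) : MeasurableSet {x | ∀ᶠ k in atTop, x ∈ V k} := by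
  have : {x | ∀ᶠ k in atTop, x ∈ V k} = ⋃ K, ⋂ k, ⋂ (_ : K ≤ k), V k := by
    ext x; simp [eventually_atTop]
  rw [this]
  exact MeasurableSet.iUnion fun K => MeasurableSet.iInter fun k => MeasurableSet.iInter fun _ => hV k

section Exactify

variable {X : Type*} [MeasurableSpace X] {μ : Measure X} [IsProbabilityMeasure μ]
  {Y : Type*} [MetricSpace Y]

/-- Limits of approximately equivariant maps with summable defects. -/
theorem exists_equivariant_limit [CompleteSpace Y] [MeasurableSpace Y] [BorelSpace Y]
    {T : X ≃ᵐ X} (hT : MeasurePreserving T μ μ) {S : Y → Y} (hSc : Continuous S) {o : Y}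
    (ho : S o = o) {Φ : ℕ → X → Y} (hΦ : ∀ k, Measurable (Φ k)) {V : ℕ → Set X}
    (hV : ∀ k, MeasurableSet (V k)) (hμV : ∑' k, μ (V k)ᶜ ≠ ∞) {η : ℝ} (hη : 0 ≤ η)
    (hd : ∀ k, ∀ x ∈ V k, dist (Φ k x) (Φ (k + 1) x) ≤ η / 2 ^ k)
    (heq : ∀ k, ∀ x ∈ V k, Φ k (T x) = S (Φ k x)) :
    ∃ Ψ : X → Y, Measurable Ψ ∧ (∀ x, Ψ (T x) = S (Ψ x)) ∧
      ∃ I, MeasurableSet I ∧ μ Iᶜ = 0 ∧ (∀ x, T x ∈ I ↔ x ∈ I) ∧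
        ∀ x ∈ I, Tendsto (fun k => Φ k x) atTop (nhds (Ψ x)) := by
  classical
  set I : Set X := {x | ∀ n, (∀ᶠ k in atTop, T^[n] x ∈ V k) ∧ ∀ᶠ k in atTop, T.symm^[n] x ∈ V k}
    with hI
  have hae : ∀ᵐ x ∂μ, ∀ᶠ k in atTop, x ∈ V k := by
    have := measure_setOfPred_frequently_eq_zero (p := fun k x => x ∉ V k) (μ := μ) hμV
    rw [← compl_mem_ae_iff] at this
    filter_upwards [this] with x hx
    simpa using hx
  have hIae : ∀ᵐ x ∂μ, x ∈ I := by
    simp only [hI, Set.mem_ofPred_eq]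
    rw [ae_all_iff]
    intro n
    exact ((hT.iterate n).quasiMeasurePreserving.ae hae).and
      (((measurePreserving_symm hT).iterate n).quasiMeasurePreserving.ae hae)
  have hIm : MeasurableSet I := by
    have : I = ⋂ n, ({x | ∀ᶠ k in atTop, T^[n] x ∈ V k} ∩ {x | ∀ᶠ k in atTop, T.symm^[n] x ∈ V k}) := by
      ext x; simp [hI]
    rw [this]
    refine MeasurableSet.iInter fun n => ?_
    exact (measurableSet_setOf_eventually_mem fun k => (T.measurable.iterate n) (hV k)).inter
      (measurableSet_setOf_eventually_mem fun k => (T.symm.measurable.iterate n) (hV k))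
  have hinv : ∀ x, T x ∈ I ↔ x ∈ I := by
    intro x
    constructor
    · intro h n
      have h1 : T.symm^[n] x = T.symm^[n + 1] (T x) := by simp
      refine ⟨?_, h1 ▸ (h (n + 1)).2⟩
      rcases n with _ | n
      · simpa using (h 1).2
      · simpa using (h n).1
    · intro h n
      refine ⟨by simpa using (h (n + 1)).1, ?_⟩
      rcases n with _ | n
      · simpa using (h 1).1
      · simpa using (h n).2
  have hconv : ∀ x ∈ I, ∃ y, Tendsto (fun k => Φ k x) atTop (nhds y) := by
    intro x hx
    obtain ⟨K, hK⟩ := eventually_atTop.1 (hx 0).1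
    have hc : CauchySeq (fun k => Φ (k + K) x) := by
      refine cauchySeq_of_le_geometric_two (C := 2 * η) fun k => ?_
      have := hd (k + K) x (hK _ (Nat.le_add_left _ _))
      rw [show k + K + 1 = k + 1 + K by ring] at this
      refine this.trans ?_
      rw [mul_div_cancel_left₀ _ (two_ne_zero)]
      gcongr
      · norm_num
      · omega
    obtain ⟨y, hy⟩ := cauchySeq_tendsto_of_complete hc
    exact ⟨y, (tendsto_add_atTop_iff_nat (f := fun k => Φ k x) K).1 hy⟩
  have : Nonempty Y := ⟨o⟩
  choose! L hL using hconv
  have hlim : ∀ x, Tendsto (fun k => if x ∈ I then Φ k x else o) atTop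
      (nhds (if x ∈ I then L x else o)) := by
    intro x
    by_cases hx : x ∈ I
    · simpa [hx] using hL x hx
    · simp [hx]
  refine ⟨fun x => if x ∈ I then L x else o, ?_, ?_, I, hIm, ?_, hinv, ?_⟩
  · refine measurable_of_tendsto_metrizable (f := fun k x => if x ∈ I then Φ k x else o)
      (fun k => Measurable.ite hIm (hΦ k) measurable_const) ?_
    rw [tendsto_pi_nhds]
    exact hlim
  · intro x
    by_cases hx : x ∈ I
    · have hx' := (hinv x).2 hx
      simp only [hx, hx', if_true]
      refine tendsto_nhds_unique (hL _ hx') ?_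
      refine ((hSc.tendsto _).comp (hL x hx)).congr' ?_
      filter_upwards [(hx 0).1] with k hk
      exact (heq k x hk).symm
    · have hx' : T x ∉ I := fun h => hx ((hinv x).1 h)
      simp [hx, hx', ho]
  · exact hIae
  · intro x hx
    simpa [hx] using hL x hx

/-- A shadowing of column patterns by exactly equivariant maps. -/
theorem exists_equivariant_shadow [StandardBorelSpace X] [NullSingletonClass μ] [CompleteSpace Y]
    [MeasurableSpace Y] [BorelSpace Y] {T : X ≃ᵐ X} (hT : Ergodic T μ) {S : Y → Y}
    (hSc : Continuous S) (hS : HasSpec S) {o : Y} (ho : S o = o) {η τ : ℝ} (hη : 0 < η)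
    (hτ : 0 < τ) {N m : ℕ} (hsp : SpecAt S η N m) {B : Set X} (hB : MeasurableSet B)
    (hr : ReturnGE T B (N + m)) {g : X → Y} (hg : IsFinObs g) :
    ∃ Ψ : X → Y, Measurable Ψ ∧ (∀ x, Ψ (T x) = S (Ψ x)) ∧
      ∃ Bad ⊆ B, MeasurableSet Bad ∧ N * μ.real Bad ≤ τ ∧
        ∀ x ∈ B \ Bad, ∀ i < N, dist (Ψ (T^[i] x)) (S^[i] (g x)) ≤ 2 * η := by
  classical
  have : Nonempty Y := ⟨o⟩
  have hTm := hT.toMeasurePreserving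
  obtain ⟨f, hf0, hf⟩ := exists_dependent_seq (D := ℕ × ℕ × Set X × (X → Y))
    (fun k d => SpecAt S (η / 2 ^ k) d.1 d.2.1 ∧ MeasurableSet d.2.2.1 ∧
      ReturnGE T d.2.2.1 (d.1 + d.2.1) ∧ IsFinObs d.2.2.2)
    (fun k d d' => d.1 + 1 ≤ d'.1 ∧
      (d.1 + 1) * (1 - (d'.1 - d.1 - 1) * μ.real d'.2.2.1) ≤ τ / 2 / 2 ^ k ∧
      ∀ x t, T^[t] x ∈ d.2.2.1 → t + d.1 ≤ d'.1 → ∀ i < d.1,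
        dist (S^[t + i] (d'.2.2.2 x)) (S^[i] (d.2.2.2 (T^[t] x))) ≤ η / 2 ^ k)
    (d₀ := (N, m, B, g)) ⟨by simpa using hsp, hB, hr, hg⟩ (by
      rintro k ⟨n, j, C, g₁⟩ ⟨h1, h2, h3, h4⟩
      obtain ⟨n', j', C', g', a1, a2, a3, a4, a5, a6, a7⟩ := exists_longer_columns hT hS
        (η' := η / 2 ^ (k + 1)) (τ := τ / 2 / 2 ^ k) (by positivity) (by positivity) h1 h2 h3 h4
      exact ⟨(n', j', C', g'), ⟨a1, a2, a3, a4⟩, a5, a6, a7⟩)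
  set n : ℕ → ℕ := fun k => (f k).1
  set C : ℕ → Set X := fun k => (f k).2.2.1
  set G : ℕ → X → Y := fun k => (f k).2.2.2
  have hCm : ∀ k, MeasurableSet (C k) := fun k => (hf k).1.2.1
  have hCr : ∀ k, ReturnGE T (C k) (n k) := fun k =>
    ((hf k).1.2.2.1).mono subset_rfl (Nat.le_add_right _ _)
  have hG : ∀ k, Measurable (G k) := fun k => (hf k).1.2.2.2.measurable
  have hn : ∀ k, n k + 1 ≤ n (k + 1) := fun k => (hf k).2.1
  have hτk : ∀ k, ((n k : ℝ) + 1) * (1 - (n (k + 1) - n k - 1) * μ.real (C (k + 1)))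
      ≤ τ / 2 / 2 ^ k := fun k => (hf k).2.2.1
  have hsh : ∀ k x t, T^[t] x ∈ C k → t + n k ≤ n (k + 1) → ∀ i < n k,
      dist (S^[t + i] (G (k + 1) x)) (S^[i] (G k (T^[t] x))) ≤ η / 2 ^ k := fun k => (hf k).2.2.2
  have hn0 : n 0 = N := by simp [n, hf0]
  have hC0 : C 0 = B := by simp [C, hf0]
  have hG0 : G 0 = g := by simp [G, hf0]
  clear_value n C G
  set D : ℕ → Set X := fun k => C k \ towerOver T (C (k + 1)) (Finset.range (n (k + 1) - n k + 1))
    with hD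
  have hDm : ∀ k, MeasurableSet (D k) := fun k => (hCm k).diff (measurableSet_towerOver (hCm _) _)
  have hDC : ∀ k, D k ⊆ C k := fun k => sdiff_subset
  have hnD : ∀ k, ((n k : ℝ) + 1) * μ.real (D k) ≤ τ / 2 / 2 ^ k := by
    intro k
    refine le_trans ?_ (hτk k)
    gcongr
    have h1 : μ.real (towerOver T (C (k + 1)) (Finset.range (n (k + 1) - n k)))
        = (n (k + 1) - n k : ℕ) * μ.real (C (k + 1)) := by
      rw [measureReal_towerOver hTm (hCm _) (hCr (k + 1)) (by simp; omega)]; simp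
    have h2 : D k ⊆ (towerOver T (C (k + 1)) (Finset.range (n (k + 1) - n k)))ᶜ := by
      intro x hx hx'
      refine hx.2 ?_
      rw [mem_towerOver] at hx' ⊢
      obtain ⟨i, hi, h⟩ := hx'
      exact ⟨i, by simp at hi ⊢; omega, h⟩
    have h3 := measureReal_mono (μ := μ) h2
    rw [probReal_compl_eq_one_sub (measurableSet_towerOver (hCm _) _), h1,
      Nat.cast_sub (by have := hn k; omega)] at h3
    have := measureReal_nonneg (μ := μ) (s := C (k + 1))
    linarith
  -- good base points sit inside a longer column
  have hup : ∀ k, ∀ b ∈ C k \ D k, ∃ t b', b' ∈ C (k + 1) ∧ T^[t] b' = b ∧ t + n k ≤ n (k + 1) := by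
    rintro k b ⟨hb, hb'⟩
    simp only [hD, Set.mem_sdiff, hb, true_and, not_not, mem_towerOver] at hb'
    obtain ⟨t, ht, h⟩ := hb'
    refine ⟨t, _, h, iterate_symm_iterate T t b, ?_⟩
    have := hn k
    simp at ht; omega
  set Φ : ℕ → X → Y := fun k => columnMap T S (C k) (G k) o (n k) with hΦ
  have hΦap : ∀ k, ∀ b ∈ C k, ∀ i < n k, Φ k (T^[i] b) = S^[i] (G k b) := fun k b hb i hi =>
    columnMap_apply o (hCr k) hb hi le_rfl
  have hΦd : ∀ k, ∀ b ∈ C k \ D k, ∀ i < n k,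
      dist (Φ k (T^[i] b)) (Φ (k + 1) (T^[i] b)) ≤ η / 2 ^ k := by
    intro k b hb i hi
    obtain ⟨t, b', hb', rfl, ht⟩ := hup k b hb
    rw [hΦap k _ hb.1 i hi, ← Function.iterate_add_apply, add_comm i t,
      hΦap (k + 1) b' hb' _ (by omega), dist_comm]
    exact hsh k b' t hb.1 ht i hi
  set V : ℕ → Set X := fun k => towerOver T (C k \ D k) (Finset.range (n k - 1)) with hV
  have hVm : ∀ k, MeasurableSet (V k) := fun k =>
    measurableSet_towerOver ((hCm k).diff (hDm k)) _
  have hμV : ∀ k, μ.real (V (k + 1))ᶜ ≤ τ / 2 ^ k := by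
    intro k
    have h1 : μ.real (V (k + 1)) = (n (k + 1) - 1 : ℕ) * μ.real (C (k + 1) \ D (k + 1)) := by
      rw [hV]
      dsimp only
      rw [measureReal_towerOver hTm ((hCm _).diff (hDm _))
        ((hCr (k + 1)).mono sdiff_subset le_rfl) (by simp; omega)]; simp
    rw [probReal_compl_eq_one_sub (hVm _), h1, measureReal_sdiff (hDC _) (hDm _),
      Nat.cast_sub (by have := hn k; omega)]
    have h2 := hτk k
    have h3 := hnD (k + 1)
    have h4 := measureReal_nonneg (μ := μ) (s := C (k + 1))
    have h5 := measureReal_nonneg (μ := μ) (s := D (k + 1))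
    have h6 : (τ / 2 / 2 ^ k : ℝ) + τ / 2 / 2 ^ k = τ / 2 ^ k := by ring
    have h7 : (τ / 2 / 2 ^ (k + 1) : ℝ) ≤ τ / 2 / 2 ^ k := by
      gcongr
      · norm_num
      · omega
    have h8 : 0 ≤ 1 - ((n (k + 1) : ℝ) - n k - 1) * μ.real (C (k + 1)) := by
      have := card_mul_measureReal_le_one hTm (hCm (k + 1)) (hCr (k + 1))
      nlinarith [(Nat.cast_nonneg (n k) : (0 : ℝ) ≤ n k)]
    have h9 : 0 ≤ (n k : ℝ) * (1 - ((n (k + 1) : ℝ) - n k - 1) * μ.real (C (k + 1))) := by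
      positivity
    have h10 : 0 ≤ (n k : ℝ) * μ.real (C (k + 1)) := by positivity
    push_cast
    nlinarith
  have hsum : ∑' k, μ (V k)ᶜ ≠ ∞ := by
    rw [tsum_eq_zero_add' ENNReal.summable]
    refine ENNReal.add_ne_top.2 ⟨measure_ne_top _ _, ?_⟩
    refine ne_top_of_le_ne_top (b := ENNReal.ofReal (2 * τ)) ENNReal.ofReal_ne_top ?_
    have h1 : ∀ k, μ (V (k + 1))ᶜ ≤ ENNReal.ofReal (2 * τ / 2 / 2 ^ k) := by
      intro k
      rw [← ofReal_measureReal, mul_div_cancel_left₀ _ (two_ne_zero)]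
      exact ENNReal.ofReal_le_ofReal (hμV k)
    refine (ENNReal.tsum_le_tsum h1).trans ?_
    rw [← ENNReal.ofReal_tsum_of_nonneg (fun k => by positivity) (summable_geometric_two' _),
      tsum_geometric_two']
  obtain ⟨Ψ, hΨm, hΨ, I, hIm, hI0, hIinv, hlim⟩ := exists_equivariant_limit hTm hSc ho
    (Φ := Φ) (fun k => measurable_columnMap hSc.measurable (hCm k) (hG k) o _) hVm hsum hη.le
    (fun k x hx => by
      obtain ⟨i, hi, hx⟩ := mem_towerOver.1 hx
      have := hΦd k _ hx i (by simp at hi; omega)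
      rwa [iterate_symm_iterate] at this)
    (fun k x hx => by
      obtain ⟨i, hi, hx⟩ := mem_towerOver.1 hx
      have h1 := hΦap k _ hx.1 i (by simp at hi; omega)
      have h2 := hΦap k _ hx.1 (i + 1) (by simp at hi; omega)
      rw [Function.iterate_succ_apply', iterate_symm_iterate, Function.iterate_succ_apply'] at h2
      rw [iterate_symm_iterate] at h1
      rw [h2, h1])
  have hIit : ∀ i, ∀ x ∈ I, T^[i] x ∈ I := by
    intro i x hx
    induction i with
    | zero => exact hx
    | succ i ih => rw [Function.iterate_succ_apply']; exact (hIinv _).2 ih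
  set W : ℕ → Set X := fun k => towerOver T (D k) (Finset.range (n k)) with hW
  have hWm : ∀ k, MeasurableSet (W k) := fun k => measurableSet_towerOver (hDm k) _
  set Bad' : Set X := B ∩ ⋃ k, ⋂ i, ⋂ (_ : i < N), T^[i] ⁻¹' (W k) with hBad'
  have hBad'm : MeasurableSet Bad' := hB.inter (MeasurableSet.iUnion fun k =>
    MeasurableSet.iInter fun i => MeasurableSet.iInter fun _ => (T.measurable.iterate i) (hWm k))
  refine ⟨Ψ, hΨm, hΨ, Bad' ∪ B \ I, union_subset inter_subset_left sdiff_subset,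
    hBad'm.union (hB.diff hIm), ?_, ?_⟩
  · have h0 : μ.real (B \ I) = 0 := by
      rw [measureReal_def, measure_mono_null (fun x hx => hx.2) hI0]; rfl
    have h1 : μ.real (Bad' ∪ B \ I) ≤ μ.real Bad' := by
      refine (measureReal_union_le _ _).trans ?_
      rw [h0, add_zero]
    have h2 : N * μ.real Bad' = μ.real (towerOver T Bad' (Finset.range N)) := by
      rw [measureReal_towerOver hTm hBad'm (n := N) (hr.mono inter_subset_left
        (Nat.le_add_right _ _)) (by simp)]; simp
    have h3 : towerOver T Bad' (Finset.range N) ⊆ ⋃ k, W k := by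
      intro x hx
      obtain ⟨i, hi, hx⟩ := mem_towerOver.1 hx
      obtain ⟨k, hk⟩ := mem_iUnion.1 hx.2
      have := mem_iInter₂.1 hk i (by simpa using hi)
      rw [mem_preimage, iterate_symm_iterate] at this
      exact mem_iUnion.2 ⟨k, this⟩
    have h4 : ∀ k, μ (W k) ≤ ENNReal.ofReal (τ / 2 / 2 ^ k) := by
      intro k
      rw [← ofReal_measureReal]
      refine ENNReal.ofReal_le_ofReal ?_
      refine (measureReal_towerOver_le hTm (hDm k) _).trans (le_trans ?_ (hnD k))
      simp only [Finset.card_range]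
      gcongr; linarith
    have h5 : μ (⋃ k, W k) ≤ ENNReal.ofReal τ := by
      refine (measure_iUnion_le W).trans ((ENNReal.tsum_le_tsum h4).trans ?_)
      rw [← ENNReal.ofReal_tsum_of_nonneg (fun k => by positivity) (summable_geometric_two' τ),
        tsum_geometric_two']
    calc N * μ.real (Bad' ∪ B \ I) ≤ N * μ.real Bad' := by gcongr
      _ = _ := h2
      _ ≤ μ.real (⋃ k, W k) := measureReal_mono h3
      _ ≤ τ := by
        rw [measureReal_def]
        exact ENNReal.toReal_le_of_le_ofReal hτ.le h5
  · rintro x ⟨hxB, hx⟩ i hi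
    have hxI : x ∈ I := by
      by_contra h; exact hx (Or.inr ⟨hxB, h⟩)
    have hxb : ∀ k, ∃ j < N, T^[j] x ∉ W k := by
      intro k
      by_contra! h
      exact hx (Or.inl ⟨hxB, mem_iUnion.2 ⟨k, mem_iInter₂.2 h⟩⟩)
    have hcol : ∀ k, ∃ s b, b ∈ C k \ D k ∧ T^[s] b = x ∧ s + N ≤ n k := by
      have key : ∀ k s b, b ∈ C k → T^[s] b = x → s + N ≤ n k → b ∉ D k := by
        intro k s b hb hbx hs hbD
        obtain ⟨j, hj, hjx⟩ := hxb k
        refine hjx (mem_towerOver.2 ⟨j + s, by simp; omega, ?_⟩)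
        rw [← hbx, ← Function.iterate_add_apply, symm_iterate_iterate]
        exact hbD
      intro k
      induction k with
      | zero =>
        have hx0 : x ∈ C 0 := hC0 ▸ hxB
        exact ⟨0, x, ⟨hx0, key 0 0 x hx0 rfl (by omega)⟩, rfl, by omega⟩
      | succ k ih =>
        obtain ⟨s, b, hb, hbx, hs⟩ := ih
        obtain ⟨t, b', hb', htb, ht⟩ := hup k b hb
        have hx' : T^[s + t] b' = x := by rw [Function.iterate_add_apply, htb, hbx]
        exact ⟨s + t, b', ⟨hb', key _ _ _ hb' hx' (by omega)⟩, hx', by omega⟩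
    have h0 : Φ 0 (T^[i] x) = S^[i] (g x) := by
      rw [hΦap 0 x (hC0 ▸ hxB) i (by omega), hG0]
    rw [← h0, dist_comm]
    refine dist_le_of_le_geometric_two_of_tendsto₀ (f := fun k => Φ k (T^[i] x)) (C := 2 * η)
      (fun k => ?_) (hlim _ (hIit i x hxI))
    obtain ⟨s, b, hb, rfl, hs⟩ := hcol k
    rw [← Function.iterate_add_apply, mul_div_cancel_left₀ _ (two_ne_zero)]
    exact hΦd k b hb _ (by omega)

end Exactify

section Coloring

theorem exists_proper_coloring {ι κ : Type*} [Fintype κ] (W : Finset ι) (R : ι → ι → Prop)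
    (hR : ∀ w w', R w w' → R w' w)
    (hdeg : ∀ w ∈ W, ∀ U ⊆ W, (∀ w' ∈ U, R w w') → U.card < Fintype.card κ) [Nonempty κ] :
    ∃ color : ι → κ, ∀ w ∈ W, ∀ w' ∈ W, w ≠ w' → R w w' → color w ≠ color w' := by
  classical
  suffices h : ∀ U ⊆ W, ∃ color : ι → κ,
      ∀ w ∈ U, ∀ w' ∈ U, w ≠ w' → R w w' → color w ≠ color w' from h W subset_rfl
  intro U
  induction U using Finset.induction_on with
  | empty => exact fun _ => ⟨fun _ => Classical.arbitrary κ, by simp⟩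
  | insert a U ha ih =>
    intro hU
    obtain ⟨col, hcol⟩ := ih ((Finset.subset_insert _ _).trans hU)
    have hlt : ((U.filter (R a)).image col).card < Fintype.card κ :=
      lt_of_le_of_lt Finset.card_image_le (hdeg a (hU (Finset.mem_insert_self _ _)) _
        ((Finset.filter_subset _ _).trans ((Finset.subset_insert _ _).trans hU)) (by simp))
    obtain ⟨z, hz⟩ : ∃ z, z ∉ (U.filter (R a)).image col := by
      by_contra! h
      rw [Finset.eq_univ_iff_forall.2 h, Finset.card_univ] at hlt
      exact lt_irrefl _ hlt
    have hz' : ∀ w ∈ U, R a w → col w ≠ z := fun w hw hr he =>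
      hz (Finset.mem_image.2 ⟨w, Finset.mem_filter.2 ⟨hw, hr⟩, he⟩)
    have hne : ∀ w ∈ U, w ≠ a := fun w hw h => ha (h ▸ hw)
    refine ⟨Function.update col a z, ?_⟩
    intro w hw w' hw' hww hr
    rcases Finset.mem_insert.1 hw with h1 | hu <;> rcases Finset.mem_insert.1 hw' with h2 | hu'
    · exact absurd (h1.trans h2.symm) hww
    · subst h1
      rw [Function.update_self, Function.update_of_ne (hne _ hu')]
      exact (hz' _ hu' hr).symm
    · subst h2
      rw [Function.update_self, Function.update_of_ne (hne _ hu)]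
      exact hz' _ hu (hR _ _ hr)
    · rw [Function.update_of_ne (hne _ hu), Function.update_of_ne (hne _ hu')]
      exact hcol w hu w' hu' hww hr

theorem sum_pow_hammingDist {k n : ℕ} (v : Fin n → Fin k) (s : ℝ) :
    ∑ v' : Fin n → Fin k, s ^ hammingDist v v' = (1 + (k - 1) * s) ^ n := by
  classical
  have h1 : ∀ v' : Fin n → Fin k, s ^ hammingDist v v' = ∏ i, if v i ≠ v' i then s else 1 := by
    intro v'
    rw [Finset.prod_ite, Finset.prod_const, Finset.prod_const_one, mul_one]
    rfl
  have h2 : ∀ i, ∑ a : Fin k, (if v i ≠ a then s else 1) = 1 + (k - 1) * s := by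
    intro i
    have : ∀ a : Fin k, (if v i ≠ a then s else 1) = s + if v i = a then 1 - s else 0 := by
      intro a; by_cases h : v i = a <;> simp [h]
    simp only [this, Finset.sum_add_distrib, Finset.sum_ite_eq, Finset.mem_univ, if_true]
    simp
    ring
  simp_rw [h1]
  rw [← Fintype.piFinset_univ, ← Finset.prod_univ_sum (fun _ => Finset.univ)
    (fun i a => if v i ≠ a then s else 1)]
  simp only [h2, Finset.prod_const, Finset.card_univ, Fintype.card_fin]

theorem card_mul_pow_le_exp {k n d : ℕ} (v : Fin n → Fin k) {s : ℝ} (hs : 0 < s) (hs1 : s ≤ 1)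
    {U : Finset (Fin n → Fin k)} (hU : ∀ v' ∈ U, hammingDist v v' ≤ d) :
    U.card * s ^ d ≤ Real.exp (k * s * n) := by
  calc (U.card : ℝ) * s ^ d = ∑ _v' ∈ U, s ^ d := by simp
    _ ≤ ∑ v' ∈ U, s ^ hammingDist v v' :=
        Finset.sum_le_sum fun v' hv => pow_le_pow_of_le_one hs.le hs1 (hU v' hv)
    _ ≤ ∑ v' : Fin n → Fin k, s ^ hammingDist v v' :=
        Finset.sum_le_sum_of_subset_of_nonneg (Finset.subset_univ _) fun _ _ _ => by positivity
    _ = (1 + (k - 1) * s) ^ n := sum_pow_hammingDist v s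
    _ ≤ (Real.exp (k * s)) ^ n := by
        rcases Nat.eq_zero_or_pos n with rfl | hn
        · simp
        have hk : (1 : ℝ) ≤ k := by
          have := (v ⟨0, hn⟩).pos
          exact_mod_cast this
        have : 1 + (k - 1) * s ≤ Real.exp (k * s) := by
          have := Real.add_one_le_exp (k * s)
          nlinarith
        have h0 : 0 ≤ 1 + (k - 1) * s := by nlinarith
        gcongr
    _ = Real.exp (k * s * n) := by rw [← Real.exp_nat_mul]; ring_nf

variable {X : Type*} [MeasurableSpace X] {μ : Measure X} [IsProbabilityMeasure μ]

/-- Names with mass at least `a` lying over a name of mass at most `b` number at most `b / a`. -/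
theorem card_mul_le_of_fiber {α β : Type*} [Fintype α] [MeasurableSpace α]
    [MeasurableSingletonClass α] {Q : X → α} (hQ : Measurable Q) {f : α → β} {a b : ℝ}
    {v : β} (hb : μ.real ((fun x => f (Q x)) ⁻¹' {v}) ≤ b) {U : Finset α}
    (hU : ∀ w ∈ U, f w = v ∧ a ≤ μ.real (Q ⁻¹' {w})) : U.card * a ≤ b := by
  refine le_trans ?_ hb
  calc (U.card : ℝ) * a = ∑ w ∈ U, a := by simp
    _ ≤ ∑ w ∈ U, μ.real (Q ⁻¹' {w}) := Finset.sum_le_sum fun w hw => (hU w hw).2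
    _ = μ.real (⋃ w ∈ U, Q ⁻¹' {w}) := by
        rw [measureReal_biUnion_finset]
        · intro w _ w' _ h
          exact Disjoint.preimage _ (by simpa using h)
        · exact fun w _ => hQ (measurableSet_singleton w)
    _ ≤ _ := by
        refine measureReal_mono fun x hx => ?_
        simp only [mem_iUnion] at hx
        obtain ⟨w, hw, hx⟩ := hx
        have : Q x = w := hx
        simp [this, (hU w hw).1]

/-- The coloring of names: two typical names with the same color whose projections are
close in the Hamming metric coincide. -/
theorem exists_name_coloring {α : Type*} [Fintype α] [MeasurableSpace α]
    [MeasurableSingletonClass α] {Q : X → α} (hQ : Measurable Q) {k n d : ℕ}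
    (f : α → Fin n → Fin k) {a b s : ℝ} (ha : 0 < a) (hs : 0 < s) (hs1 : s ≤ 1)
    {κ : Type*} [Fintype κ] [Nonempty κ]
    (hκ : Real.exp (k * s * n) / s ^ d * (b / a) < Fintype.card κ) :
    ∃ color : α → κ, ∀ w w', a ≤ μ.real (Q ⁻¹' {w}) → a ≤ μ.real (Q ⁻¹' {w'}) →
      μ.real ((fun x => f (Q x)) ⁻¹' {f w}) ≤ b → μ.real ((fun x => f (Q x)) ⁻¹' {f w'}) ≤ b →
      hammingDist (f w) (f w') ≤ d → color w = color w' → w = w' := by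
  classical
  obtain ⟨color, hc⟩ := exists_proper_coloring (κ := κ)
    (Finset.univ.filter fun w => a ≤ μ.real (Q ⁻¹' {w}) ∧
      μ.real ((fun x => f (Q x)) ⁻¹' {f w}) ≤ b)
    (fun w w' => hammingDist (f w) (f w') ≤ d) (fun w w' h => by rwa [hammingDist_comm]) (by
      intro w hw U hU hUw
      have h1 : (U.card : ℝ) ≤ (U.image f).card * (b / a) := by
        rw [Finset.card_eq_sum_card_image f U]
        push_cast
        rw [← nsmul_eq_mul]
        refine Finset.sum_le_card_nsmul _ _ _ fun v hv => ?_
        obtain ⟨w', hw', rfl⟩ := Finset.mem_image.1 hv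
        rw [le_div_iff₀ ha]
        have hw'2 := (Finset.mem_filter.1 (hU hw')).2
        refine card_mul_le_of_fiber hQ hw'2.2 fun u hu => ?_
        obtain ⟨hu1, hu2⟩ := Finset.mem_filter.1 hu
        exact ⟨hu2, (Finset.mem_filter.1 (hU hu1)).2.1⟩
      have hw2 := (Finset.mem_filter.1 hw).2
      have hb : 0 ≤ b := measureReal_nonneg.trans hw2.2
      have h2 := card_mul_pow_le_exp (f w) hs hs1 (U := U.image f) (d := d) (by
        intro v hv
        obtain ⟨w', hw', rfl⟩ := Finset.mem_image.1 hv
        exact hUw w' hw')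
      have h3 : ((U.image f).card : ℝ) ≤ Real.exp (k * s * n) / s ^ d := by
        rw [le_div_iff₀ (by positivity)]; exact h2
      have : (U.card : ℝ) < Fintype.card κ := by
        refine lt_of_le_of_lt (h1.trans ?_) hκ
        gcongr
      exact_mod_cast this)
  refine ⟨color, fun w w' h1 h2 h3 h4 h5 h6 => ?_⟩
  by_contra hne
  exact hc w (by simp [h1, h3]) w' (by simp [h2, h4]) hne h5 h6

end Coloring

section Names

variable {X : Type*} [MeasurableSpace X] {μ : Measure X} [IsProbabilityMeasure μ]

open Classical in
theorem eventually_frequency_le {T : X → X} (hT : Ergodic T μ) {A : Set X} (hA : MeasurableSet A)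
    {τ β : ℝ} (hτ : μ.real A < τ) (hβ : 0 < β) :
    ∀ᶠ N : ℕ in atTop, μ.real {x | ¬ (((Finset.range N).filter (fun t => T^[t] x ∈ A)).card : ℝ)
      ≤ τ * N} ≤ β := by
  classical
  have h := Ergodic.tendsto_measureReal_birkhoffAverage hT (f := A.indicator fun _ => (1 : ℝ))
    (measurable_const.indicator hA) (C := 1) (fun x => by
      by_cases hx : x ∈ A <;> simp [hx]) (sub_pos.2 hτ)
  filter_upwards [h.eventually (gt_mem_nhds hβ), eventually_gt_atTop 0] with N hN hN0
  refine le_trans (measureReal_mono fun x hx => ?_) hN.le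
  simp only [Set.mem_ofPred_eq, not_le] at hx ⊢
  rw [integral_indicator_const _ hA, smul_eq_mul, mul_one]
  refine le_trans ?_ (le_abs_self _)
  have h1 : birkhoffAverage ℝ T (A.indicator fun _ => (1 : ℝ)) N x
      = (((Finset.range N).filter (fun t => T^[t] x ∈ A)).card : ℝ) / N := by
    rw [birkhoffAverage, birkhoffSum, smul_eq_mul, inv_mul_eq_div, Finset.card_filter]
    push_cast
    rfl
  have hN0' : (0 : ℝ) < N := by exact_mod_cast hN0
  have : τ ≤ birkhoffAverage ℝ T (A.indicator fun _ => (1 : ℝ)) N x := by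
    rw [h1, le_div_iff₀ hN0']; exact hx.le
  linarith

theorem measurableSet_setOf_itinerary {T : X → X} (hT : Measurable T) {α : Type*} [Fintype α]
    [MeasurableSpace α] [MeasurableSingletonClass α] {P : X → α} (hP : Measurable P) {N : ℕ}
    (p : (Fin N → α) → Prop) : MeasurableSet {x | p (itinerary T P N x)} :=
  measurable_itinerary hT hP N (Set.toFinite {w | p w}).measurableSet

theorem eventually_exists_coloring {T : X → X} (hT : Ergodic T μ) {j k : ℕ} {Q : X → Fin j}
    (hQ : Measurable Q) (F : Fin j → Fin k) {n₁ n₂ : ℕ → ℕ} (hn₂ : Tendsto n₂ atTop atTop)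
    {δ β : ℝ} (hδ : 0 < δ) (hβ : 0 < β) :
    ∀ᶠ M in atTop, ∃ Good : Set X, MeasurableSet Good ∧ μ.real Goodᶜ ≤ β ∧
      ∀ (d C : ℕ) (s : ℝ), 0 < s → s ≤ 1 →
        Real.exp (k * s * n₂ M + d * (-Real.log s) + (n₁ M + n₂ M : ℕ) * (entropyWrt μ T Q + δ)
          - n₂ M * (entropyWrt μ T (F ∘ Q) - δ)) < C →
        ∃ color : (Fin (n₁ M + n₂ M) → Fin j) → Fin C, ∀ b ∈ Good, ∀ b' ∈ Good,
          color (itinerary T Q (n₁ M + n₂ M) b) = color (itinerary T Q (n₁ M + n₂ M) b') →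
          ((Finset.Ico (n₁ M) (n₁ M + n₂ M)).filter
            (fun t => F (Q (T^[t] b)) ≠ F (Q (T^[t] b')))).card ≤ d →
          itinerary T Q (n₁ M + n₂ M) b = itinerary T Q (n₁ M + n₂ M) b' := by
  classical
  have hF : Measurable (F ∘ Q) := (measurable_of_finite F).comp hQ
  have e1 := (tendsto_atTop_mono (fun M => Nat.le_add_left (n₂ M) (n₁ M)) hn₂).eventually
    (eventually_measureReal_atomMass_le hT hQ hδ (half_pos hβ))
  have e2 := hn₂.eventually (eventually_measureReal_atomMass_le hT hF hδ (half_pos hβ))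
  filter_upwards [e1, e2] with M h1 h2
  set N := n₁ M + n₂ M with hN
  set a := Real.exp (-(N * (entropyWrt μ T Q + δ))) with ha
  set b := Real.exp (-(n₂ M * (entropyWrt μ T (F ∘ Q) - δ))) with hb
  have m1 : MeasurableSet {x | a ≤ atomMass μ (itinerary T Q N) x} :=
    measurableSet_setOf_itinerary hT.measurable hQ
      (fun w => a ≤ μ.real (itinerary T Q N ⁻¹' {w}))
  have m2 : MeasurableSet {x | atomMass μ (itinerary T (F ∘ Q) (n₂ M)) x ≤ b} :=
    measurableSet_setOf_itinerary hT.measurable hF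
      (fun w => μ.real (itinerary T (F ∘ Q) (n₂ M) ⁻¹' {w}) ≤ b)
  have m3 := (hT.measurable.iterate (n₁ M)) m2
  refine ⟨_, m1.inter m3, ?_, ?_⟩
  · rw [compl_inter]
    refine (measureReal_union_le _ _).trans ?_
    rw [← add_halves β]
    refine add_le_add (le_trans (measureReal_mono fun x hx => ?_) h1) ?_
    · exact fun hx' => hx hx'.1
    · rw [← preimage_compl, (hT.toMeasurePreserving.iterate _).measureReal_preimage
        m2.compl.nullMeasurableSet]
      exact le_trans (measureReal_mono fun x hx => fun hx' => hx hx'.2) h2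
  · intro d C s hs hs1 hC
    have hC0 : 0 < C := by
      have := (Real.exp_pos _).trans hC
      exact_mod_cast this
    have : Nonempty (Fin C) := ⟨⟨0, hC0⟩⟩
    set f : (Fin N → Fin j) → Fin (n₂ M) → Fin k := fun w i => F (w ⟨n₁ M + i, by omega⟩) with hf
    have hfi : ∀ x, f (itinerary T Q N x) = itinerary T (F ∘ Q) (n₂ M) (T^[n₁ M] x) := by
      intro x
      funext i
      simp only [hf, itinerary, Function.comp]
      rw [← Function.iterate_add_apply, add_comm]
    have hfm : ∀ v, μ.real ((fun x => f (itinerary T Q N x)) ⁻¹' {v})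
        = μ.real (itinerary T (F ∘ Q) (n₂ M) ⁻¹' {v}) := by
      intro v
      rw [← (hT.toMeasurePreserving.iterate (n₁ M)).measureReal_preimage
        (measurable_itinerary hT.measurable hF _ (measurableSet_singleton v)).nullMeasurableSet]
      congr 1
      ext x
      simp [hfi]
    obtain ⟨color, hcol⟩ := exists_name_coloring (μ := μ) (κ := Fin C) (a := a) (b := b) (d := d)
      (measurable_itinerary hT.measurable hQ N) f (Real.exp_pos _) hs hs1 (by
        rw [Fintype.card_fin]
        refine lt_of_eq_of_lt ?_ hC
        rw [ha, hb, ← Real.exp_sub, ← Real.rpow_natCast, Real.rpow_def_of_pos hs, ← Real.exp_sub,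
          ← Real.exp_add]
        congr 1
        ring)
    refine ⟨color, fun x hx x' hx' hc hd => hcol _ _ hx.1 hx'.1 ?_ ?_ ?_ hc⟩
    · rw [hfm, hfi]; exact hx.2
    · rw [hfm, hfi]; exact hx'.2
    · refine le_trans ?_ hd
      rw [hammingDist]
      refine Finset.card_le_card_of_injOn (fun i : Fin (n₂ M) => n₁ M + i) ?_ ?_
      · intro i hi
        have hi2 := i.2
        simp [hf, itinerary] at hi ⊢
        exact ⟨by omega, hi⟩
      · intro i _ i' _ h
        have h' : n₁ M + i = n₁ M + i' := h
        exact Fin.ext (by omega)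

end Names

section Block

variable {Y : Type*} [MetricSpace Y]

theorem SpecAt.exists_of_seq {S : Y → Y} {ε : ℝ} {L m : ℕ} (h : SpecAt S ε L m) {n : ℕ}
    {st len : ℕ → ℕ} (x : ℕ → Y) (h0 : ∀ k < n, 0 < len k) (hL : ∀ k < n, len k ≤ L)
    (hst : ∀ k, k + 1 < n → st k + len k + m ≤ st (k + 1)) :
    ∃ y, ∀ k < n, ∀ i < len k, dist (S^[st k + i] y) (S^[i] (x k)) ≤ ε := by
  classical
  have hlt : ∀ a d, a + d + 1 < n → st a + len a + m ≤ st (a + d + 1) := by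
    intro a d
    induction d with
    | zero => exact hst a
    | succ d ih =>
      intro hd
      have := hst (a + d + 1) (by omega)
      have := ih (by omega)
      rw [show a + (d + 1) + 1 = a + d + 1 + 1 by ring]
      omega
  have hlt' : ∀ a b, a < b → b < n → st a + len a + m ≤ st b := by
    intro a b hab hb
    obtain ⟨d, rfl⟩ := Nat.exists_eq_add_of_lt hab
    exact hlt a d hb
  have hinj : InjOn st (Finset.range n : Set ℕ) := by
    intro a ha b hb hab
    simp only [Finset.coe_range, mem_Iio] at ha hb
    rcases lt_trichotomy a b with h | h | h
    · have := hlt' a b h hb; have := h0 a ha; omega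
    · exact h
    · have := hlt' b a h ha; have := h0 b hb; omega
  set inv := Function.invFunOn st (Finset.range n : Set ℕ)
  have hinv : ∀ k < n, inv (st k) = k := fun k hk =>
    hinj.leftInvOn_invFunOn (by simpa using hk)
  obtain ⟨y, hy⟩ := h ((Finset.range n).image st) (fun s => len (inv s)) (fun s => x (inv s))
    (by
      intro s hs
      obtain ⟨k, hk, rfl⟩ := Finset.mem_image.1 hs
      rw [Finset.mem_range] at hk
      rw [hinv k hk]; exact hL k hk)
    (by
      intro s hs s' hs' hss
      obtain ⟨k, hk, rfl⟩ := Finset.mem_image.1 hs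
      obtain ⟨k', hk', rfl⟩ := Finset.mem_image.1 hs'
      rw [Finset.mem_range] at hk hk'
      rw [hinv k hk]
      refine hlt' k k' ?_ hk'
      by_contra hcon
      rcases (not_lt.1 hcon).lt_or_eq with h' | rfl
      · have := hlt' k' k h' hk; omega
      · omega)
  refine ⟨y, fun k hk i hi => ?_⟩
  have := hy (st k) (Finset.mem_image_of_mem _ (Finset.mem_range.2 hk)) i (by rwa [hinv k hk])
  rwa [hinv k hk] at this

/-- Words made of a marker, followed by `M` cells, each containing a tour of `Z` and a content. -/
theorem exists_block {S : Y → Y} {η : ℝ} {L m c p ℓ : ℕ} (hsp : SpecAt S η L m)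
    (hc : c = p * (m + 1) + ℓ + m) (hcL : c + 1 ≤ L) (hℓ : 0 < ℓ) (q : Y) (Z cont : ℕ → Y)
    (M : ℕ) : ∃ y, (∀ i ≤ c, dist (S^[i] y) (S^[i] q) ≤ η) ∧
      (∀ j < M, ∀ i < p, dist (S^[c + 1 + m + j * c + i * (m + 1)] y) (Z i) ≤ η) ∧
      ∀ j < M, ∀ i < ℓ, dist (S^[c + 1 + m + j * c + p * (m + 1) + i] y) (S^[i] (cont j)) ≤ η := by
  classical
  obtain ⟨y, hy⟩ := hsp.exists_of_seq (n := M * (p + 1) + 1)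
    (st := fun k => match k with
      | 0 => 0
      | k + 1 => c + 1 + m + k / (p + 1) * c + k % (p + 1) * (m + 1))
    (len := fun k => match k with
      | 0 => c + 1
      | k + 1 => if k % (p + 1) < p then 1 else ℓ)
    (fun k => match k with
      | 0 => q
      | k + 1 => if k % (p + 1) < p then Z (k % (p + 1)) else cont (k / (p + 1)))
    (by rintro (_ | k) hk
        · simp
        · dsimp only; split_ifs <;> omega)
    (by rintro (_ | k) hk
        · exact hcL
        · dsimp only; split_ifs <;> omega)
    (by rintro (_ | k) hk
        · simp
        · dsimp only
          by_cases hkp : k % (p + 1) < p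
          · have h1 : (k + 1) % (p + 1) = k % (p + 1) + 1 := by
              rw [Nat.add_mod, Nat.mod_eq_of_lt (a := k % (p + 1) + 1 % (p + 1))]
              · rw [Nat.mod_eq_of_lt (a := 1)]; omega
              · rw [Nat.mod_eq_of_lt (a := 1)] <;> omega
            have h2 : (k + 1) / (p + 1) = k / (p + 1) := by
              have e1 := Nat.div_add_mod k (p + 1)
              have e2 := Nat.div_add_mod (k + 1) (p + 1)
              have : (p + 1) * ((k + 1) / (p + 1)) = (p + 1) * (k / (p + 1)) := by omega
              exact Nat.eq_of_mul_eq_mul_left (by omega) this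
            rw [if_pos hkp, h1, h2, add_mul]
            omega
          · have hkp' : k % (p + 1) = p := by
              have := Nat.mod_lt k (show 0 < p + 1 by omega); omega
            have e1 := Nat.div_add_mod k (p + 1)
            have h0 : k + 1 = (p + 1) * (k / (p + 1) + 1) := by rw [mul_add]; omega
            have h1 : (k + 1) % (p + 1) = 0 := by rw [h0]; exact Nat.mul_mod_right _ _
            have h2 : (k + 1) / (p + 1) = k / (p + 1) + 1 := by
              rw [h0]; exact Nat.mul_div_cancel_left _ (by omega)
            rw [if_neg hkp, h1, h2, hkp', add_mul (k / (p + 1))]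
            omega)
  have key : ∀ j < M, ∀ i ≤ p, (j * (p + 1) + i) % (p + 1) = i ∧ (j * (p + 1) + i) / (p + 1) = j ∧
      j * (p + 1) + i + 1 < M * (p + 1) + 1 := by
    intro j hj i hi
    have h1 : (j + 1) * (p + 1) ≤ M * (p + 1) := Nat.mul_le_mul_right _ hj
    refine ⟨?_, ?_, ?_⟩
    · rw [add_comm, Nat.add_mul_mod_self_right, Nat.mod_eq_of_lt (by omega)]
    · rw [mul_comm, Nat.mul_add_div (by omega), Nat.div_eq_of_lt (by omega), add_zero]
    · rw [add_mul] at h1; omega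
  refine ⟨y, fun i hi => ?_, fun j hj i hi => ?_, fun j hj i hi => ?_⟩
  · have := hy 0 (by omega) i (Nat.lt_succ_of_le hi)
    simpa using this
  · obtain ⟨h1, h2, h3⟩ := key j hj i hi.le
    have := hy _ h3 0
    simp only [h1, h2, hi, if_true, Nat.add_zero] at this
    simpa using this
  · obtain ⟨h1, h2, h3⟩ := key j hj p le_rfl
    have := hy _ h3 i
    simp only [h1, h2, lt_irrefl, if_false] at this
    exact this hi

/-- A marker in one block cannot be seen in another block with a positive delay. -/
theorem false_of_marker_shift {u u' : ℕ → Y} {o : Y} {r₁ r₂ e : ℝ} {c m M D : ℕ}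
    (hr : r₁ + e < r₂) (hu : ∀ t < c, dist (u t) o ≤ r₁) (hc : r₂ ≤ dist (u' c) o)
    (hM : ∀ j < M, r₂ ≤ dist (u' (c + 1 + m + j * c)) o)
    (hclose : ∀ t < c, dist (u t) (u' (D + t)) ≤ e) (hD : 1 ≤ D)
    (hD' : D + c ≤ c + 1 + m + M * c) (hmc : m + 1 ≤ c) : False := by
  have key : ∀ t < c, ¬ r₂ ≤ dist (u' (D + t)) o := by
    intro t ht h
    have h1 := hu t ht
    have h2 := hclose t ht
    have h3 := dist_triangle_left (u' (D + t)) o (u t)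
    linarith
  rcases le_or_gt D c with h | h
  · refine key (c - D) (by omega) ?_
    rwa [Nat.add_sub_cancel' h]
  rcases le_or_gt D (c + 1 + m) with h' | h'
  · have hM0 : 0 < M := by
      rcases Nat.eq_zero_or_pos M with rfl | hM
      · omega
      · exact hM
    refine key (c + 1 + m - D) (by omega) ?_
    rw [Nat.add_sub_cancel' h']
    simpa using hM 0 hM0
  · obtain ⟨x, rfl⟩ := Nat.exists_eq_add_of_lt h'
    set j := (x + 1 + (c - 1)) / c with hj
    have e1 : c * j + (x + 1 + (c - 1)) % c = x + 1 + (c - 1) := Nat.div_add_mod _ _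
    have e2 := Nat.mod_lt (x + 1 + (c - 1)) (show 0 < c by omega)
    have e3 : c * j = j * c := mul_comm _ _
    have hjM : j < M := by
      by_contra hcon
      have := Nat.mul_le_mul_right c (not_lt.1 hcon)
      omega
    refine key (j * c - (x + 1)) (by omega) ?_
    rw [show c + 1 + m + x + 1 + (j * c - (x + 1)) = c + 1 + m + j * c by omega]
    exact hM j hjM

end Block

section BlockMap

variable {X : Type*} [MeasurableSpace X] {μ : Measure X} [IsProbabilityMeasure μ]
  {Y : Type*} [MetricSpace Y]

/-- The base of a Rokhlin tower may be chosen to be almost disjoint from a small set. -/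
theorem exists_rokhlin_base [StandardBorelSpace X] [NullSingletonClass μ] {T : X ≃ᵐ X}
    (hT : Ergodic T μ) {A : Set X} (hA : MeasurableSet A) {n K : ℕ} (hK : 0 < K) {δ : ℝ}
    (hδ : 0 < δ) : ∃ B, MeasurableSet B ∧ ReturnGE T B n ∧ 1 - δ ≤ (n + K : ℕ) * μ.real B ∧
      K * μ.real (B ∩ A) ≤ μ.real A := by
  obtain ⟨B, hB, hr, hμ⟩ := exists_rokhlin hT (n := n + K) (by omega) hδ
  have hm : ∀ i, MeasurableSet (T.symm^[i] ⁻¹' B) := fun i => (T.symm.measurable.iterate i) hB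
  have hsum : ∑ i ∈ Finset.range K, μ.real (T.symm^[i] ⁻¹' B ∩ A) ≤ μ.real A := by
    rw [← measureReal_biUnion_finset]
    · refine measureReal_mono fun x hx => ?_
      simp only [mem_iUnion] at hx
      obtain ⟨i, _, hx⟩ := hx
      exact hx.2
    · have key : ∀ i j, i < j → j < K →
          Disjoint (T.symm^[i] ⁻¹' B ∩ A) (T.symm^[j] ⁻¹' B ∩ A) := by
        intro i j hij hj
        rw [Set.disjoint_left]
        rintro x ⟨hx, -⟩ ⟨hx', -⟩
        refine hr _ hx' (j - i) (by omega) (by omega) ?_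
        rw [iterate_symm_iterate_of_le T (by omega)]
        rwa [show j - (j - i) = i by omega]
      intro i hi j hj hij
      simp only [Finset.coe_range, mem_Iio] at hi hj
      rcases lt_or_gt_of_ne hij with h | h
      · exact key i j h hj
      · exact (key j i h hi).symm
    · exact fun i _ => (hm i).inter hA
  obtain ⟨i, -, hi⟩ : ∃ i ∈ Finset.range K, K * μ.real (T.symm^[i] ⁻¹' B ∩ A) ≤ μ.real A := by
    by_contra! h
    have h1 := Finset.sum_lt_sum_of_nonempty (s := Finset.range K) (by simp; omega) h
    rw [← Finset.mul_sum] at h1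
    simp only [Finset.sum_const, Finset.card_range, nsmul_eq_mul] at h1
    have hK' : (0 : ℝ) < K := by exact_mod_cast hK
    nlinarith
  refine ⟨T.symm^[i] ⁻¹' B, hm i, ?_, ?_, hi⟩
  · intro x hx t ht0 ht hx'
    refine hr _ hx t ht0 (by omega) ?_
    have hc : Function.Commute T T.symm := fun x => by simp
    rw [hc.iterate_iterate t i]
    exact hx'
  · rwa [((measurePreserving_symm hT.toMeasurePreserving).iterate i).measureReal_preimage
      hB.nullMeasurableSet]

theorem exists_pos_forall_dist_iterate_le [CompactSpace Y] {S : Y → Y} (hS : Continuous S) {η : ℝ}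
    (hη : 0 < η) (N : ℕ) :
    ∃ θ > 0, ∀ y y', dist y y' ≤ θ → ∀ i < N, dist (S^[i] y) (S^[i] y') ≤ η := by
  induction N with
  | zero => exact ⟨1, one_pos, by simp⟩
  | succ N ih =>
    obtain ⟨θ, hθ, h⟩ := ih
    obtain ⟨θ', hθ', h'⟩ := Metric.uniformContinuous_iff.1
      (CompactSpace.uniformContinuous_of_continuous (hS.iterate N)) η hη
    refine ⟨min θ (θ' / 2), by positivity, fun y y' hy i hi => ?_⟩
    rcases Nat.lt_succ_iff_lt_or_eq.1 hi with hi | rfl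
    · exact h y y' (hy.trans (min_le_left _ _)) i hi
    · exact (h' ((hy.trans (min_le_right _ _)).trans_lt (by linarith))).le

theorem exists_isFinObs_dist_iterate_le [CompactSpace Y] [MeasurableSpace Y] [BorelSpace Y]
    {S : Y → Y} (hS : Continuous S) {η : ℝ} (hη : 0 < η) (ℓ : ℕ) :
    ∃ D : Y → Y, IsFinObs D ∧ ∀ y, ∀ i < ℓ, dist (S^[i] (D y)) (S^[i] y) ≤ η := by
  classical
  rcases isEmpty_or_nonempty Y with hY | hY
  · exact ⟨id, ⟨Set.toFinite _, fun z => (hY.false z).elim⟩, fun y => (hY.false y).elim⟩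
  obtain ⟨θ, hθ, h⟩ := exists_pos_forall_dist_iterate_le hS hη ℓ
  obtain ⟨s, -, hs, hcov⟩ := finite_cover_balls_of_compact (isCompact_univ (X := Y)) hθ
  have hf : IsFinObs (fun (y : Y) (z : s) => dist y (z : Y) < θ) := by
    have := hs.to_subtype
    exact IsFinObs.pi fun z => isFinObs_mem (B := {y | dist y (z : Y) < θ}) Metric.isOpen_ball.measurableSet
  obtain ⟨D, hD, hDR⟩ := hf.exists_choice (Y := Y) (fun y z => z ∈ s ∧ dist y z < θ)
    (fun y => by
      obtain ⟨z, hz, hy⟩ := mem_iUnion₂.1 (hcov (mem_univ y))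
      exact ⟨z, hz, hy⟩)
    (fun y y' hyy z hz => ⟨hz.1, by
      have := congrFun hyy ⟨z, hz.1⟩
      simp only [eq_iff_iff] at this
      exact this.1 hz.2⟩)
  exact ⟨D, hD, fun y i hi => h _ _ (by rw [dist_comm]; exact (hDR y).2.le) i hi⟩

theorem apply_iterate_of_equivariant {T : X → X} {S : Y → Y} {Ψ : X → Y}
    (h : ∀ x, Ψ (T x) = S (Ψ x)) (n : ℕ) (x : X) : Ψ (T^[n] x) = S^[n] (Ψ x) :=
  (Function.Semiconj.iterate_right (f := Ψ) h n) x

theorem exists_block_map [StandardBorelSpace X] [NullSingletonClass μ] [CompactSpace Y]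
    [MeasurableSpace Y] [BorelSpace Y] {T : X ≃ᵐ X} (hT : Ergodic T μ) {S : Y → Y}
    (hSc : Continuous S) (hS : HasSpec S) {o : Y} (ho : S o = o) {η τ : ℝ} (hη : 0 < η)
    (hτ : 0 < τ) {L m c p ℓ M m₂ d : ℕ} (hsp : SpecAt S η L m) (hc : c = p * (m + 1) + ℓ + m)
    (hcL : c + 1 ≤ L) (hℓ : 0 < ℓ) (q : Y) (Z : ℕ → Y)
    (hsp₂ : SpecAt S η (c + 1 + m + M * c) m₂) {B : Set X} (hB : MeasurableSet B)
    (hr : ReturnGE T B (c + 1 + m + M * c + m₂)) {Ψ : X → Y} (hΨ : Measurable Ψ)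
    (hΨe : ∀ x, Ψ (T x) = S (Ψ x)) {α : Type*} {w : X → α} (hw : IsFinObs w) (code : α → ℕ → Y) :
    ∃ Ψ' : X → Y, Measurable Ψ' ∧ (∀ x, Ψ' (T x) = S (Ψ' x)) ∧ ∃ Bad ⊆ B, MeasurableSet Bad ∧
      (c + 1 + m + M * c : ℕ) * μ.real Bad ≤ τ ∧ ∀ b ∈ B \ Bad,
        (∀ i ≤ c, dist (Ψ' (T^[i] b)) (S^[i] q) ≤ 3 * η) ∧
        (∀ j < M, ∀ i < p, dist (Ψ' (T^[c + 1 + m + j * c + i * (m + 1)] b)) (Z i) ≤ 3 * η) ∧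
        (∀ j < M, j < d → ∀ i < ℓ, dist (Ψ' (T^[c + 1 + m + j * c + p * (m + 1) + i] b))
          (S^[i] (code (w b) j)) ≤ 3 * η) ∧
        (∀ j < M, d ≤ j → ∀ i < ℓ, dist (Ψ' (T^[c + 1 + m + j * c + p * (m + 1) + i] b))
          (Ψ (T^[c + 1 + m + j * c + p * (m + 1) + i] b)) ≤ 4 * η) := by
  classical
  have : Nonempty Y := ⟨o⟩
  obtain ⟨D, hD, hDd⟩ := exists_isFinObs_dist_iterate_le hSc hη ℓ
  have hobs : IsFinObs (fun b => (w b, fun j : Fin M =>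
      D (Ψ (T^[c + 1 + m + j * c + p * (m + 1)] b)))) :=
    hw.prodMk (IsFinObs.pi fun j => hD.comp_measurable (hΨ.comp (T.measurable.iterate _)))
  set cont : X → ℕ → Y := fun b j => if j < d then code (w b) j else
    if j < M then D (Ψ (T^[c + 1 + m + j * c + p * (m + 1)] b)) else o with hcont
  obtain ⟨g, hg, hgR⟩ := hobs.exists_choice (Y := Y)
    (fun b y => (∀ i ≤ c, dist (S^[i] y) (S^[i] q) ≤ η) ∧
      (∀ j < M, ∀ i < p, dist (S^[c + 1 + m + j * c + i * (m + 1)] y) (Z i) ≤ η) ∧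
      ∀ j < M, ∀ i < ℓ,
        dist (S^[c + 1 + m + j * c + p * (m + 1) + i] y) (S^[i] (cont b j)) ≤ η)
    (fun b => exists_block hsp hc hcL hℓ q Z (cont b) M)
    (fun b b' hbb y hy => by
      have h : cont b = cont b' := by
        funext j
        have h1 := congrArg Prod.fst hbb
        have h2 := congrArg Prod.snd hbb
        simp only at h1 h2
        simp only [hcont, h1]
        split_ifs with h3 h4
        · rfl
        · exact congrFun h2 ⟨j, h4⟩
        · rfl
      rw [← h]; exact hy)
  obtain ⟨Ψ', hΨ', hΨ'e, Bad, hBad, hBadm, hμ, hsh⟩ :=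
    exists_equivariant_shadow hT hSc hS ho hη hτ hsp₂ hB hr hg
  refine ⟨Ψ', hΨ', hΨ'e, Bad, hBad, hBadm, hμ, fun b hb => ?_⟩
  obtain ⟨g1, g2, g3⟩ := hgR b
  have hcell : ∀ j < M, j * c + c ≤ M * c := fun j hj => by
    have := Nat.mul_le_mul_right c hj
    rwa [Nat.succ_mul] at this
  have htri : ∀ i < c + 1 + m + M * c, ∀ z, dist (S^[i] (g b)) z ≤ η →
      dist (Ψ' (T^[i] b)) z ≤ 3 * η := fun i hi z hz => by
    have := dist_triangle (Ψ' (T^[i] b)) (S^[i] (g b)) z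
    have := hsh b hb i hi
    linarith
  refine ⟨fun i hi => htri i (by omega) _ (g1 i hi), fun j hj i hi => htri _ ?_ _ (g2 j hj i hi),
    fun j hj hjd i hi => htri _ ?_ _ ?_, fun j hj hjd i hi => ?_⟩
  · have := hcell j hj
    have := Nat.mul_le_mul_right (m + 1) (Nat.succ_le_of_lt hi)
    rw [Nat.succ_mul] at this
    omega
  · have := hcell j hj
    omega
  · have := g3 j hj i hi
    simpa [hcont, hjd] using this
  · have h1 := htri _ (by have := hcell j hj; omega) _ (g3 j hj i hi)
    have h2 : cont b j = D (Ψ (T^[c + 1 + m + j * c + p * (m + 1)] b)) := by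
      simp [hcont, hj, not_lt.2 hjd]
    have h3 := hDd (Ψ (T^[c + 1 + m + j * c + p * (m + 1)] b)) i hi
    have h4 : Ψ (T^[c + 1 + m + j * c + p * (m + 1) + i] b)
        = S^[i] (Ψ (T^[c + 1 + m + j * c + p * (m + 1)] b)) := by
      rw [add_comm _ i, Function.iterate_add_apply, apply_iterate_of_equivariant hΨe]
    rw [h4]
    rw [h2] at h1
    have := dist_triangle (Ψ' (T^[c + 1 + m + j * c + p * (m + 1) + i] b))
      (S^[i] (D (Ψ (T^[c + 1 + m + j * c + p * (m + 1)] b))))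
      (S^[i] (Ψ (T^[c + 1 + m + j * c + p * (m + 1)] b)))
    linarith

end BlockMap

section Times

/-- The times of a block at which the old map is copied. -/
def copyTimes (c m p ℓ d M : ℕ) : Finset ℕ :=
  (Finset.Ico d M ×ˢ Finset.range ℓ).image fun a => c + 1 + m + a.1 * c + p * (m + 1) + a.2

/-- The times of a block at which the `i`-th point of the tour is visited. -/
def tourTimes (c m i M : ℕ) : Finset ℕ :=
  (Finset.range M).image fun j => c + 1 + m + j * c + i * (m + 1)

theorem cell_add_eq {c j j' r r' : ℕ} (hr : r < c) (hr' : r' < c) (h : j * c + r = j' * c + r') :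
    j = j' ∧ r = r' := by
  have h1 : (j * c + r) / c = j := by
    rw [mul_comm, Nat.mul_add_div (by omega), Nat.div_eq_of_lt hr, add_zero]
  have h2 : (j' * c + r') / c = j' := by
    rw [mul_comm, Nat.mul_add_div (by omega), Nat.div_eq_of_lt hr', add_zero]
  have : j = j' := by rw [← h1, h, h2]
  subst this
  exact ⟨rfl, by omega⟩

theorem card_copyTimes {c m p ℓ : ℕ} (hc : c = p * (m + 1) + ℓ + m) (d M : ℕ) :
    (copyTimes c m p ℓ d M).card = (M - d) * ℓ := by
  rw [copyTimes, Finset.card_image_of_injOn, Finset.card_product, Nat.card_Ico, Finset.card_range]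
  rintro ⟨j, i⟩ hj ⟨j', i'⟩ hj' h
  simp only [Finset.coe_product, Finset.coe_range, Finset.coe_Ico, mem_prod, mem_Iio] at hj hj' h
  have := cell_add_eq (c := c) (j := j) (j' := j') (r := p * (m + 1) + i) (r' := p * (m + 1) + i')
    (by omega) (by omega) (by omega)
  ext <;> simp <;> omega

theorem copyTimes_subset {c m p ℓ : ℕ} (hc : c = p * (m + 1) + ℓ + m) (d M : ℕ) :
    copyTimes c m p ℓ d M ⊆ Finset.Ico (c + 1 + m + d * c) (c + 1 + m + M * c) := by
  intro t ht
  obtain ⟨⟨j, i⟩, h, rfl⟩ := Finset.mem_image.1 ht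
  simp only [Finset.mem_product, Finset.mem_Ico, Finset.mem_range] at h ⊢
  have h1 := Nat.mul_le_mul_right c h.1.1
  have h2 := Nat.mul_le_mul_right c (Nat.succ_le_of_lt h.1.2)
  rw [Nat.succ_mul] at h2
  omega

theorem card_tourTimes {c m i p ℓ : ℕ} (hc : c = p * (m + 1) + ℓ + m) (hℓ : 0 < ℓ) (M : ℕ) :
    (tourTimes c m i M).card = M := by
  rw [tourTimes, Finset.card_image_of_injective, Finset.card_range]
  intro j j' h
  have hc0 : 0 < c := by omega
  have : j * c = j' * c := by simp only at h; omega
  exact Nat.eq_of_mul_eq_mul_right hc0 this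

theorem lt_of_mem_tourTimes {c m i p ℓ M t : ℕ} (hc : c = p * (m + 1) + ℓ + m) (hi : i < p)
    (ht : t ∈ tourTimes c m i M) : t < c + 1 + m + M * c := by
  obtain ⟨j, h, rfl⟩ := Finset.mem_image.1 ht
  have h2 := Nat.mul_le_mul_right c (Nat.succ_le_of_lt (Finset.mem_range.1 h))
  have := Nat.mul_le_mul_right (m + 1) (Nat.succ_le_of_lt hi)
  rw [Nat.succ_mul] at h2 this
  omega

end Times

section Cells

variable {X : Type*} [MeasurableSpace X] {μ : Measure X} [IsProbabilityMeasure μ]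
  {Y : Type*} [MetricSpace Y]

/-- For entropy `h`, there are exponentially many orbit segments separated at scale `ε`. -/
def HasSep (S : Y → Y) (ε h : ℝ) : Prop :=
  ∃ᶠ ℓ : ℕ in atTop, ∃ E : Finset Y, Real.exp (ℓ * h) ≤ E.card ∧
    ∀ e ∈ E, ∀ e' ∈ E, (∀ i < ℓ, dist (S^[i] e) (S^[i] e') ≤ ε) → e = e'

theorem exists_cell {S : Y → Y} (hS : HasSpec S) {ε h : ℝ} (hsep : HasSep S ε h) {η γ : ℝ}
    (hη : 0 < η) (hγ : 0 < γ) (hγ1 : γ ≤ 1 / 2) (p : ℕ) :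
    ∃ (ℓ m c : ℕ) (E : Finset Y), SpecAt S η (2 * ℓ) m ∧ c = p * (m + 1) + ℓ + m ∧ c + 1 ≤ 2 * ℓ ∧
      0 < ℓ ∧ (c : ℝ) - ℓ ≤ γ * c ∧ Real.exp (ℓ * h) ≤ E.card ∧
      ∀ e ∈ E, ∀ e' ∈ E, (∀ i < ℓ, dist (S^[i] e) (S^[i] e') ≤ ε) → e = e' := by
  obtain ⟨ℓ₀, hℓ₀⟩ := hS η hη (γ / (4 * (p + 1))) (by positivity)
  obtain ⟨ℓ, ⟨E, hE, hE'⟩, hℓ⟩ := (hsep.and_eventually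
    (eventually_ge_atTop (max (max ℓ₀ 2) ⌈2 * p / γ⌉₊))).exists
  simp only [max_le_iff] at hℓ
  obtain ⟨⟨h1, h2⟩, h3⟩ := hℓ
  obtain ⟨m, hm, hsp⟩ := hℓ₀ (2 * ℓ) (by omega)
  have h3' : 2 * p ≤ γ * ℓ := by
    have := (div_le_iff₀ hγ).1 (Nat.ceil_le.1 h3)
    linarith
  have hm' : (p + 1) * (m : ℝ) ≤ γ * ℓ / 2 := by
    have : γ / (4 * ((p : ℝ) + 1)) * ((2 * ℓ : ℕ) : ℝ) = γ * ℓ / 2 / (p + 1) := by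
      push_cast; field_simp; ring
    rw [this, le_div_iff₀ (by positivity)] at hm
    linarith
  have h2' : (2 : ℝ) ≤ ℓ := by exact_mod_cast h2
  have hc : (((p * (m + 1) + ℓ + m : ℕ)) : ℝ) - ℓ ≤ γ * ℓ := by
    push_cast; nlinarith
  refine ⟨ℓ, m, p * (m + 1) + ℓ + m, E, hsp, rfl, ?_, by omega, ?_, hE, hE'⟩
  · have : (((p * (m + 1) + ℓ + m + 1 : ℕ)) : ℝ) ≤ ((2 * ℓ : ℕ) : ℝ) := by
      push_cast at hc ⊢; nlinarith
    exact_mod_cast this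
  · refine hc.trans (mul_le_mul_of_nonneg_left ?_ hγ.le)
    exact_mod_cast (by omega : ℓ ≤ p * (m + 1) + ℓ + m)

theorem exists_good_columns [StandardBorelSpace X] [NullSingletonClass μ] [CompactSpace Y]
    [MeasurableSpace Y] [BorelSpace Y] {T : X ≃ᵐ X} (hT : Ergodic T μ) {S : Y → Y}
    (hSc : Continuous S) (hS : HasSpec S) {o : Y} (ho : S o = o) {η ζ : ℝ} (hη : 0 < η)
    (hζ : 0 < ζ) {L m c p ℓ M m₂ d : ℕ} (hsp : SpecAt S η L m) (hc : c = p * (m + 1) + ℓ + m)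
    (hcL : c + 1 ≤ L) (hℓ : 0 < ℓ) (q : Y) (Z : ℕ → Y) {N : ℕ} (hN : N = c + 1 + m + M * c)
    (hsp₂ : SpecAt S η N m₂) (hm₂ : (m₂ : ℝ) ≤ ζ / 12 * N) (hN1 : 1 ≤ ζ / 12 * N)
    {A : Set X} (hA : MeasurableSet A) (hμA : μ.real A ≤ ζ ^ 2 / 48)
    {Ψ : X → Y} (hΨ : Measurable Ψ)
    (hΨe : ∀ x, Ψ (T x) = S (Ψ x)) {α : Type*} {w : X → α} (hw : IsFinObs w) (code : α → ℕ → Y) :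
    ∃ Ψ' : X → Y, Measurable Ψ' ∧ (∀ x, Ψ' (T x) = S (Ψ' x)) ∧ ∃ C : Set X, MeasurableSet C ∧
      ReturnGE T C N ∧ 1 - ζ ≤ N * μ.real C ∧ (∀ b ∈ C, b ∉ A) ∧ ∀ b ∈ C,
        (∀ i ≤ c, dist (Ψ' (T^[i] b)) (S^[i] q) ≤ 3 * η) ∧
        (∀ j < M, ∀ i < p, dist (Ψ' (T^[c + 1 + m + j * c + i * (m + 1)] b)) (Z i) ≤ 3 * η) ∧
        (∀ j < M, j < d → ∀ i < ℓ, dist (Ψ' (T^[c + 1 + m + j * c + p * (m + 1) + i] b))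
          (S^[i] (code (w b) j)) ≤ 3 * η) ∧
        (∀ j < M, d ≤ j → ∀ i < ℓ, dist (Ψ' (T^[c + 1 + m + j * c + p * (m + 1) + i] b))
          (Ψ (T^[c + 1 + m + j * c + p * (m + 1) + i] b)) ≤ 4 * η) := by
  subst hN
  set N := c + 1 + m + M * c with hN
  obtain ⟨K, hK⟩ : ∃ K : ℕ, K = ⌈ζ / 12 * N⌉₊ := ⟨_, rfl⟩
  have hK1 : ζ / 12 * N ≤ K := hK ▸ Nat.le_ceil _
  have hK2 : (K : ℝ) ≤ ζ / 12 * N + 1 := hK ▸ (Nat.ceil_lt_add_one (by positivity)).le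
  have hN0 : (0 : ℝ) < N := by rw [hN]; positivity
  have hK0 : 0 < K := by
    have : (0 : ℝ) < K := by linarith
    exact_mod_cast this
  obtain ⟨B, hB, hr, hμB, hBA⟩ := exists_rokhlin_base hT hA (n := N + m₂) hK0
    (show 0 < ζ / 8 by positivity)
  obtain ⟨Ψ', hΨ', hΨ'e, Bad, hBad, hBadm, hμ, hbl⟩ := exists_block_map hT hSc hS ho hη
    (show 0 < ζ / 4 by positivity) hsp hc hcL hℓ q Z hsp₂ hB hr hΨ hΨe hw code (d := d)
  refine ⟨Ψ', hΨ', hΨ'e, (B \ A) \ Bad, (hB.diff hA).diff hBadm,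
    hr.mono (fun x hx => hx.1.1) (by omega), ?_, fun b hb => hb.1.2,
    fun b hb => hbl b ⟨hb.1.1, hb.2⟩⟩
  have e1 : μ.real B ≤ μ.real ((B \ A) \ Bad) + μ.real (B ∩ A) + μ.real Bad := by
    refine le_trans (measureReal_mono (s₂ := ((B \ A) \ Bad) ∪ (B ∩ A) ∪ Bad) ?_)
      ((measureReal_union_le _ _).trans (add_le_add_left (measureReal_union_le _ _) _))
    intro x hx
    by_cases h1 : x ∈ A
    · exact Or.inl (Or.inr ⟨hx, h1⟩)
    · by_cases h2 : x ∈ Bad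
      · exact Or.inr h2
      · exact Or.inl (Or.inl ⟨⟨hx, h1⟩, h2⟩)
  have e2 : N * μ.real (B ∩ A) ≤ ζ / 4 := by
    have : ζ / 12 * (N * μ.real (B ∩ A)) ≤ ζ / 12 * (ζ / 4) := by
      calc ζ / 12 * (N * μ.real (B ∩ A)) = (ζ / 12 * N) * μ.real (B ∩ A) := by ring
        _ ≤ K * μ.real (B ∩ A) := by gcongr
        _ ≤ ζ ^ 2 / 48 := hBA.trans hμA
        _ = _ := by ring
    exact le_of_mul_le_mul_left this (by positivity)
  have e3 : N * μ.real Bad ≤ ζ / 4 := hμ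
  have e4 : 1 - ζ / 8 ≤ N * (1 + ζ / 4) * μ.real B := by
    refine hμB.trans (mul_le_mul_of_nonneg_right ?_ measureReal_nonneg)
    push_cast; nlinarith
  have e5 : (N : ℝ) * μ.real B ≤ 1 := by
    refine le_trans ?_ (card_mul_measureReal_le_one hT.toMeasurePreserving hB hr)
    gcongr
    omega
  have := mul_le_mul_of_nonneg_left e1 hN0.le
  nlinarith

/-- The times of two close points in their blocks agree. -/
theorem eq_of_close_blocks {S : Y → Y} {o q : Y} {r η₀ η : ℝ} {c m M : ℕ}
    (hη : 0 < η) (hη₀ : 4 * η ≤ η₀) (hq : ∀ i < c, dist (S^[i] q) o ≤ r - η₀)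
    (hqc : r + η₀ ≤ dist (S^[c] q) o) {z : Y} (hz : r + η₀ ≤ dist z o) {v v' : ℕ → Y}
    (hv : ∀ i ≤ c, dist (v i) (S^[i] q) ≤ 3 * η) (hv' : ∀ i ≤ c, dist (v' i) (S^[i] q) ≤ 3 * η)
    (hz' : ∀ j < M, dist (v' (c + 1 + m + j * c)) z ≤ 3 * η) (hmc : m + 1 ≤ c) {i i' : ℕ}
    (hii : i ≤ i') (hi : c + 1 ≤ i) (hi' : i' < c + 1 + m + M * c)
    (hclose : ∀ t < c, dist (v t) (v' (i' - i + t)) ≤ η) : i = i' := by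
  by_contra hne
  refine false_of_marker_shift (u := v) (u' := v') (o := o) (r₁ := r - η₀ + 3 * η)
    (r₂ := r + η₀ - 3 * η) (e := η) (c := c) (m := m) (M := M) (D := i' - i) (by linarith)
    (fun t ht => ?_) ?_ (fun j hj => ?_) hclose (by omega) (by omega) hmc
  · have := dist_triangle (v t) (S^[t] q) o
    have := hq t ht
    have := hv t ht.le
    linarith
  · have := dist_triangle_left (S^[c] q) o (v' c)
    have := hv' c le_rfl
    linarith
  · have := dist_triangle_left z o (v' (c + 1 + m + j * c))
    have := hz' j hj
    linarith

end Cells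

section StepNumerics

theorem coloring_exponent_lt {k s l σ τ dH n₂ N hQ H hP h1 ρ γ c m M D ℓ : ℝ}
    (hks : k * s + τ * l ≤ σ / 4) (hk : 0 ≤ k) (hs : 0 < s) (hl : 0 ≤ l) (hdH : dH ≤ τ * N)
    (hQH : hQ ≤ H) (hD1 : ρ * M ≤ D) (hD2 : D ≤ ρ * M + 1) (hn₂ : n₂ = (M - D) * c)
    (hN : N = c + 1 + m + M * c) (hmc : m + 1 ≤ c) (hm : 0 ≤ m) (hn₂0 : 0 ≤ n₂) (hn₂N : n₂ ≤ N)
    (h : H - hP + ρ * hP + σ ≤ ρ * h1) (hγ0 : 0 ≤ γ) (hγ1 : γ ≤ 1) (hγ : γ * h1 ≤ σ / 16)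
    (hℓ : c - ℓ ≤ γ * c) (hh1 : 0 < h1) (hhP : 0 ≤ hP) (hM : 3 * hP + 2 * h1 < M * (σ / 2))
    (hρ : 0 < ρ) (hρ1 : ρ < 1) (hσ : 0 < σ) (hM0 : 0 ≤ M) :
    k * s * n₂ + dH * l + N * (hQ + σ / 16) - n₂ * (hP - σ / 16) < D * (ℓ * h1) := by
  have hc : 0 < c := by linarith
  have hMc : 0 ≤ M * c := by positivity
  have hN0 : 0 < N := by linarith
  have a1 : k * s * n₂ + dH * l ≤ N * (σ / 4) := by
    have e1 : k * s * n₂ ≤ k * s * N := mul_le_mul_of_nonneg_left hn₂N (by positivity)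
    have e2 : dH * l ≤ τ * N * l := mul_le_mul_of_nonneg_right hdH hl
    nlinarith
  have a2 : N * hQ ≤ N * H := mul_le_mul_of_nonneg_left hQH hN0.le
  have a3 : (N - ρ * N - 3 * c) * hP ≤ n₂ * hP := by
    refine mul_le_mul_of_nonneg_right ?_ hhP
    have : D * c ≤ (ρ * M + 1) * c := mul_le_mul_of_nonneg_right hD2 hc.le
    nlinarith
  have a4 : n₂ * (σ / 16) ≤ N * (σ / 16) := by gcongr
  have hℓ' : (1 - γ) * c ≤ ℓ := by linarith
  have hℓ0 : 0 ≤ ℓ := le_trans (mul_nonneg (by linarith) hc.le) hℓ'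
  have a5 : ρ * h1 * N - γ * h1 * N - 2 * c * h1 ≤ D * (ℓ * h1) := by
    have e1 : ρ * M * ((1 - γ) * c * h1) ≤ D * (ℓ * h1) :=
      mul_le_mul hD1 (mul_le_mul_of_nonneg_right hℓ' hh1.le)
        (mul_nonneg (mul_nonneg (by linarith) hc.le) hh1.le) (le_trans (by positivity) hD1)
    have e2 : N - 2 * c ≤ M * c := by linarith
    have e3 : ρ * (1 - γ) * h1 * (N - 2 * c) ≤ ρ * (1 - γ) * h1 * (M * c) :=
      mul_le_mul_of_nonneg_left e2 (by have : 0 ≤ 1 - γ := by linarith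
                                       positivity)
    have e4 : ρ * (γ * h1 * N) ≤ 1 * (γ * h1 * N) :=
      mul_le_mul_of_nonneg_right hρ1.le (by positivity)
    have e5 : ρ * (1 - γ) * (h1 * c) ≤ 1 * 1 * (h1 * c) := by
      refine mul_le_mul_of_nonneg_right ?_ (by positivity)
      exact mul_le_mul hρ1.le (by linarith) (by linarith) (by norm_num)
    nlinarith
  have a6 : (H - hP + ρ * hP + σ) * N ≤ ρ * h1 * N := mul_le_mul_of_nonneg_right h hN0.le
  have a7 : γ * h1 * N ≤ σ / 16 * N := mul_le_mul_of_nonneg_right hγ hN0.le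
  have a8 : (3 * hP + 2 * h1) * c < N * (σ / 2) := by
    calc (3 * hP + 2 * h1) * c < M * (σ / 2) * c := mul_lt_mul_of_pos_right hM hc
      _ = M * c * (σ / 2) := by ring
      _ ≤ N * (σ / 2) := by gcongr; linarith
  nlinarith

theorem copied_proportion {M D c ℓ ρ γ m N : ℝ} (hD : D ≤ ρ * M + 1) (hℓ : c - ℓ ≤ γ * c)
    (hDM : D ≤ M) (hmc : m + 1 ≤ c) (hm : 0 ≤ m) (hN : N = c + 1 + m + M * c) (hM : 3 ≤ γ * M)
    (hρ : 0 < ρ) (hργ : 0 ≤ 1 - ρ - 2 * γ) (hγ : 0 < γ) :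
    (1 - ρ - 2 * γ) * N ≤ (M - D) * ℓ := by
  have hc : 0 < c := by linarith
  have e0 : (1 - ρ - 2 * γ) * N ≤ (1 - ρ - 2 * γ) * ((M + 2) * c) :=
    mul_le_mul_of_nonneg_left (by linarith) hργ
  have e1 : (M - D) * ((1 - γ) * c) ≤ (M - D) * ℓ :=
    mul_le_mul_of_nonneg_left (by linarith) (by linarith)
  have e2 : ((1 - ρ) * M - 1) * ((1 - γ) * c) ≤ (M - D) * ((1 - γ) * c) :=
    mul_le_mul_of_nonneg_right (by linarith) (mul_nonneg (by linarith) hc.le)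
  have e3 : (1 - ρ - 2 * γ) * (M + 2) ≤ ((1 - ρ) * M - 1) * (1 - γ) := by
    have hM0 : 0 < M := by
      by_contra h
      nlinarith
    nlinarith [mul_pos hρ (mul_pos hγ hM0)]
  have e4 := mul_le_mul_of_nonneg_right e3 hc.le
  nlinarith

end StepNumerics

section Step

variable {X : Type*} [MeasurableSpace X] {μ : Measure X} [IsProbabilityMeasure μ]
  {Y : Type*} [MetricSpace Y]

open Classical in
theorem card_mismatch_le {T : X → X} {α : Type*} {P : X → α} {G : Set X} {b b' : X}
    {c m p ℓ D M N : ℕ} (hc : c = p * (m + 1) + ℓ + m) (hN : N = c + 1 + m + M * c) (hD : D ≤ M)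
    (hcopy : ∀ t ∈ copyTimes c m p ℓ D M, T^[t] b ∈ G → T^[t] b' ∈ G → P (T^[t] b) = P (T^[t] b'))
    {γ τ : ℝ} (hγ : (c : ℝ) - ℓ ≤ γ * c) (hγτ : γ ≤ τ / 2) (hτ : 0 < τ)
    (hb : (((Finset.range N).filter (fun t => T^[t] b ∈ Gᶜ)).card : ℝ) ≤ τ / 4 * N)
    (hb' : (((Finset.range N).filter (fun t => T^[t] b' ∈ Gᶜ)).card : ℝ) ≤ τ / 4 * N) :
    (((Finset.Ico (c + 1 + m + D * c) N).filter (fun t => P (T^[t] b) ≠ P (T^[t] b'))).card : ℝ)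
      ≤ τ * N := by
  have hsub : (Finset.Ico (c + 1 + m + D * c) N).filter (fun t => P (T^[t] b) ≠ P (T^[t] b')) ⊆
      ((Finset.range N).filter (fun t => T^[t] b ∈ Gᶜ) ∪
        (Finset.range N).filter (fun t => T^[t] b' ∈ Gᶜ)) ∪
      (Finset.Ico (c + 1 + m + D * c) N \ copyTimes c m p ℓ D M) := by
    intro t ht
    simp only [Finset.mem_filter, Finset.mem_Ico, Finset.mem_union, Finset.mem_range,
      Finset.mem_sdiff, mem_compl_iff] at ht ⊢
    by_contra hcon
    push Not at hcon
    obtain ⟨⟨h1, h2⟩, h3⟩ := hcon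
    exact ht.2 (hcopy t (h3 ht.1) (h1 ht.1.2) (h2 ht.1.2))
  have h1 := (Finset.card_le_card hsub).trans ((Finset.card_union_le _ _).trans
    (Nat.add_le_add_right (Finset.card_union_le _ _) _))
  have h2 : ((Finset.Ico (c + 1 + m + D * c) N \ copyTimes c m p ℓ D M).card : ℝ) ≤ τ / 2 * N := by
    rw [Finset.card_sdiff_of_subset (hN ▸ copyTimes_subset hc D M), card_copyTimes hc,
      Nat.card_Ico]
    obtain ⟨k, rfl⟩ := Nat.exists_eq_add_of_le hD
    have e : N - (c + 1 + m + D * c) - (D + k - D) * ℓ = k * (c - ℓ) := by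
      rw [hN, Nat.add_sub_cancel_left, Nat.mul_sub, add_mul]
      omega
    have hℓc : ℓ ≤ c := by omega
    rw [e]
    push_cast [hℓc]
    have e2 : (k : ℝ) * c ≤ N := by
      have : k * c ≤ N := by rw [hN, add_mul]; omega
      exact_mod_cast this
    calc (k : ℝ) * (c - ℓ) ≤ k * (γ * c) := by gcongr
      _ = γ * (k * c) := by ring
      _ ≤ τ / 2 * (k * c) := by gcongr
      _ ≤ τ / 2 * N := by gcongr
  have h1' : (((Finset.Ico (c + 1 + m + D * c) N).filter
      (fun t => P (T^[t] b) ≠ P (T^[t] b'))).card : ℝ) ≤ _ := Nat.cast_le.2 h1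
  push_cast at h1'
  linarith

theorem towerOver_iterate {T : X ≃ᵐ X} {C : Set X} {I : Finset ℕ} {x : X}
    (hx : x ∈ towerOver T C I) : ∃ b ∈ C, ∃ i ∈ I, x = T^[i] b := by
  obtain ⟨i, hi, hx⟩ := mem_towerOver.1 hx
  exact ⟨_, hx, i, hi, (iterate_symm_iterate T i x).symm⟩

theorem card_mul_le_measureReal_of_columns {T : X ≃ᵐ X} (hT : MeasurePreserving T μ μ) {C : Set X}
    (hC : MeasurableSet C) {n : ℕ} (hr : ReturnGE T C n) {I : Finset ℕ} (hI : ∀ i ∈ I, i < n)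
    {V : Set X} (hV : ∀ b ∈ C, ∀ i ∈ I, T^[i] b ∈ V) : I.card * μ.real C ≤ μ.real V := by
  rw [← measureReal_towerOver hT hC hr hI]
  refine measureReal_mono fun x hx => ?_
  obtain ⟨b, hb, i, hi, rfl⟩ := towerOver_iterate hx
  exact hV b hb i hi

/-- Two points of good columns with close images lie on the same level, and the images of the two
columns stay close. -/
theorem eq_and_close_of_columns {T : X ≃ᵐ X} (S : Y ≃ₜ Y) {Ψ : X → Y}
    (hΨe : ∀ x, Ψ (T x) = S (Ψ x)) {o q : Y} {r η₀ η θ : ℝ} {c m M N : ℕ}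
    (hη : 0 < η) (hη₀ : 4 * η ≤ η₀) (hq : ∀ i < c, dist (S^[i] q) o ≤ r - η₀)
    (hqc : r + η₀ ≤ dist (S^[c] q) o) {z : Y} (hz : r + η₀ ≤ dist z o)
    (hN : N = c + 1 + m + M * c) (hmc : m + 1 ≤ c)
    (hθ : ∀ y y', dist y y' ≤ θ → ∀ i < N, dist (S^[i] y) (S^[i] y') ≤ η)
    (hθ' : ∀ y y', dist y y' ≤ θ → ∀ i < N, dist (S.symm^[i] y) (S.symm^[i] y') ≤ η)
    {b b' : X} (hb : ∀ i ≤ c, dist (Ψ (T^[i] b)) (S^[i] q) ≤ 3 * η)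
    (hb' : ∀ i ≤ c, dist (Ψ (T^[i] b')) (S^[i] q) ≤ 3 * η)
    (hbz' : ∀ j < M, dist (Ψ (T^[c + 1 + m + j * c] b')) z ≤ 3 * η)
    {i i' : ℕ} (hii : i ≤ i') (hi : c + 1 ≤ i) (hi' : i' < N)
    (hclose : dist (Ψ (T^[i] b)) (Ψ (T^[i'] b')) ≤ θ) :
    i = i' ∧ ∀ t < N, dist (Ψ (T^[t] b)) (Ψ (T^[t] b')) ≤ η := by
  have hshift : ∀ t, t < N → i' - i + t < N →
      dist (Ψ (T^[t] b)) (Ψ (T^[i' - i + t] b')) ≤ η := by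
    intro t ht ht'
    rcases le_total i t with h | h
    · have := hθ _ _ hclose (t - i) (by omega)
      rw [← apply_iterate_of_equivariant hΨe, ← apply_iterate_of_equivariant hΨe,
        ← Function.iterate_add_apply, ← Function.iterate_add_apply] at this
      rwa [show t - i + i = t by omega, show t - i + i' = i' - i + t by omega] at this
    · have := hθ' _ _ hclose (i - t) (by omega)
      have inv : ∀ n x, S.symm^[n] (Ψ (T^[n] x)) = Ψ x := fun n x => by
        rw [apply_iterate_of_equivariant hΨe]
        exact (Function.LeftInverse.iterate S.symm_apply_apply n) _
      have e1 : T^[i] b = T^[i - t] (T^[t] b) := by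
        rw [← Function.iterate_add_apply]; congr 1; omega
      have e2 : T^[i'] b' = T^[i - t] (T^[i' - i + t] b') := by
        rw [← Function.iterate_add_apply]; congr 1; omega
      rwa [e1, e2, inv, inv] at this
  have heq : i = i' := eq_of_close_blocks (v := fun t => Ψ (T^[t] b)) (v' := fun t => Ψ (T^[t] b'))
    hη hη₀ hq hqc hz hb hb' hbz' hmc hii hi (hN ▸ hi')
    (fun t ht => hshift t (by omega) (by omega))
  refine ⟨heq, fun t ht => ?_⟩
  subst heq
  have := hshift t ht (by omega)
  rwa [Nat.sub_self, zero_add] at this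

end Step

section MainStep

variable {X : Type*} [MeasurableSpace X] {μ : Measure X} [IsProbabilityMeasure μ]
  {Y : Type*} [MetricSpace Y]

/-- A marker: a fixed point together with orbits staying close to it for a prescribed time
and then leaving a larger neighbourhood. -/
def HasMarker (S : Y → Y) (o : Y) (r η₀ : ℝ) : Prop :=
  ∀ L : ℕ, ∃ q, (∀ i < L, dist (S^[i] q) o ≤ r - η₀) ∧ r + η₀ ≤ dist (S^[L] q) o

/-- Images under `Ψ` at distance at most `2 * θ` determine `P` on `G`. -/
def DeterminesOn {α : Type*} (Ψ : X → Y) (P : X → α) (G : Set X) (θ : ℝ) : Prop :=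
  ∀ x ∈ G, ∀ x' ∈ G, dist (Ψ x) (Ψ x') ≤ 2 * θ → P x = P x'

/-- Adapted columns whose data words encode a coloring of names determine the coarser partition
up to few errors, hence the names. -/
theorem exists_determinesOn_of_columns [CompactSpace Y] {T : X ≃ᵐ X} (S : Y ≃ₜ Y) {Ψ Ψ' : X → Y}
    (hΨ'e : ∀ x, Ψ' (T x) = S (Ψ' x)) {o q : Y} {r η₀ η θ ε γ τ : ℝ} {c m p ℓ M N D : ℕ}
    (hη : 0 < η) (hη₀ : 4 * η ≤ η₀) (hηε : 7 * η ≤ ε) (hηθ : 5 * η ≤ θ) (hτ : 0 < τ)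
    (hq : ∀ i < c, dist (S^[i] q) o ≤ r - η₀)
    (hqc : r + η₀ ≤ dist (S^[c] q) o) (Z : ℕ → Y) (hZ : r + η₀ ≤ dist (Z 0) o)
    (hc : c = p * (m + 1) + ℓ + m) (hp : 0 < p) (hN : N = c + 1 + m + M * c) (hD : D ≤ M)
    (hγ : (c : ℝ) - ℓ ≤ γ * c) (hγτ : γ ≤ τ / 2) {E : Finset Y}
    (hE : ∀ e ∈ E, ∀ e' ∈ E, (∀ i < ℓ, dist (S^[i] e) (S^[i] e') ≤ ε) → e = e')
    {j k : ℕ} {Q : X → Fin j} {F : Fin j → Fin k} {G C : Set X}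
    (hG : DeterminesOn Ψ (F ∘ Q) G θ) {K : Type*} {color : X → K} (enc : K → Fin D → E)
    (henc : Function.Injective enc)
    (hcol : ∀ b ∈ C, ∀ b' ∈ C, color b = color b' →
      ((Finset.Ico (c + 1 + m + D * c) N).filter
        (fun t => F (Q (T^[t] b)) ≠ F (Q (T^[t] b')))).card ≤ ⌊τ * N⌋₊ →
      itinerary T Q N b = itinerary T Q N b')
    (hfreq : ∀ b ∈ C, by classical exact
      (((Finset.range N).filter (fun t => T^[t] b ∈ Gᶜ)).card : ℝ) ≤ τ / 4 * N)
    (hb1 : ∀ b ∈ C, ∀ i ≤ c, dist (Ψ' (T^[i] b)) (S^[i] q) ≤ 3 * η)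
    (hb2 : ∀ b ∈ C, ∀ j < M, ∀ i < p,
      dist (Ψ' (T^[c + 1 + m + j * c + i * (m + 1)] b)) (Z i) ≤ 3 * η)
    (hb3 : ∀ b ∈ C, ∀ j (hj : j < D), ∀ i < ℓ,
      dist (Ψ' (T^[c + 1 + m + j * c + p * (m + 1) + i] b))
        (S^[i] (enc (color b) ⟨j, hj⟩)) ≤ 3 * η)
    (hb4 : ∀ b ∈ C, ∀ j < M, D ≤ j → ∀ i < ℓ,
      dist (Ψ' (T^[c + 1 + m + j * c + p * (m + 1) + i] b))
        (Ψ (T^[c + 1 + m + j * c + p * (m + 1) + i] b)) ≤ 4 * η) :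
    ∃ θ' > 0, DeterminesOn Ψ' Q (towerOver T C (Finset.Ico (c + 1) N)) θ' := by
  classical
  obtain ⟨θ₁, hθ₁, h₁⟩ := exists_pos_forall_dist_iterate_le S.continuous hη N
  obtain ⟨θ₂, hθ₂, h₂⟩ := exists_pos_forall_dist_iterate_le S.symm.continuous hη N
  have hmc : m + 1 ≤ c := by
    have := Nat.mul_le_mul_right (m + 1) hp
    omega
  have main : ∀ b ∈ C, ∀ b' ∈ C, ∀ i i', i ≤ i' → c + 1 ≤ i → i' < N →
      dist (Ψ' (T^[i] b)) (Ψ' (T^[i'] b')) ≤ min θ₁ θ₂ → Q (T^[i] b) = Q (T^[i'] b') := by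
    intro b hb b' hb' i i' hii hi hi' hclose
    obtain ⟨heq, hcl⟩ := eq_and_close_of_columns S hΨ'e hη hη₀ hq hqc hZ hN hmc
      (fun y y' h => h₁ y y' (h.trans (min_le_left θ₁ θ₂)))
      (fun y y' h => h₂ y y' (h.trans (min_le_right θ₁ θ₂))) (hb1 b hb) (hb1 b' hb')
      (fun j hj => by simpa using hb2 b' hb' j hj 0 hp) hii hi hi' hclose
    subst heq
    have hlt : ∀ j < M, ∀ i < ℓ, c + 1 + m + j * c + p * (m + 1) + i < N := by
      intro j hj i hi
      have h1 := Nat.mul_le_mul_right c (Nat.succ_le_of_lt hj)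
      rw [Nat.succ_mul] at h1
      omega
    have hcolor : color b = color b' := by
      refine henc (funext fun j => Subtype.ext (hE _ (enc _ j).2 _ (enc _ j).2 fun i hi => ?_))
      have e1 := hb3 b hb j j.2 i hi
      have e2 := hb3 b' hb' j j.2 i hi
      have e3 := hcl _ (hlt j (j.2.trans_le hD) i hi)
      have t1 := dist_triangle_left (S^[i] (enc (color b) j : Y)) (S^[i] (enc (color b') j : Y))
        (Ψ' (T^[c + 1 + m + j * c + p * (m + 1) + i] b))
      have t2 := dist_triangle (Ψ' (T^[c + 1 + m + j * c + p * (m + 1) + i] b))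
        (Ψ' (T^[c + 1 + m + j * c + p * (m + 1) + i] b')) (S^[i] (enc (color b') j : Y))
      simp only [Fin.eta] at e1 e2
      linarith
    have hmis := card_mismatch_le (T := T) (P := F ∘ Q) (G := G) (b := b) (b' := b') hc hN hD
      (fun t ht hbt hbt' => by
        obtain ⟨⟨j, i⟩, h, rfl⟩ := Finset.mem_image.1 ht
        simp only [Finset.mem_product, Finset.mem_Ico, Finset.mem_range] at h
        refine hG _ hbt _ hbt' ?_
        have e1 := hb4 b hb j h.1.2 h.1.1 i h.2
        have e2 := hb4 b' hb' j h.1.2 h.1.1 i h.2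
        have e3 := hcl _ (hlt j h.1.2 i h.2)
        dsimp only
        have t1 := dist_triangle_left
          (Ψ (T^[c + 1 + m + j * c + p * (m + 1) + i] b))
          (Ψ (T^[c + 1 + m + j * c + p * (m + 1) + i] b'))
          (Ψ' (T^[c + 1 + m + j * c + p * (m + 1) + i] b))
        have t2 := dist_triangle (Ψ' (T^[c + 1 + m + j * c + p * (m + 1) + i] b))
          (Ψ' (T^[c + 1 + m + j * c + p * (m + 1) + i] b'))
          (Ψ (T^[c + 1 + m + j * c + p * (m + 1) + i] b'))
        linarith) hγ hγτ hτ (hfreq b hb) (hfreq b' hb')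
    have hnames := hcol b hb b' hb' hcolor
      ((Finset.card_le_card fun t ht => by simpa using ht).trans (Nat.le_floor hmis))
    exact congrFun hnames ⟨i, hi'⟩
  refine ⟨min θ₁ θ₂ / 2, by positivity, fun x hx x' hx' hxx => ?_⟩
  rw [mul_div_cancel₀ _ two_ne_zero] at hxx
  obtain ⟨b, hb, i, hi, rfl⟩ := towerOver_iterate hx
  obtain ⟨b', hb', i', hi', rfl⟩ := towerOver_iterate hx'
  rw [Finset.mem_Ico] at hi hi'
  rcases le_total i i' with h | h
  · exact main b hb b' hb' i i' h hi.1 hi'.2 hxx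
  · exact (main b' hb' b hb i' i h hi'.1 hi.2 (by rwa [dist_comm])).symm

end MainStep

section FullStep

variable {X : Type*} [MeasurableSpace X] {μ : Measure X} [IsProbabilityMeasure μ]
  {Y : Type*} [MetricSpace Y]

theorem one_sub_two_mul_le_of_copied {M D ℓ N ρ γ ζ x V : ℝ}
    (h : (1 - ρ - 2 * γ) * N ≤ (M - D) * ℓ) (hx : 0 ≤ x) (hV : (M - D) * ℓ * x ≤ V)
    (hN : 1 - ζ ≤ N * x) (hρ : 0 ≤ ρ) (hγ : γ ≤ (1 - ρ) / 4) (hγ' : γ ≤ ρ / 4) (hζ' : ζ ≤ ρ / 4)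
    (hζ : 0 ≤ ζ) (hγ0 : 0 ≤ γ) : 1 - 2 * ρ ≤ V := by
  have h4 := mul_le_mul_of_nonneg_right h hx
  have h5 : (1 - ρ - 2 * γ) * (1 - ζ) ≤ (1 - ρ - 2 * γ) * (N * x) :=
    mul_le_mul_of_nonneg_left hN (by linarith)
  nlinarith [mul_nonneg hρ hζ, mul_nonneg hγ0 hζ]

theorem one_div_le_of_visits {M N c m ζ x : ℝ} (hNR : N = c + 1 + m + M * c) (hmc : m + 1 ≤ c)
    (hm : 0 ≤ m) (hM : 2 < M) (hx : 0 ≤ x) (hN : 1 - ζ ≤ N * x) (hζ : ζ ≤ 1 / 2) :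
    1 / (8 * c) ≤ M * x := by
  have hc : 0 < c := by linarith
  rw [div_le_iff₀ (by positivity)]
  have h2 : N ≤ 2 * c * M := by nlinarith
  have h3 : N * x ≤ 2 * c * M * x := mul_le_mul_of_nonneg_right h2 hx
  nlinarith

theorem one_sub_le_of_levels {M N c m ζ x ε : ℝ} (hNR : N = c + 1 + m + M * c) (hc : 1 ≤ c)
    (hm : 0 ≤ m) (hM : 4 < M * ε) (hx : 0 ≤ x) (hN : 1 - ζ ≤ N * x) (hN1 : N * x ≤ 1)
    (hε : 0 < ε) (hζ : ζ ≤ ε / 2) : 1 - (N - (c + 1)) * x ≤ ε := by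
  have h2 : (c + 1) * x ≤ ε / 2 := by
    have h3 : (c + 1) * 4 ≤ N * ε * 2 := by
      have : 4 * c ≤ M * ε * c := by gcongr
      have : 0 ≤ (c + 1 + m) * ε := by positivity
      nlinarith
    have h4 : (c + 1) * 4 * x ≤ N * ε * 2 * x := mul_le_mul_of_nonneg_right h3 hx
    have h5 : N * x * ε ≤ 1 * ε := mul_le_mul_of_nonneg_right hN1 hε.le
    nlinarith
  nlinarith

theorem exists_inj_encoding {Y : Type*} (E : Finset Y) (D : ℕ) :
    ∃ enc : Fin (E.card ^ D) → Fin D → E, Function.Injective enc :=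
  ⟨_, (Fintype.equivFinOfCardEq (α := Fin D → E) (n := E.card ^ D) (by simp)).symm.injective⟩

theorem eventually_exists_coloring' {T : X → X} (hT : Ergodic T μ) {j k : ℕ} {Q : X → Fin j}
    (hQ : Measurable Q) (F : Fin j → Fin k) {n₁ n₂ N : ℕ → ℕ} (hN : ∀ M, n₁ M + n₂ M = N M)
    (hn₂ : Tendsto n₂ atTop atTop) {δ β : ℝ} (hδ : 0 < δ) (hβ : 0 < β) :
    ∀ᶠ M in atTop, ∃ Good : Set X, MeasurableSet Good ∧ μ.real Goodᶜ ≤ β ∧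
      ∀ (d C : ℕ) (s : ℝ), 0 < s → s ≤ 1 →
        Real.exp (k * s * n₂ M + d * (-Real.log s) + N M * (entropyWrt μ T Q + δ)
          - n₂ M * (entropyWrt μ T (F ∘ Q) - δ)) < C →
        ∃ color : (Fin (N M) → Fin j) → Fin C, ∀ b ∈ Good, ∀ b' ∈ Good,
          color (itinerary T Q (N M) b) = color (itinerary T Q (N M) b') →
          ((Finset.Ico (n₁ M) (N M)).filter
            (fun t => F (Q (T^[t] b)) ≠ F (Q (T^[t] b')))).card ≤ d →
          itinerary T Q (N M) b = itinerary T Q (N M) b' := by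
  obtain rfl : (fun M => n₁ M + n₂ M) = N := funext hN
  exact eventually_exists_coloring hT hQ F hn₂ hδ hβ

set_option maxHeartbeats 1000000 in
/-- The inductive step: an equivariant map which determines a partition of large entropy up to few
errors can be modified slightly so as to determine a given finer partition and visit prescribed
points. -/
theorem exists_refinement [StandardBorelSpace X] [NullSingletonClass μ] [CompactSpace Y]
    [MeasurableSpace Y] [BorelSpace Y] {T : X ≃ᵐ X} (hT : Ergodic T μ)
    (hfin : ksEntropy μ T ≠ ⊤) (S : Y ≃ₜ Y) (hS : HasSpec S) {o : Y} (ho : S o = o) {r η₀ : ℝ}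
    (hmark : HasMarker S o r η₀) {ε h₁ : ℝ} (hsep : HasSep S ε h₁)
    (hh : (ksEntropy μ T).toReal < h₁) {Ψ : X → Y} (hΨ : Measurable Ψ)
    (hΨe : ∀ x, Ψ (T x) = S (Ψ x)) {k : ℕ} {P : X → Fin k} (hP : Measurable P)
    {G : Set X} (hG : MeasurableSet G) {θ ρ σ τ s : ℝ} (hdet : DeterminesOn Ψ P G θ)
    (hμG : μ.real Gᶜ < τ / 8) (hs : 0 < s) (hs1 : s ≤ 1)
    (hks : k * s + τ * (-Real.log s) ≤ σ / 4)
    (hent : (ksEntropy μ T).toReal - entropyWrt μ T P + ρ * entropyWrt μ T P + σ ≤ ρ * h₁)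
    (hρ : 0 < ρ) (hρ1 : ρ < 1) (hσ : 0 < σ) (hτ : 0 < τ) {p : ℕ} (hp : 0 < p) (Z : ℕ → Y)
    (hZ : r + η₀ ≤ dist (Z 0) o) {η : ℝ} (hη : 0 < η) (hη₀ : 4 * η ≤ η₀) (hηε : 7 * η ≤ ε)
    (hηθ : 5 * η ≤ θ) :
    ∃ a : ℝ, 0 < a ∧ ∀ (j : ℕ) (Q : X → Fin j) (F : Fin j → Fin k), Measurable Q → F ∘ Q = P →
      ∀ ε' : ℝ, 0 < ε' → ∃ Ψ' : X → Y, Measurable Ψ' ∧ (∀ x, Ψ' (T x) = S (Ψ' x)) ∧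
        μ.real {x | 4 * η < dist (Ψ' x) (Ψ x)} ≤ 2 * ρ ∧
        (∀ i < p, a ≤ μ.real {x | dist (Ψ' x) (Z i) ≤ 3 * η}) ∧
        ∃ G' : Set X, MeasurableSet G' ∧ μ.real G'ᶜ ≤ ε' ∧ ∃ θ' > 0, DeterminesOn Ψ' Q G' θ' := by
  classical
  set H := (ksEntropy μ T).toReal with hH
  set hP' := entropyWrt μ T P with hhP'
  have hhP0 : 0 ≤ hP' := entropyWrt_nonneg hT.measurable hP
  have hh1 : 0 < h₁ := lt_of_le_of_lt ENNReal.toReal_nonneg hh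
  obtain ⟨γ, hγ0, hγ1, hγ2, hγ3, hγ4, hγ5⟩ : ∃ γ : ℝ, 0 < γ ∧ γ ≤ 1 / 2 ∧ γ ≤ σ / (16 * h₁) ∧
      γ ≤ τ / 2 ∧ γ ≤ ρ / 4 ∧ γ ≤ (1 - ρ) / 4 := by
    refine ⟨min (1 / 2) (min (σ / (16 * h₁)) (min (τ / 2) (min (ρ / 4) ((1 - ρ) / 4)))), ?_, ?_⟩
    · have : 0 < 1 - ρ := by linarith
      positivity
    · simp only [min_le_iff, le_refl, true_or, or_true, and_self]
  have hγh : γ * h₁ ≤ σ / 16 := by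
    rw [le_div_iff₀ (by positivity)] at hγ2 ⊢
    linarith
  obtain ⟨ℓ, m, c, E, hsp, hc, hcL, hℓ, hcℓ, hEc, hE⟩ := exists_cell hS hsep hη hγ0 hγ1 p
  obtain ⟨q, hq, hqc⟩ := hmark c
  have hmc : m + 1 ≤ c := by
    have := Nat.mul_le_mul_right (m + 1) hp
    omega
  have hc0 : 0 < c := by omega
  have hc0' : (0 : ℝ) < c := by exact_mod_cast hc0
  refine ⟨1 / (8 * c), by positivity, fun j Q F hQ hFQ ε' hε' => ?_⟩
  subst hFQ
  obtain ⟨ζ, hζ0, hζ1, hζ2, hζ3⟩ : ∃ ζ : ℝ, 0 < ζ ∧ ζ ≤ 1 / 2 ∧ ζ ≤ ε' / 2 ∧ ζ ≤ ρ / 4 :=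
    ⟨min (1 / 2) (min (ε' / 2) (ρ / 4)), by positivity, by
      simp only [min_le_iff, le_refl, true_or, or_true, and_self]⟩
  set D : ℕ → ℕ := fun M => ⌈ρ * M⌉₊ with hD
  set NN : ℕ → ℕ := fun M => c + 1 + m + M * c with hNN
  have hD1 : ∀ M : ℕ, ρ * M ≤ D M := fun M => Nat.le_ceil _
  have hD2 : ∀ M : ℕ, (D M : ℝ) ≤ ρ * M + 1 := fun M => (Nat.ceil_lt_add_one (by positivity)).le
  have hDM : ∀ M, D M ≤ M := fun M => Nat.ceil_le.2 (by nlinarith [Nat.cast_nonneg (α := ℝ) M])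
  have hMN : ∀ M, M ≤ NN M := fun M => by
    have := Nat.le_mul_of_pos_right M hc0
    simp only [hNN]; omega
  have hNt : Tendsto NN atTop atTop := tendsto_atTop_mono hMN tendsto_id
  have hn₂ : Tendsto (fun M => (M - D M) * c) atTop atTop := by
    have h1 : Tendsto (fun M : ℕ => (1 - ρ) * (M : ℝ) + -1) atTop atTop :=
      tendsto_atTop_add_const_right _ _
        (tendsto_natCast_atTop_atTop.const_mul_atTop (by linarith))
    refine tendsto_atTop_mono (f := fun M => M - D M) (fun M => Nat.le_mul_of_pos_right _ hc0) ?_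
    rw [← tendsto_natCast_atTop_iff (R := ℝ)]
    refine tendsto_atTop_mono (fun M => ?_) h1
    rw [Nat.cast_sub (hDM M)]
    have := hD2 M
    linarith
  have hsum : ∀ M, c + 1 + m + D M * c + (M - D M) * c = NN M := fun M => by
    have : D M * c + (M - D M) * c = M * c := by rw [← add_mul, Nat.add_sub_cancel' (hDM M)]
    simp only [hNN]; omega
  obtain ⟨ℓ₀, hℓ₀⟩ := hS η hη (ζ / 12) (by positivity)
  have ev1 := eventually_exists_coloring' hT hQ F hsum hn₂
    (show 0 < σ / 16 by positivity) (show 0 < ζ ^ 2 / 96 by positivity)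
  have ev2 := hNt.eventually (eventually_frequency_le hT hG.compl (show μ.real Gᶜ < τ / 4 by linarith)
    (show 0 < ζ ^ 2 / 96 by positivity))
  have ev3 := hNt.eventually (eventually_ge_atTop ℓ₀)
  have ev4 := tendsto_natCast_atTop_atTop.eventually (eventually_gt_atTop
    (max (max ((3 * hP' + 2 * h₁) / (σ / 2)) (3 / γ)) (max (max (4 / ε') (12 / ζ)) 2)))
  obtain ⟨M, hM1, hM2, hM3, hM4⟩ := (ev1.and (ev2.and (ev3.and ev4))).exists
  simp only [max_lt_iff] at hM4
  obtain ⟨⟨hM4, hM5⟩, ⟨hM6, hM7⟩, hM8⟩ := hM4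
  rw [div_lt_iff₀ (by positivity)] at hM4 hM5 hM6 hM7
  obtain ⟨Good, hGood, hμGood, hcolor⟩ := hM1
  obtain ⟨m₂, hm₂, hsp₂⟩ := hℓ₀ _ hM3
  set N := NN M with hN
  have hNR : (N : ℝ) = c + 1 + m + M * c := by simp [hN, hNN]
  have hMc1 : (M : ℝ) ≤ N := by exact_mod_cast hMN M
  have hmcR : (m : ℝ) + 1 ≤ c := by exact_mod_cast hmc
  have hM0 : (0 : ℝ) < M := by linarith
  have hN0 : (0 : ℝ) < N := by linarith
  have hn₂R : (((M - D M) * c : ℕ) : ℝ) = (M - D M) * c := by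
    push_cast [hDM M]; rfl
  have hDMR : (D M : ℝ) ≤ M := by exact_mod_cast hDM M
  -- the coloring of names by data words
  obtain ⟨color, hcol⟩ := hcolor ⌊τ * N⌋₊ (E.card ^ D M) s hs hs1 (by
    have hexp : Real.exp (D M * (ℓ * h₁)) ≤ ((E.card ^ D M : ℕ) : ℝ) := by
      rw [Real.exp_nat_mul]
      push_cast
      exact pow_le_pow_left₀ (Real.exp_pos _).le hEc _
    refine lt_of_lt_of_le (Real.exp_lt_exp.2 ?_) hexp
    exact coloring_exponent_lt (H := H) (m := m) hks (Nat.cast_nonneg k) hs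
      (neg_nonneg.2 (Real.log_nonpos hs.le hs1)) (Nat.floor_le (by positivity))
      (entropyWrt_le_ksEntropy hT.measurable hQ hfin) (hD1 M) (hD2 M) hn₂R hNR hmcR
      (Nat.cast_nonneg m) (Nat.cast_nonneg _) (by
        have := hsum M
        rw [Nat.cast_le]; omega) hent hγ0.le (by linarith) hγh hcℓ hh1 hhP0 hM4 hρ hρ1
      hσ hM0.le)
  obtain ⟨enc, henc⟩ := exists_inj_encoding E (D M)
  set Fbad : Set X := {x | ¬ (((Finset.range N).filter (fun t => T^[t] x ∈ Gᶜ)).card : ℝ)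
    ≤ τ / 4 * N} with hFbad
  obtain ⟨Ψ', hΨ', hΨ'e, C, hC, hr, hμC, hCA, hbl⟩ := exists_good_columns hT S.continuous hS ho hη
    hζ0 hsp hc hcL hℓ q Z (N := N) rfl hsp₂ hm₂ (by nlinarith)
    (A := Goodᶜ ∪ toMeasurable μ Fbad) (hGood.compl.union (measurableSet_toMeasurable _ _))
    (by
      have h1 : μ.real (toMeasurable μ Fbad) ≤ ζ ^ 2 / 96 := by
        rw [measureReal_def, measure_toMeasurable]
        refine le_trans (measureReal_mono fun x hx => ?_) hM2
        convert hx
      have := measureReal_union_le (μ := μ) Goodᶜ (toMeasurable μ Fbad)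
      linarith) hΨ hΨe
    (isFinObs_of_finite (measurable_itinerary hT.measurable hQ N))
    (fun v j => if h : j < D M then (enc (color v) ⟨j, h⟩ : Y) else o) (d := D M)
  have hCG : ∀ b ∈ C, b ∈ Good := fun b hb => not_not.1 fun h => hCA b hb (Or.inl h)
  have hCF : ∀ b ∈ C, b ∉ Fbad := fun b hb h =>
    hCA b hb (Or.inr (subset_toMeasurable μ Fbad h))
  have hμC1 : N * μ.real C ≤ 1 := card_mul_measureReal_le_one hT.toMeasurePreserving hC hr
  have hμC0 : 0 ≤ μ.real C := measureReal_nonneg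
  refine ⟨Ψ', hΨ', hΨ'e, ?_, ?_, towerOver T C (Finset.Ico (c + 1) N),
    measurableSet_towerOver hC _, ?_, ?_⟩
  · have h1 := card_mul_le_measureReal_of_columns hT.toMeasurePreserving hC hr
      (I := copyTimes c m p ℓ (D M) M)
      (fun t ht => (Finset.mem_Ico.1 (copyTimes_subset hc (D M) M ht)).2)
      (V := {x | 4 * η < dist (Ψ' x) (Ψ x)}ᶜ) (fun b hb t ht => by
        obtain ⟨⟨j, i⟩, h, rfl⟩ := Finset.mem_image.1 ht
        simp only [Finset.mem_product, Finset.mem_Ico, Finset.mem_range] at h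
        have := (hbl b hb).2.2.2 j h.1.2 h.1.1 i h.2
        simpa using this)
    rw [card_copyTimes hc] at h1
    push_cast [hDM M] at h1
    have h2 := copied_proportion (hD2 M) hcℓ hDMR hmcR (Nat.cast_nonneg m) hNR
      (by linarith) hρ (by linarith) hγ0
    have h3 := probReal_compl_eq_one_sub (μ := μ) (s := {x | 4 * η < dist (Ψ' x) (Ψ x)})
      (measurableSet_lt measurable_const (hΨ'.dist hΨ))
    have h4 := one_sub_two_mul_le_of_copied h2 hμC0 h1 hμC hρ.le hγ5 hγ4 hζ3 hζ0.le hγ0.le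
    linarith
  · intro i hi
    have h1 := card_mul_le_measureReal_of_columns hT.toMeasurePreserving hC hr
      (I := tourTimes c m i M) (fun t ht => lt_of_mem_tourTimes hc hi ht)
      (V := {x | dist (Ψ' x) (Z i) ≤ 3 * η}) (fun b hb t ht => by
        obtain ⟨j, h, rfl⟩ := Finset.mem_image.1 ht
        exact (hbl b hb).2.1 j (Finset.mem_range.1 h) i hi)
    rw [card_tourTimes hc hℓ] at h1
    exact (one_div_le_of_visits hNR hmcR (Nat.cast_nonneg m) hM8 hμC0 hμC hζ1).trans h1
  · have h1 := measureReal_towerOver hT.toMeasurePreserving hC hr (I := Finset.Ico (c + 1) N)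
      (fun i hi => (Finset.mem_Ico.1 hi).2)
    rw [probReal_compl_eq_one_sub (measurableSet_towerOver hC _), h1, Nat.card_Ico,
      Nat.cast_sub (by simp only [hN, hNN]; omega)]
    push_cast
    exact one_sub_le_of_levels hNR (by exact_mod_cast hc0) (Nat.cast_nonneg m) hM6 hμC0 hμC hμC1 hε'
      hζ2
  · exact exists_determinesOn_of_columns S hΨ'e hη hη₀ hηε hηθ hτ hq hqc Z hZ hc hp rfl (hDM M)
      hcℓ hγ3 hE hdet (color := fun b => color (itinerary T Q N b)) enc henc
      (fun b hb b' hb' h h' => by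
        refine hcol b (hCG b hb) b' (hCG b' hb') h ?_
        exact h')
      (fun b hb => not_not.1 (hCF b hb)) (fun b hb => (hbl b hb).1)
      (fun b hb => (hbl b hb).2.1)
      (fun b hb j hj i hi => by
        have := (hbl b hb).2.2.1 j (hj.trans_le (hDM M)) hj i hi
        simpa only [dif_pos hj] using this)
      (fun b hb => (hbl b hb).2.2.2)

end FullStep

section Assembly

variable {X : Type*} [MeasurableSpace X] {Y : Type*} [MetricSpace Y]

/-- An equivariant map together with a finite partition that its values determine off a small
set, and a bound `ρ` for the proportion of time that later refinements may modify. -/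
structure RefState (X Y : Type*) where
  map : X → Y
  card : ℕ
  part : X → Fin card
  good : Set X
  sep : ℝ
  rate : ℝ

variable [MeasurableSpace Y]

/-- The conditions under which a state can be refined. -/
def RefState.Ready (μ : Measure X) (T : X → X) (S : Y → Y) (h₁ : ℝ) (d : RefState X Y) : Prop :=
  (Measurable d.map ∧ (∀ x, d.map (T x) = S (d.map x)) ∧ Measurable d.part ∧
    MeasurableSet d.good ∧ DeterminesOn d.map d.part d.good d.sep) ∧
  (0 < d.sep ∧ 0 < d.rate ∧ d.rate < 1 ∧ μ.real d.goodᶜ ≤ d.rate) ∧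
  ∃ σ > 0, ∃ τ > 0, ∃ s : ℝ, 0 < s ∧ s ≤ 1 ∧ d.card * s + τ * (-Real.log s) ≤ σ / 4 ∧
    μ.real d.goodᶜ < τ / 8 ∧
    (ksEntropy μ T).toReal - entropyWrt μ T d.part + d.rate * entropyWrt μ T d.part + σ
      ≤ d.rate * h₁

/-- The state `d'` refines `d` and its partition resolves the set `V`. -/
def RefState.Refines (μ : Measure X) (V : Set X) (d d' : RefState X Y) : Prop :=
  d'.rate ≤ d.rate / 2 ∧ d'.sep ≤ d.sep / 2 ∧
  (∀ x x', d'.part x = d'.part x' → d.part x = d.part x' ∧ (x ∈ V ↔ x' ∈ V)) ∧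
  μ.real {x | d.sep / 2 < dist (d'.map x) (d.map x)} ≤ 2 * d.rate ∧
  ∀ y, 16 * d'.rate ≤ μ.real {x | dist (d'.map x) y ≤ d.sep}

theorem exists_mul_add_mul_neg_log_le (k : ℕ) {σ : ℝ} (hσ : 0 < σ) :
    ∃ τ > 0, ∃ s : ℝ, 0 < s ∧ s ≤ 1 ∧ k * s + τ * (-Real.log s) ≤ σ / 4 := by
  set s : ℝ := min 1 (σ / (8 * (k + 1))) with hs
  have hs0 : 0 < s := by positivity
  have hl : 0 ≤ -Real.log s := by
    have := Real.log_nonpos hs0.le (min_le_left _ _)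
    linarith
  refine ⟨σ / (8 * (-Real.log s + 1)), by positivity, s, hs0, min_le_left _ _, ?_⟩
  have h1 : k * s ≤ σ / 8 := by
    have h2 : s * (8 * (k + 1)) ≤ σ := by
      rw [← le_div_iff₀ (by positivity)]; exact min_le_right _ _
    nlinarith
  have h3 : σ / (8 * (-Real.log s + 1)) * (-Real.log s) ≤ σ / 8 := by
    rw [div_mul_eq_mul_div, div_le_iff₀ (by positivity)]
    nlinarith
  linarith

theorem exists_net_from [CompactSpace Y] (z : Y) {η : ℝ} (hη : 0 < η) :
    ∃ p > 0, ∃ Z : ℕ → Y, Z 0 = z ∧ ∀ y, ∃ i < p, dist y (Z i) ≤ η := by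
  obtain ⟨t, ht, htc⟩ := Metric.totallyBounded_iff.1 (isCompact_univ (X := Y)).totallyBounded η hη
  classical
  obtain ⟨n, f, hf⟩ : ∃ (n : ℕ) (f : Fin n → Y), Set.range f = t := by
    lift t to Finset Y using ht
    exact ⟨t.card, fun i => t.equivFin.symm i, by
      ext y; exact ⟨fun ⟨i, hi⟩ => hi ▸ (t.equivFin.symm i).2, fun h => ⟨t.equivFin ⟨y, h⟩, by simp⟩⟩⟩
  refine ⟨n + 1, by omega, fun i => if h : 1 ≤ i ∧ i ≤ n then f ⟨i - 1, by omega⟩ else z,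
    by simp, fun y => ?_⟩
  obtain ⟨w, hw, hy⟩ : ∃ w ∈ t, y ∈ Metric.ball w η := by simpa using htc (mem_univ y)
  rw [← hf] at hw
  obtain ⟨⟨i, hi⟩, rfl⟩ := hw
  refine ⟨i + 1, by omega, ?_⟩
  have : 1 ≤ i + 1 ∧ i + 1 ≤ n := by omega
  simp only [this, and_self, dite_true, Nat.add_sub_cancel]
  exact (Metric.mem_ball.1 hy).le

variable {μ : Measure X} [IsProbabilityMeasure μ]

theorem RefState.Ready.exists_refines [StandardBorelSpace X] [NullSingletonClass μ]
    [CompactSpace Y] [BorelSpace Y] {T : X ≃ᵐ X} (hT : Ergodic T μ)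
    (hfin : ksEntropy μ T ≠ ⊤) (S : Y ≃ₜ Y) (hS : HasSpec S) {o : Y} (ho : S o = o) {r η₀ : ℝ}
    (hη₀ : 0 < η₀) (hmark : HasMarker S o r η₀) {ε h₁ : ℝ} (hε : 0 < ε) (hsep : HasSep S ε h₁)
    (hh : (ksEntropy μ T).toReal < h₁) {V : Set X} (hV : MeasurableSet V) {d : RefState X Y}
    (hd : d.Ready μ T S h₁) : ∃ d', d'.Ready μ T S h₁ ∧ d.Refines μ V d' := by
  classical
  obtain ⟨⟨hΨ, hΨe, hP, hG, hdet⟩, ⟨hθ, hρ, hρ1, hGρ⟩, σ, hσ, τ, hτ, s, hs, hs1, hks, hμG, hent⟩ :=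
    hd
  set H := (ksEntropy μ T).toReal with hH
  have hH0 : 0 ≤ H := ENNReal.toReal_nonneg
  obtain ⟨η, hη, hη1, hη2, hη3⟩ : ∃ η : ℝ, 0 < η ∧ 4 * η ≤ η₀ ∧ 7 * η ≤ ε ∧ 8 * η ≤ d.sep := by
    refine ⟨min (η₀ / 4) (min (ε / 7) (d.sep / 8)), by positivity, ?_, ?_, ?_⟩
    · linarith [min_le_left (η₀ / 4) (min (ε / 7) (d.sep / 8))]
    · linarith [min_le_right (η₀ / 4) (min (ε / 7) (d.sep / 8)), min_le_left (ε / 7) (d.sep / 8)]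
    · linarith [min_le_right (η₀ / 4) (min (ε / 7) (d.sep / 8)), min_le_right (ε / 7) (d.sep / 8)]
  obtain ⟨z, -, hz⟩ := hmark 0
  obtain ⟨p, hp, Z, hZ0, hZ⟩ := exists_net_from z hη
  obtain ⟨a, ha, hstep⟩ := exists_refinement hT hfin S hS ho hmark hsep hh hΨ hΨe hP hG hdet hμG
    hs hs1 hks hent hρ hρ1 hσ hτ hp Z (by rw [hZ0]; exact hz) hη hη1 hη2 (by linarith)
  set ρ' := min (d.rate / 2) (a / 16) with hρ'
  have hρ'0 : 0 < ρ' := by positivity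
  have hρ'1 : ρ' ≤ d.rate / 2 := min_le_left _ _
  have hρ'2 : 16 * ρ' ≤ a := by linarith [min_le_right (d.rate / 2) (a / 16)]
  set e := ρ' * (h₁ - H) / 2 with he
  have he0 : 0 < e := by
    have : 0 < h₁ - H := by linarith
    positivity
  obtain ⟨k', P', hP', hPe⟩ := exists_lt_entropyWrt hT.measurable hfin he0
  let K := Fin d.card × Prop × Fin k'
  let eq := Fintype.equivFin K
  let Q : X → Fin (Fintype.card K) := fun x => eq (d.part x, x ∈ V, P' x)
  have hQ : Measurable Q := by
    refine (measurable_of_finite (fun t : Fin d.card × Prop × Fin k' => eq t)).comp ?_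
    exact hP.prodMk ((measurable_mem.2 hV).prodMk hP')
  have hQP : (fun i => (eq.symm i).1) ∘ Q = d.part := by
    funext x; simp [Q]
  have hQP' : (fun i => (eq.symm i).2.2) ∘ Q = P' := by
    funext x; simp [Q]
  have hQ1 : H - e ≤ entropyWrt μ T Q := by
    have := entropyWrt_comp_le hT.measurable hQ (μ := μ) (fun i => (eq.symm i).2.2)
    rw [hQP'] at this
    linarith
  have hQ2 : entropyWrt μ T Q ≤ H := entropyWrt_le_ksEntropy hT.measurable hQ hfin
  obtain ⟨τ', hτ', s', hs', hs'1, hks'⟩ := exists_mul_add_mul_neg_log_le (Fintype.card K) he0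
  obtain ⟨Ψ', hΨ', hΨ'e, hclose, hvis, G', hG', hμG', θ', hθ', hdet'⟩ := hstep _ Q _ hQ hQP
    (min (τ' / 16) ρ') (by positivity)
  refine ⟨⟨Ψ', _, Q, G', min θ' (d.sep / 2), ρ'⟩, ⟨⟨hΨ', hΨ'e, hQ, hG', ?_⟩, ⟨by positivity, hρ'0,
    by linarith, hμG'.trans (min_le_right _ _)⟩, e, he0, τ', hτ', s', hs', hs'1, hks', ?_, ?_⟩,
    hρ'1, min_le_right _ _, ?_, ?_, ?_⟩
  · intro x hx x' hx' h
    exact hdet' x hx x' hx' (h.trans (by gcongr; exact min_le_left _ _))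
  · exact lt_of_le_of_lt (hμG'.trans (min_le_left _ _)) (by linarith)
  · have : ρ' * entropyWrt μ T Q ≤ ρ' * H := by gcongr
    have h2 : 2 * e = ρ' * h₁ - ρ' * H := by rw [he]; ring
    linarith
  · intro x x' h
    have h' : (d.part x, x ∈ V, P' x) = (d.part x', x' ∈ V, P' x') := eq.injective h
    simp only [Prod.mk.injEq] at h'
    exact ⟨h'.1, by rw [h'.2.1]⟩
  · refine le_trans (measureReal_mono ?_) hclose
    intro x hx
    simp only [Set.mem_ofPred_eq] at hx ⊢
    linarith
  · intro y
    obtain ⟨i, hi, hyi⟩ := hZ y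
    refine hρ'2.trans ((hvis i hi).trans (measureReal_mono ?_))
    intro x hx
    simp only [Set.mem_ofPred_eq] at hx ⊢
    have := dist_triangle (Ψ' x) (Z i) y
    rw [dist_comm (Z i)] at this
    linarith

end Assembly

section Limit

variable {X : Type*} [MeasurableSpace X] {μ : Measure X} [IsProbabilityMeasure μ]

theorem tsum_measure_le_of_geometric {B : ℕ → Set X} {c : ℝ} (hc : 0 ≤ c)
    (hB : ∀ m, μ.real (B m) ≤ c / 2 ^ m) : ∑' m, μ (B m) ≤ ENNReal.ofReal (2 * c) := by
  have h1 : ∀ m, μ (B m) ≤ ENNReal.ofReal (c / 2 / 2 ^ m * 2) := fun m => by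
    rw [← ofReal_measureReal (μ := μ)]
    refine ENNReal.ofReal_le_ofReal ((hB m).trans (le_of_eq ?_))
    ring
  refine (ENNReal.tsum_le_tsum h1).trans ?_
  have hs : HasSum (fun m : ℕ => c / 2 / 2 ^ m * 2) (c * 2) :=
    (hasSum_geometric_two' c).mul_right 2
  rw [← ENNReal.ofReal_tsum_of_nonneg (fun m => by positivity) hs.summable, hs.tsum_eq, mul_comm]

theorem le_div_two_pow {u : ℕ → ℝ} (hu : ∀ n, u (n + 1) ≤ u n / 2) (n m : ℕ) :
    u (n + m) ≤ u n / 2 ^ m := by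
  induction m with
  | zero => simp
  | succ m ih =>
    rw [← add_assoc, pow_succ, ← div_div]
    linarith [hu (n + m)]

variable {Y : Type*} [MetricSpace Y]

theorem dist_le_of_forall_dist_le_half {φ : ℕ → Y} {u : ℕ → ℝ} (hu : ∀ n, u (n + 1) ≤ u n / 2)
    (hu0 : ∀ n, 0 ≤ u n) {n : ℕ} (h : ∀ m ≥ n, dist (φ (m + 1)) (φ m) ≤ u m / 2) {y : Y}
    (hy : Tendsto φ atTop (nhds y)) : dist (φ n) y ≤ u n := by
  have h1 : ∀ m ≥ n, dist (φ n) (φ m) ≤ u n - u m := by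
    intro m hm
    induction m, hm using Nat.le_induction with
    | base => simp
    | succ m hm ih =>
      have := dist_triangle_right (φ n) (φ (m + 1)) (φ m)
      have := h m hm
      linarith [hu m]
  refine le_of_tendsto (tendsto_const_nhds.dist hy) ?_
  filter_upwards [eventually_ge_atTop n] with m hm
  linarith [h1 m hm, hu0 m]

variable [MeasurableSpace Y]

/-- A homeomorphism with a fixed point, specification and markers has a fully supported
embedding of every ergodic system of smaller entropy. -/
theorem exists_isMeasEmbedding_fullSupport [StandardBorelSpace X] [NullSingletonClass μ]
    [CompactSpace Y] [BorelSpace Y] {T : X ≃ᵐ X} (hT : Ergodic T μ)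
    (hfin : ksEntropy μ T ≠ ⊤) (S : Y ≃ₜ Y) (hS : HasSpec S) {o : Y} (ho : S o = o) {r η₀ : ℝ}
    (hη₀ : 0 < η₀) (hmark : HasMarker S o r η₀) {ε h₁ : ℝ} (hε : 0 < ε) (hsep : HasSep S ε h₁)
    (hh : (ksEntropy μ T).toReal < h₁) :
    ∃ Ψ : X → Y, IsMeasEmbedding μ T S Ψ ∧ FullSupport (μ.map Ψ) := by
  set H := (ksEntropy μ T).toReal with hH
  have hH0 : 0 ≤ H := ENNReal.toReal_nonneg
  have h10 : 0 < h₁ := by linarith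
  let s := MeasurableSpace.natGeneratingSequence X
  have hs : ∀ n, MeasurableSet (s n) := MeasurableSpace.measurableSet_natGeneratingSequence
  let d₀ : RefState X Y := ⟨fun _ => o, 1, fun _ => 0, univ, 1, (H + h₁) / (2 * h₁)⟩
  have hd₀ : d₀.Ready μ T S h₁ := by
    obtain ⟨τ, hτ, s', hs', hs'1, hks⟩ := exists_mul_add_mul_neg_log_le 1
      (σ := (h₁ - H) / 2) (by linarith)
    refine ⟨⟨measurable_const, fun _ => ho.symm, measurable_const, MeasurableSet.univ,
      fun _ _ _ _ _ => rfl⟩, ⟨one_pos, by positivity, ?_, ?_⟩, _, by linarith, τ, hτ, s', hs', hs'1,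
      hks, ?_, ?_⟩
    · simp only [d₀]
      rw [div_lt_one (by positivity)]; linarith
    · simp only [d₀, compl_univ, measureReal_empty]; positivity
    · simp only [d₀, compl_univ, measureReal_empty]; positivity
    · have h0 : 0 ≤ entropyWrt μ T d₀.part := entropyWrt_nonneg hT.measurable measurable_const
      have h1 : d₀.rate ≤ 1 := by
        simp only [d₀]
        rw [div_le_one (by positivity)]; linarith
      have h2 : d₀.rate * h₁ = (H + h₁) / 2 := by
        simp only [d₀]
        field_simp
      rw [h2]
      nlinarith
  obtain ⟨f, -, hf⟩ := exists_dependent_seq (fun _ (d : RefState X Y) => d.Ready μ T S h₁)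
    (fun n (d d' : RefState X Y) => d.Refines μ (s n) d') hd₀
    (fun n d hd => hd.exists_refines hT hfin S hS ho hη₀ hmark hε hsep hh (hs n))
  have hrate : ∀ n, (f (n + 1)).rate ≤ (f n).rate / 2 := fun n => (hf n).2.1
  have hsep' : ∀ n, (f (n + 1)).sep ≤ (f n).sep / 2 := fun n => (hf n).2.2.1
  have hrate' : ∀ n m, (f (n + m)).rate ≤ (f n).rate / 2 ^ m :=
    le_div_two_pow (u := fun n => (f n).rate) hrate
  have hsep₀ : ∀ n, (f n).sep ≤ (f 0).sep / 2 ^ n := fun n => by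
    simpa using le_div_two_pow (u := fun n => (f n).sep) hsep' 0 n
  have hm : ∀ n, Measurable (f n).map := fun n => (hf n).1.1.1
  have hr0 : ∀ n, 0 < (f n).rate := fun n => (hf n).1.2.1.2.1
  have hs0 : ∀ n, 0 < (f n).sep := fun n => (hf n).1.2.1.1
  let V : ℕ → Set X := fun n => {x | dist ((f (n + 1)).map x) ((f n).map x) ≤ (f n).sep / 2}
  have hVm : ∀ n, MeasurableSet (V n) := fun n =>
    measurableSet_le ((hm _).dist (hm n)) measurable_const
  have hμV : ∀ n, μ.real (V n)ᶜ ≤ 2 * (f n).rate := fun n => by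
    have : (V n)ᶜ = {x | (f n).sep / 2 < dist ((f (n + 1)).map x) ((f n).map x)} := by
      ext x; simp [V]
    rw [this]
    exact (hf n).2.2.2.2.1
  have hVs : ∀ n, ∑' m, μ (V (n + m))ᶜ ≤ ENNReal.ofReal (2 * (2 * (f n).rate)) := fun n =>
    tsum_measure_le_of_geometric (by linarith [hr0 n]) fun m => (hμV _).trans (by
      rw [mul_div_assoc]
      gcongr
      exact hrate' n m)
  obtain ⟨Ψ, hΨ, hΨe, I, hI, hμI, -, hlim⟩ := exists_equivariant_limit hT.toMeasurePreserving
    S.continuous ho hm hVm (η := (f 0).sep) (by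
      have := hVs 0
      simp only [zero_add] at this
      exact (this.trans_lt ENNReal.ofReal_lt_top).ne) (hs0 0).le
    (fun n x hx => by
      rw [dist_comm]
      refine le_trans hx ?_
      linarith [hs0 n, hsep₀ n]) (fun n x _ => (hf n).1.1.2.1 x)
  have hclose : ∀ n x, x ∈ I → (∀ m ≥ n, x ∈ V m) → dist ((f n).map x) (Ψ x) ≤ (f n).sep :=
    fun n x hx hV => dist_le_of_forall_dist_le_half (φ := fun n => (f n).map x)
      (u := fun n => (f n).sep) hsep' (fun n => (hs0 n).le) hV (hlim x hx)
  refine ⟨Ψ, ⟨hΨ, I ∩ {x | ∀ᶠ n in atTop, x ∈ V n ∩ (f n).good}, ?_, ?_, ?_, fun x _ => hΨe x⟩, ?_⟩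
  · exact hI.inter (measurableSet_setOf_eventually_mem fun n => (hVm n).inter (hf n).1.1.2.2.2.1)
  · rw [compl_inter, measure_union_null_iff]
    refine ⟨hμI, ?_⟩
    have h1 : ∑' m, μ (V m ∩ (f m).good)ᶜ ≠ ∞ := by
      refine ((tsum_measure_le_of_geometric (c := 3 * (f 0).rate) (by linarith [hr0 0])
        fun m => ?_).trans_lt ENNReal.ofReal_lt_top).ne
      rw [compl_inter]
      refine (measureReal_union_le _ _).trans ?_
      have h2 := hrate' 0 m
      rw [zero_add] at h2
      rw [mul_div_assoc]
      linarith [hμV m, (hf m).1.2.1.2.2.2]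
    have h3 := measure_setOfPred_frequently_eq_zero (p := fun m x => x ∉ V m ∩ (f m).good) (μ := μ) h1
    convert h3 using 2
    ext x; simp [frequently_atTop]
  · rintro x ⟨hxI, hx⟩ x' ⟨hx'I, hx'⟩ hxx
    obtain ⟨N, hN⟩ := eventually_atTop.1 (hx.and hx')
    have hpart : ∀ n ≥ N, (f n).part x = (f n).part x' := fun n hn => by
      refine (hf n).1.1.2.2.2.2 x (hN n hn).1.2 x' (hN n hn).2.2 ?_
      have h1 := hclose n x hxI fun m hm => (hN m (hn.le.trans hm)).1.1
      have h2 := hclose n x' hx'I fun m hm => (hN m (hn.le.trans hm)).2.1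
      rw [← hxx] at h2
      linarith [dist_triangle_right ((f n).map x) ((f n).map x') (Ψ x)]
    have hback : ∀ k n, n + k ≥ N → (f n).part x = (f n).part x' := by
      intro k
      induction k with
      | zero => exact hpart
      | succ k ih => exact fun n hn => ((hf n).2.2.2.1 x x' (ih (n + 1) (by omega))).1
    refine MeasurableSpace.injective_mapNatBool X (funext fun n => ?_)
    have := ((hf n).2.2.2.1 x x' (hback N (n + 1) (by omega))).2
    simpa [MeasurableSpace.mapNatBool, s] using this
  · rintro U hU ⟨y, hy⟩
    rw [Measure.map_apply hΨ hU.measurableSet]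
    obtain ⟨δ, hδ, hyU⟩ := Metric.isOpen_iff.1 hU y hy
    obtain ⟨n, hn⟩ : ∃ n, 2 * (f n).sep < δ := by
      have h1 : Tendsto (fun n : ℕ => (f 0).sep * (1 / 2) ^ n) atTop (nhds 0) := by
        simpa using (tendsto_pow_atTop_nhds_zero_of_lt_one (by norm_num : (0 : ℝ) ≤ 1 / 2)
          (by norm_num)).const_mul (f 0).sep
      obtain ⟨n, hn⟩ := (h1.eventually (gt_mem_nhds (half_pos hδ))).exists
      refine ⟨n, ?_⟩
      have := hsep₀ n
      rw [one_div, inv_pow, ← div_eq_mul_inv] at hn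
      linarith
    have hA := (hf n).2.2.2.2.2 y
    set A := {x | dist ((f (n + 1)).map x) y ≤ (f n).sep} with hAdef
    set B := (⋃ m, (V (n + 1 + m))ᶜ) ∪ Iᶜ with hB
    have hμB : μ B ≤ ENNReal.ofReal (2 * (2 * (f (n + 1)).rate)) := by
      refine (measure_union_le _ _).trans ?_
      rw [hμI, add_zero]
      exact (measure_iUnion_le _).trans (hVs (n + 1))
    have hμA : μ B < μ A := by
      refine hμB.trans_lt ?_
      rw [← ofReal_measureReal (μ := μ) (s := A)]
      refine (ENNReal.ofReal_lt_ofReal_iff_of_nonneg (by linarith [hr0 (n + 1)])).2 ?_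
      linarith [hr0 (n + 1)]
    have hpos : 0 < μ (A \ B) := (tsub_pos_of_lt hμA).trans_le le_measure_sdiff
    refine hpos.trans_le (measure_mono fun x hx => hyU ?_)
    obtain ⟨hxA, hxB⟩ := hx
    simp only [hB, Set.mem_union, Set.mem_iUnion, Set.mem_compl_iff, not_or, not_exists, not_not]
      at hxB
    have h1 := hclose (n + 1) x hxB.2 fun m hm => by
      obtain ⟨k, rfl⟩ := Nat.exists_eq_add_of_le hm
      exact hxB.1 k
    rw [Metric.mem_ball]
    have h2 : dist ((f (n + 1)).map x) y ≤ (f n).sep := hxA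
    linarith [dist_triangle_left (Ψ x) y ((f (n + 1)).map x), hsep' n, hs0 n]

end Limit

theorem exists_finset_of_exp_le_netMaxcard {Y : Type*} {S : Y → Y} {U : SetRel Y Y} {n : ℕ} {t : ℝ}
    (h : ENNReal.ofReal (Real.exp t) ≤ (Dynamics.netMaxcard S univ U n : ℝ≥0∞)) :
    ∃ E : Finset Y, Dynamics.IsDynNetIn S univ U n E ∧ Real.exp t ≤ E.card := by
  rcases lt_or_eq_of_le (le_top (a := Dynamics.netMaxcard S univ U n)) with hlt | htop
  · obtain ⟨E, hE, hc⟩ := (Dynamics.netMaxcard_finite_iff S univ U n).1 hlt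
    refine ⟨E, hE, ?_⟩
    rw [← hc, ENat.toENNReal_coe, ← ENNReal.ofReal_natCast] at h
    exact (ENNReal.ofReal_le_ofReal_iff (by positivity)).1 h
  · have h1 : ((⌈Real.exp t⌉₊ : ℕ) : ℕ∞) < Dynamics.netMaxcard S univ U n := by
      rw [htop]; exact ENat.natCast_lt_top _
    rw [Dynamics.netMaxcard] at h1
    simp only [lt_iSup_iff] at h1
    obtain ⟨E, hE, hc⟩ := h1
    exact ⟨E, hE, (Nat.le_ceil _).trans (by exact_mod_cast hc.le)⟩

/-- Positive topological entropy yields exponentially many separated orbits. -/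
theorem exists_hasSep_of_lt_topEntropy {Y : Type*} [MetricSpace Y] {S : Y → Y} {h : ℝ}
    (hh : (h : EReal) < topEntropy S) : ∃ ε > 0, HasSep S ε h := by
  rw [topEntropy, Dynamics.coverEntropy_eq_iSup_netEntropyEntourage, lt_iSup_iff] at hh
  obtain ⟨U, hU⟩ := hh
  rw [lt_iSup_iff] at hU
  obtain ⟨hU, hlt⟩ := hU
  obtain ⟨ε, hε, hεU⟩ := Metric.mem_uniformity_dist.1 hU
  refine ⟨ε / 2, by positivity, (ExpGrowth.frequently_exp_le hlt).mono fun n hn => ?_⟩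
  have hn' : ENNReal.ofReal (Real.exp (n * h)) ≤ (Dynamics.netMaxcard S univ U n : ℝ≥0∞) := by
    refine le_trans (le_of_eq ?_) hn
    rw [← EReal.exp_coe, mul_comm]
    norm_cast
  obtain ⟨E, hE, hc⟩ := exists_finset_of_exp_le_netMaxcard hn'
  refine ⟨E, hc, fun e he e' he' hd => ?_⟩
  by_contra hne
  have h1 := Set.disjoint_left.1 (hE.2 he he' hne)
  refine @h1 e' ?_ ?_
  · exact Dynamics.mem_ball_dynEntourage.2 fun k hk => hεU (by linarith [hd k hk])
  · exact Dynamics.mem_ball_dynEntourage.2 fun k _ => hεU (by simpa using hε)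

section Growth

open Polynomial

variable {𝔸 : Type*} [NormedRing 𝔸] [NormedAlgebra ℂ 𝔸]

theorem exists_norm_pow_mul_le {a b : 𝔸} {r : ℝ} (hr : 0 < r) (m : Multiset ℂ)
    (h : ∀ μ ∈ m, ∃ (ν : ℂ) (c : 𝔸), Commute c b ∧
      b - algebraMap ℂ 𝔸 ν = c * (a - algebraMap ℂ 𝔸 μ) ∧ ‖ν‖ < r) :
    ∀ x : 𝔸, aeval a ((m.map fun μ => X - C μ).prod) * x = 0 →
      ∃ K, ∀ n : ℕ, ‖b ^ n * x‖ ≤ K * r ^ n := by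
  induction m using Multiset.induction with
  | empty =>
    intro x hx
    simp only [Multiset.map_zero, Multiset.prod_zero, map_one, one_mul] at hx
    exact ⟨0, fun n => by simp [hx]⟩
  | cons μ m ih =>
    intro x hx
    obtain ⟨ν, c, hcb, hbc, hν⟩ := h μ (Multiset.mem_cons_self _ _)
    set w := (a - algebraMap ℂ 𝔸 μ) * x with hw
    have hIH := ih (fun μ' h' => h μ' (Multiset.mem_cons_of_mem h')) w (by
      rw [Multiset.map_cons, Multiset.prod_cons, mul_comm, map_mul] at hx
      simpa [hw, mul_assoc] using hx)
    obtain ⟨K, hK⟩ := hIH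
    have hbx : b * x = ν • x + c * w := by
      rw [hw, ← mul_assoc, ← hbc, sub_mul, Algebra.smul_def]
      abel
    set D := max ‖x‖ (‖c‖ * K / (r - ‖ν‖)) with hD
    have hD1 : ‖c‖ * K ≤ D * (r - ‖ν‖) := by
      rw [← div_le_iff₀ (by linarith)]
      exact le_max_right _ _
    refine ⟨D, fun n => ?_⟩
    induction n with
    | zero => simp [hD]
    | succ n ihn =>
      have h1 : b ^ (n + 1) * x = ν • (b ^ n * x) + c * (b ^ n * w) := by
        rw [pow_succ, mul_assoc, hbx, mul_add, mul_smul_comm, ← mul_assoc c (b ^ n) w,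
          (hcb.pow_right n).eq, mul_assoc (b ^ n) c w]
      rw [h1]
      calc ‖ν • (b ^ n * x) + c * (b ^ n * w)‖
          ≤ ‖ν‖ * ‖b ^ n * x‖ + ‖c‖ * ‖b ^ n * w‖ := by
            refine (norm_add_le _ _).trans (add_le_add (norm_smul_le _ _) (norm_mul_le _ _))
        _ ≤ ‖ν‖ * (D * r ^ n) + ‖c‖ * (K * r ^ n) := by
            gcongr
            exact hK n
        _ = (‖ν‖ * D + ‖c‖ * K) * r ^ n := by ring
        _ ≤ (D * r) * r ^ n := by gcongr; linarith
        _ = D * r ^ (n + 1) := by ring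

theorem exists_lt_one_forall_norm_lt (m : Multiset ℂ) (h : ∀ μ ∈ m, ‖μ‖ < 1) :
    ∃ l : ℝ, 0 < l ∧ l < 1 ∧ ∀ μ ∈ m, ‖μ‖ < l := by
  induction m using Multiset.induction with
  | empty => exact ⟨1 / 2, by norm_num, by norm_num, by simp⟩
  | cons μ m ih =>
    obtain ⟨l, h0, h1, hl⟩ := ih fun μ' h' => h μ' (Multiset.mem_cons_of_mem h')
    have h2 := h μ (Multiset.mem_cons_self _ _)
    refine ⟨max l ((1 + ‖μ‖) / 2), by positivity, max_lt h1 (by linarith), fun μ' h' => ?_⟩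
    rcases Multiset.mem_cons.1 h' with rfl | h'
    · exact lt_max_of_lt_right (by linarith)
    · exact lt_max_of_lt_left (hl _ h')

/-- Simultaneous recurrence of the powers of finitely many points of the closed unit disc. -/
theorem exists_pow_sub_pow_lt (s : Finset ℂ) (h : ∀ μ ∈ s, ‖μ‖ ≤ 1) :
    ∃ n n' : ℕ, n < n' ∧ ∀ μ ∈ s, ‖μ ^ n' - μ ^ n‖ < 1 / 2 := by
  have hb : Bornology.IsBounded (Metric.closedBall (0 : s → ℂ) 1) := Metric.isBounded_closedBall
  obtain ⟨y, -, φ, hφ, hlim⟩ := tendsto_subseq_of_bounded hb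
    (x := fun n (μ : s) => (μ : ℂ) ^ n) (fun n => by
      rw [mem_closedBall_zero_iff, pi_norm_le_iff_of_nonneg zero_le_one]
      intro μ
      rw [norm_pow]
      exact pow_le_one₀ (norm_nonneg _) (h _ μ.2))
  obtain ⟨N, hN⟩ := Metric.cauchySeq_iff.1 hlim.cauchySeq (1 / 2) (by norm_num)
  refine ⟨φ N, φ (N + 1), hφ (Nat.lt_succ_self N), fun μ hμ => ?_⟩
  have h1 := hN (N + 1) (Nat.le_succ N) N le_rfl
  rw [dist_eq_norm] at h1
  exact (norm_le_pi_norm _ (⟨μ, hμ⟩ : s)).trans_lt h1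

/-- Splitting of an invertible element annihilated by a polynomial into an expanding part and a
center-stable part; on the latter some difference of powers is contracting. -/
theorem exists_splitting {a ai : 𝔸} (h2 : ai * a = 1) {p : ℂ[X]} (hp : p.Monic)
    (ha : aeval a p = 0) :
    ∃ (qu qc : 𝔸) (n n' : ℕ) (l : ℝ), n < n' ∧ 0 < l ∧ l < 1 ∧ qu + qc = 1 ∧ qc * qc = qc ∧
      Commute a qc ∧ (∃ K, ∀ k : ℕ, ‖ai ^ k * qu‖ ≤ K * l ^ k) ∧
      (∃ K, ∀ k : ℕ, ‖(a ^ n' - a ^ n) ^ k * qc‖ ≤ K * (1 / 2) ^ k) ∧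
      ∀ r > 1, ∃ K, ∀ k : ℕ, ‖a ^ k * qc‖ ≤ K * r ^ k := by
  classical
  set mu := p.roots.filter (fun μ => 1 < ‖μ‖) with hmu
  set mc := p.roots.filter (fun μ => ¬ 1 < ‖μ‖) with hmc
  set pu := (mu.map fun μ => X - C μ).prod with hpu
  set pc := (mc.map fun μ => X - C μ).prod with hpc
  have hprod : pu * pc = p := by
    rw [hpu, hpc, ← Multiset.prod_add, ← Multiset.map_add, Multiset.filter_add_not]
    exact ((IsAlgClosed.splits p).eq_prod_roots_of_monic hp).symm
  have hcop : IsCoprime pu pc := by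
    rw [Polynomial.isCoprime_iff_aeval_ne_zero_of_isAlgClosed ℂ ℂ]
    intro z
    by_contra hcon
    push Not at hcon
    obtain ⟨hu, hc⟩ := hcon
    simp only [hpu, hpc, map_multiset_prod, Multiset.prod_eq_zero_iff, Multiset.mem_map,
      Multiset.map_map] at hu hc
    obtain ⟨x, hx, hx0⟩ := hu
    obtain ⟨y, hy, hy0⟩ := hc
    simp only [Function.comp_apply, map_sub, aeval_X, aeval_C, Algebra.algebraMap_self,
      RingHom.id_apply, sub_eq_zero] at hx0 hy0
    subst hx0 hy0
    exact (Multiset.mem_filter.1 hy).2 (Multiset.mem_filter.1 hx).2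
  obtain ⟨f, g, hfg⟩ := hcop
  have hsum : aeval a (g * pc) + aeval a (f * pu) = 1 := by
    rw [← map_add, add_comm, hfg, map_one]
  have hz : aeval a (f * pu) * aeval a (g * pc) = 0 := by
    rw [← map_mul, show f * pu * (g * pc) = (f * g) * (pu * pc) by ring, hprod, map_mul, ha,
      mul_zero]
  have hcz : aeval a pc * aeval a (f * pu) = 0 := by
    rw [← map_mul, show pc * (f * pu) = f * (pu * pc) by ring, hprod, map_mul, ha, mul_zero]
  have huz : aeval a pu * aeval a (g * pc) = 0 := by
    rw [← map_mul, show pu * (g * pc) = g * (pu * pc) by ring, hprod, map_mul, ha, mul_zero]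
  obtain ⟨n, n', hnn, hB⟩ := exists_pow_sub_pow_lt mc.toFinset (fun μ hμ => by
    have := (Multiset.mem_filter.1 (Multiset.mem_toFinset.1 hμ)).2
    linarith)
  obtain ⟨l, hl0, hl1, hl⟩ := exists_lt_one_forall_norm_lt (mu.map fun μ => μ⁻¹) (by
    intro ν hν
    obtain ⟨μ, hμ, rfl⟩ := Multiset.mem_map.1 hν
    rw [norm_inv]
    exact inv_lt_one_of_one_lt₀ (Multiset.mem_filter.1 hμ).2)
  refine ⟨aeval a (g * pc), aeval a (f * pu), n, n', l, hnn, hl0, hl1, hsum, ?_, ?_, ?_, ?_, ?_⟩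
  · calc aeval a (f * pu) * aeval a (f * pu)
        = aeval a (f * pu) * (aeval a (g * pc) + aeval a (f * pu)) := by rw [mul_add, hz, zero_add]
      _ = aeval a (f * pu) := by rw [hsum, mul_one]
  · have := Commute.all (X : ℂ[X]) (f * pu) |>.map (aeval a)
    simpa using this
  · refine exists_norm_pow_mul_le hl0 mu (fun μ hμ => ⟨μ⁻¹, -(algebraMap ℂ 𝔸 μ⁻¹) * ai, ?_, ?_, ?_⟩)
      _ huz
    · exact (Algebra.commute_algebraMap_left μ⁻¹ ai).neg_left.mul_left (Commute.refl ai)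
    · have hμ0 : μ ≠ 0 := by
        rintro rfl
        have := (Multiset.mem_filter.1 hμ).2
        simp at this
        linarith
      have h3 : algebraMap ℂ 𝔸 μ⁻¹ * algebraMap ℂ 𝔸 μ = 1 := by
        rw [← map_mul, inv_mul_cancel₀ hμ0, map_one]
      have h4 : ai * algebraMap ℂ 𝔸 μ = algebraMap ℂ 𝔸 μ * ai := (Algebra.commutes _ _).symm
      rw [mul_assoc, mul_sub, h2, h4, mul_sub, mul_one, neg_mul, ← mul_assoc, h3, one_mul]
      abel
    · exact hl _ (Multiset.mem_map_of_mem _ hμ)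
  · refine exists_norm_pow_mul_le (by norm_num) mc (fun μ hμ => ?_) _ hcz
    obtain ⟨q, hq⟩ := X_sub_C_dvd_sub_C_eval (a := μ) (p := (X : ℂ[X]) ^ n' - X ^ n)
    refine ⟨μ ^ n' - μ ^ n, aeval a q, ?_, ?_, hB μ (Multiset.mem_toFinset.2 hμ)⟩
    · have := Commute.all q ((X : ℂ[X]) ^ n' - X ^ n) |>.map (aeval a)
      simpa using this
    · have := congrArg (aeval a) hq
      rw [mul_comm] at this
      simpa using this
  · intro r hr
    refine exists_norm_pow_mul_le (by linarith) mc (fun μ hμ => ⟨μ, 1, Commute.one_left _,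
      (one_mul _).symm, ?_⟩) _ hcz
    have := (Multiset.mem_filter.1 hμ).2
    linarith

end Growth

section RealSplitting

open scoped Matrix.Norms.Operator

variable {d : ℕ}

/-- An integer matrix with its entries viewed in the ring `R`. -/
abbrev intMatrixCast (R : Type*) [CommRing R] :
    Matrix (Fin d) (Fin d) ℤ →+* Matrix (Fin d) (Fin d) R :=
  (Int.castRingHom R).mapMatrix

theorem norm_map_re_le (Q : Matrix (Fin d) (Fin d) ℂ) : ‖Q.map Complex.re‖ ≤ ‖Q‖ := by
  rw [Matrix.linfty_opNorm_def, Matrix.linfty_opNorm_def, NNReal.coe_le_coe]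
  refine Finset.sup_mono_fun fun i _ => Finset.sum_le_sum fun j _ => ?_
  exact Complex.abs_re_le_norm _

theorem map_re_intMatrixCast_mul (M : Matrix (Fin d) (Fin d) ℤ) (Q : Matrix (Fin d) (Fin d) ℂ) :
    (intMatrixCast ℂ M * Q).map Complex.re = intMatrixCast ℝ M * Q.map Complex.re := by
  ext i j
  simp [Matrix.mul_apply]

theorem det_pow_sub_pow_ne_zero {A : Matrix (Fin d) (Fin d) ℤ} (hA : IsUnit A.det)
    (hQH : QuasiHyperbolic A) {n n' : ℕ} (h : n < n') : (A ^ n' - A ^ n).det ≠ 0 := by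
  obtain ⟨k, rfl⟩ := Nat.exists_eq_add_of_le h.le
  have hk : 0 < k := by omega
  rw [show A ^ (n + k) - A ^ n = A ^ n * (A ^ k - 1) by rw [mul_sub, pow_add, mul_one],
    Matrix.det_mul, Matrix.det_pow]
  refine mul_ne_zero (pow_ne_zero _ hA.ne_zero) fun h0 => ?_
  have h1 : (1 : ℂ) ∈ spectrum ℂ (intMatrixCast ℂ A ^ k) := by
    rw [spectrum.mem_iff, Matrix.isUnit_iff_isUnit_det, isUnit_iff_ne_zero, not_not, map_one,
      ← neg_sub, ← map_pow, ← map_one (intMatrixCast ℂ), ← map_sub, ← map_neg,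
      ← RingHom.map_det, Matrix.det_neg, h0]
    simp
  rw [spectrum.map_pow_of_pos _ hk] at h1
  obtain ⟨z, hz, hzk⟩ := h1
  refine hQH z ?_ k hk hzk
  rw [← Matrix.charpoly_map]
  exact Matrix.mem_spectrum_iff_isRoot_charpoly.1 hz

/-- A quasi-hyperbolic integer matrix splits the space into a part that its inverse contracts and
a part on which it grows subexponentially and some nonsingular integer matrix contracts. -/
theorem exists_real_splitting {A : Matrix (Fin d) (Fin d) ℤ} (hA : IsUnit A.det)
    (hQH : QuasiHyperbolic A) :
    ∃ (Pu Pc : Matrix (Fin d) (Fin d) ℝ) (B : Matrix (Fin d) (Fin d) ℤ) (l b K₀ : ℝ),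
      0 < l ∧ l < 1 ∧ 1 ≤ b ∧ Pu + Pc = 1 ∧ B.det ≠ 0 ∧
      (∀ n j : ℕ, ‖intMatrixCast ℝ (A⁻¹ ^ n * B ^ j) * Pu‖ ≤ K₀ * b ^ j * l ^ n) ∧
      ∀ r > 1, ∃ K, ∀ i j : ℕ,
        ‖intMatrixCast ℝ (A ^ i * B ^ j) * Pc‖ ≤ K * r ^ i * (1 / 2) ^ j := by
  have hi : A⁻¹ * A = 1 := Matrix.nonsing_inv_mul A hA
  have hi' : A * A⁻¹ = 1 := Matrix.mul_nonsing_inv A hA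
  set a := intMatrixCast ℂ A with ha
  obtain ⟨qu, qc, n, n', l, hnn, hl0, hl1, hsum, hcc, hcomm, ⟨K, hK⟩, ⟨K', hK'⟩, hr⟩ :=
    exists_splitting (a := a) (ai := intMatrixCast ℂ A⁻¹) (by rw [ha, ← map_mul, hi, map_one])
      a.charpoly_monic a.aeval_self_charpoly
  set B := A ^ n' - A ^ n with hB
  have hBa : intMatrixCast ℂ B = a ^ n' - a ^ n := by rw [hB, map_sub, map_pow, map_pow]
  have hAB : Commute A⁻¹ B := by
    have h1 : Commute A⁻¹ A := hi.trans hi'.symm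
    exact (h1.pow_right _).sub_right (h1.pow_right _)
  refine ⟨qu.map Complex.re, qc.map Complex.re, B, l, ‖intMatrixCast ℂ B‖ + 1, K, hl0, hl1,
    by linarith [norm_nonneg (intMatrixCast ℂ B)], ?_, det_pow_sub_pow_ne_zero hA hQH hnn, ?_, ?_⟩
  · have h1 : (qu + qc).map Complex.re = qu.map Complex.re + qc.map Complex.re := by
      ext i j; simp
    rw [← h1, hsum]
    ext i j
    simp [Matrix.one_apply, apply_ite Complex.re]
  · intro k j
    rw [← map_re_intMatrixCast_mul]
    refine (norm_map_re_le _).trans ?_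
    rw [((hAB.pow_left k).pow_right j).eq, map_mul, map_pow, map_pow, mul_assoc]
    refine (norm_mul_le _ _).trans ?_
    have h1 : ‖intMatrixCast ℂ B ^ j‖ ≤ (‖intMatrixCast ℂ B‖ + 1) ^ j := by
      rcases j.eq_zero_or_pos with rfl | hj
      · rw [pow_zero, pow_zero]
        rcases isEmpty_or_nonempty (Fin d) with h | h
        · rw [Subsingleton.elim (1 : Matrix (Fin d) (Fin d) ℂ) 0, norm_zero]; exact zero_le_one
        · exact norm_one.le
      · exact (norm_pow_le' _ hj).trans (by gcongr; linarith)
    calc _ ≤ (‖intMatrixCast ℂ B‖ + 1) ^ j * (K * l ^ k) := by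
          gcongr
          exact hK k
      _ = _ := by ring
  · intro r hr1
    obtain ⟨K₂, hK₂⟩ := hr r hr1
    have hK₂0 : 0 ≤ K₂ := by
      have := (norm_nonneg _).trans (hK₂ 0)
      simpa using this
    refine ⟨K₂ * K', fun i j => ?_⟩
    rw [← map_re_intMatrixCast_mul]
    refine (norm_map_re_le _).trans ?_
    have h1 : Commute qc (intMatrixCast ℂ B) := by
      rw [hBa]
      exact ((hcomm.pow_left _).sub_left (hcomm.pow_left _)).symm
    have h2 : intMatrixCast ℂ (A ^ i * B ^ j) * qc
        = (a ^ i * qc) * (intMatrixCast ℂ B ^ j * qc) := by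
      rw [map_mul, map_pow, map_pow, mul_assoc, mul_assoc, ← mul_assoc qc,
        (h1.pow_right j).eq, mul_assoc, hcc]
    rw [h2]
    refine (norm_mul_le _ _).trans ?_
    calc _ ≤ (K₂ * r ^ i) * (K' * (1 / 2) ^ j) := by
          gcongr
          · exact hK₂ i
          · rw [hBa]; exact hK' j
      _ = _ := by ring

end RealSplitting

section SpecOfSplitting

variable {Y : Type*}

theorem sum_pow_sub_le {l : ℝ} (h0 : 0 < l) (h1 : l < 1) (J : Finset ℕ) (p m : ℕ)
    (hJ : ∀ s ∈ J, p + m ≤ s) : ∑ s ∈ J, l ^ (s - p) ≤ l ^ m * (1 - l)⁻¹ := by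
  have hinj : Set.InjOn (fun s => s - (p + m)) (J : Set ℕ) := by
    intro s hs s' hs' h
    have h1 := hJ s hs
    have h2 := hJ s' hs'
    simp only at h
    omega
  calc ∑ s ∈ J, l ^ (s - p) = l ^ m * ∑ s ∈ J, l ^ (s - (p + m)) := by
        rw [Finset.mul_sum]
        refine Finset.sum_congr rfl fun s hs => ?_
        rw [← pow_add]
        congr 1
        have := hJ s hs
        omega
    _ = l ^ m * ∑ n ∈ J.image fun s => s - (p + m), l ^ n := by
        rw [Finset.sum_image hinj]
    _ ≤ l ^ m * (1 - l)⁻¹ := by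
        gcongr
        rw [← tsum_geometric_of_lt_one h0.le h1]
        exact (summable_geometric_of_lt_one h0.le h1).sum_le_tsum _ fun n _ => by positivity

theorem specAt_of_splitting [NormedAddCommGroup Y] {S S' : Y →+ Y} (hSS : ∀ x, S (S' x) = x)
    {l δ ε : ℝ} {L m : ℕ} (hl0 : 0 < l) (hl1 : l < 1) (hδ0 : 0 ≤ δ)
    (hδ : δ * (l ^ m * (1 - l)⁻¹) ≤ ε / 2)
    (h : ∀ z, ∃ u c, z = u + c ∧ (∀ n, ‖S'^[n] u‖ ≤ δ * l ^ n) ∧ ∀ i < L, ‖S^[i] c‖ ≤ ε / 2) :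
    SpecAt S ε L m := by
  intro J len x hlen hgap
  have hinv : ∀ n (u : Y), S^[n] (S'^[n] u) = u := fun n u =>
    (Function.LeftInverse.iterate (f := S') (g := S) hSS n) u
  suffices ∃ y, ∀ s ∈ J, ∀ i < len s, dist (S^[s + i] y) (S^[i] (x s))
      ≤ ε / 2 + ∑ s' ∈ J.filter (s < ·), δ * l ^ (s' - (s + i)) by
    obtain ⟨y, hy⟩ := this
    refine ⟨y, fun s hs i hi => (hy s hs i hi).trans ?_⟩
    rw [← Finset.mul_sum]
    have h1 := sum_pow_sub_le hl0 hl1 (J.filter (s < ·)) (s + i) m (by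
      intro s' hs'
      rw [Finset.mem_filter] at hs'
      have := hgap s hs s' hs'.1 hs'.2
      omega)
    have h2 := mul_le_mul_of_nonneg_left h1 hδ0
    linarith
  induction J using Finset.induction_on_max with
  | empty => exact ⟨0, by simp⟩
  | insert s' J hmax ih =>
    obtain ⟨y, hy⟩ := ih (fun s hs => hlen s (Finset.mem_insert_of_mem hs))
      fun s hs t ht => hgap s (Finset.mem_insert_of_mem hs) t (Finset.mem_insert_of_mem ht)
    obtain ⟨u, c, hz, hu, hc⟩ := h (x s' - S^[s'] y)
    have hadd : ∀ n (v w : Y), S^[n] (v + w) = S^[n] v + S^[n] w := fun n v w =>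
      iterate_map_add S n v w
    refine ⟨y + S'^[s'] u, fun s hs i hi => ?_⟩
    rw [Finset.mem_insert] at hs
    rcases hs with rfl | hs
    · have h1 : S^[s + i] (y + S'^[s] u) = S^[i] (x s) - S^[i] c := by
        rw [add_comm s i, Function.iterate_add_apply, hadd s, hinv, ← iterate_map_sub S]
        congr 1
        rw [← add_right_cancel_iff (a := c), add_assoc, ← hz]
        abel
      rw [h1, dist_eq_norm, sub_sub_cancel_left, norm_neg]
      have h2 := hc i (hi.trans_le (hlen s (Finset.mem_insert_self _ _)))
      have h3 : 0 ≤ ∑ s' ∈ (insert s J).filter (s < ·), δ * l ^ (s' - (s + i)) :=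
        Finset.sum_nonneg fun _ _ => by positivity
      linarith
    · have hss := hmax s hs
      have hle : s + i ≤ s' := by
        have := hgap s (Finset.mem_insert_of_mem hs) s' (Finset.mem_insert_self _ _) hss
        omega
      have hs'J : s' ∉ J := fun hmem => lt_irrefl _ (hmax s' hmem)
      have h1 : S^[s + i] (y + S'^[s'] u) = S^[s + i] y + S'^[s' - (s + i)] u := by
        rw [hadd]
        congr 1
        have h2 := hinv (s + i) (S'^[s' - (s + i)] u)
        rwa [← Function.iterate_add_apply, Nat.add_sub_cancel' hle] at h2
      rw [h1, Finset.filter_insert, if_pos hss, Finset.sum_insert (by simp [hs'J])]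
      have h2 := hy s hs i hi
      have h3 := hu (s' - (s + i))
      have h4 : dist (S^[s + i] y + S'^[s' - (s + i)] u) (S^[i] (x s))
          ≤ dist (S^[s + i] y) (S^[i] (x s)) + ‖S'^[s' - (s + i)] u‖ := by
        rw [dist_eq_norm, dist_eq_norm, add_sub_right_comm]
        exact norm_add_le _ _
      linarith

theorem hasSpec_of_splitting [NormedAddCommGroup Y] {S S' : Y →+ Y} (hSS : ∀ x, S (S' x) = x)
    {l b K₀ : ℝ} (hl0 : 0 < l) (hl1 : l < 1) (hb : 1 ≤ b) (hK₀ : 0 ≤ K₀)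
    (h : ∀ r > 1, ∃ K, 0 ≤ K ∧ ∀ j z, ∃ u c, z = u + c ∧
      (∀ n, ‖S'^[n] u‖ ≤ K₀ * b ^ j * l ^ n) ∧ ∀ i, ‖S^[i] c‖ ≤ K * r ^ i * (1 / 2) ^ j) :
    HasSpec S := by
  intro ε hε κ hκ
  obtain ⟨t, ht1, ht⟩ : ∃ t : ℕ, 1 ≤ t ∧ b * l ^ t ≤ 1 / 2 := by
    have h1 : Tendsto (fun t : ℕ => b * l ^ t) atTop (nhds (b * 0)) :=
      (tendsto_pow_atTop_nhds_zero_of_lt_one hl0.le hl1).const_mul b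
    rw [mul_zero] at h1
    have h2 := h1.eventually_le_const (show (0 : ℝ) < 1 / 2 by norm_num)
    obtain ⟨t, h3, h4⟩ := (h2.and (eventually_ge_atTop 1)).exists
    exact ⟨t, h4, h3⟩
  obtain ⟨q, hq⟩ := exists_nat_ge ((t : ℝ) / κ)
  obtain ⟨r, hr1, hrq⟩ : ∃ r : ℝ, 1 < r ∧ r ^ q ≤ 4 / 3 := by
    have h1 : Tendsto (fun r : ℝ => r ^ q) (nhdsWithin 1 (Ioi 1)) (nhds (1 ^ q)) :=
      ((continuous_pow q).tendsto 1).mono_left nhdsWithin_le_nhds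
    rw [one_pow] at h1
    have h2 := h1.eventually_le_const (show (1 : ℝ) < 4 / 3 by norm_num)
    obtain ⟨r, h3, h4⟩ := (h2.and self_mem_nhdsWithin).exists
    exact ⟨r, h4, h3⟩
  obtain ⟨K, hK0, hK⟩ := h r hr1
  have hlim : ∀ (C a : ℝ), 0 ≤ a → a < 1 → ∀ᶠ j : ℕ in atTop, C * a ^ j ≤ ε / 2 := by
    intro C a ha0 ha1
    have h1 : Tendsto (fun t : ℕ => C * a ^ t) atTop (nhds (C * 0)) :=
      (tendsto_pow_atTop_nhds_zero_of_lt_one ha0 ha1).const_mul C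
    rw [mul_zero] at h1
    exact h1.eventually_le_const (by linarith)
  obtain ⟨j₀, hj₀⟩ := eventually_atTop.1
    ((hlim (K * (4 / 3)) (2 / 3) (by norm_num) (by norm_num)).and
      (hlim (K₀ * (1 - l)⁻¹) (1 / 2) (by norm_num) (by norm_num)))
  have ht0 : (0 : ℝ) < t := by exact_mod_cast ht1
  obtain ⟨ℓ₀, hℓ₀⟩ := exists_nat_ge ((t : ℝ) * j₀ / κ)
  refine ⟨ℓ₀, fun L hL => ?_⟩
  have hLr : (ℓ₀ : ℝ) ≤ L := by exact_mod_cast hL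
  set j := ⌊κ * L / t⌋₊ with hj
  have hj1 : (j : ℝ) ≤ κ * L / t := Nat.floor_le (by positivity)
  have hj2 : κ * L / t < j + 1 := Nat.lt_floor_add_one _
  have hjj : j₀ ≤ j := by
    refine Nat.le_floor ?_
    rw [div_le_iff₀ hκ] at hℓ₀
    rw [le_div_iff₀ ht0]
    nlinarith
  obtain ⟨hA, hB⟩ := hj₀ j hjj
  have hLq : L ≤ q * (j + 1) := by
    have h1 : (L : ℝ) ≤ q * (j + 1) := by
      rw [div_lt_iff₀ ht0] at hj2
      rw [div_le_iff₀ hκ] at hq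
      have h2 : κ * L ≤ κ * (q * (j + 1)) := by
        have : (0 : ℝ) ≤ j + 1 := by positivity
        nlinarith
      exact le_of_mul_le_mul_left h2 hκ
    exact_mod_cast h1
  refine ⟨t * j, ?_, specAt_of_splitting hSS hl0 hl1 (δ := K₀ * b ^ j) (by positivity) ?_ ?_⟩
  · rw [le_div_iff₀ ht0] at hj1
    push_cast
    linarith
  · have h1 : (b * l ^ t) ^ j ≤ (1 / 2) ^ j := by gcongr
    have h2 : 0 ≤ K₀ * (1 - l)⁻¹ := mul_nonneg hK₀ (inv_nonneg.2 (by linarith))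
    calc K₀ * b ^ j * (l ^ (t * j) * (1 - l)⁻¹) = K₀ * (1 - l)⁻¹ * (b * l ^ t) ^ j := by
          rw [mul_pow, ← pow_mul]; ring
      _ ≤ K₀ * (1 - l)⁻¹ * (1 / 2) ^ j := mul_le_mul_of_nonneg_left h1 h2
      _ ≤ ε / 2 := hB
  · intro z
    obtain ⟨u, c, hz, hu, hc⟩ := hK j z
    refine ⟨u, c, hz, hu, fun i hi => (hc i).trans (le_trans ?_ hA)⟩
    have h1 : r ^ i ≤ (4 / 3) ^ (j + 1) :=
      calc r ^ i ≤ r ^ (q * (j + 1)) := pow_le_pow_right₀ hr1.le (hi.le.trans hLq)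
        _ = (r ^ q) ^ (j + 1) := pow_mul _ _ _
        _ ≤ (4 / 3) ^ (j + 1) := by gcongr
    calc K * r ^ i * (1 / 2) ^ j ≤ K * (4 / 3) ^ (j + 1) * (1 / 2) ^ j := by gcongr
      _ = K * (4 / 3) * (2 / 3) ^ j := by
        rw [show (2 / 3 : ℝ) = 4 / 3 * (1 / 2) by norm_num, mul_pow, pow_succ]; ring

/-- A nontrivial point with a backward orbit converging to a fixed point yields a marker. -/
theorem hasMarker_of_tendsto [MetricSpace Y] {S S' : Y → Y} (hSS : ∀ x, S (S' x) = x) {o v : Y}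
    (hv : v ≠ o) (hlim : Tendsto (fun n => S'^[n] v) atTop (nhds o)) :
    ∃ r η₀, 0 < η₀ ∧ HasMarker S o r η₀ := by
  set a : ℕ → ℝ := fun n => dist (S'^[n] v) o with ha
  have ha0 : 0 < a 0 := dist_pos.2 hv
  have hlim' : Tendsto a atTop (nhds 0) := tendsto_iff_dist_tendsto_zero.1 hlim
  obtain ⟨N₀, hN₀⟩ := eventually_atTop.1 (hlim'.eventually_lt_const (half_pos ha0))
  obtain ⟨N, hN, hmax⟩ : ∃ N, a 0 ≤ a N ∧ ∀ n > N, a n < a 0 := by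
    have hex : ∃ N, a 0 ≤ a N ∧ N ≤ N₀ := ⟨0, le_rfl, Nat.zero_le _⟩
    refine ⟨Nat.findGreatest (fun n => a 0 ≤ a n) N₀, ?_, fun n hn => ?_⟩
    · exact Nat.findGreatest_spec (P := fun n => a 0 ≤ a n) (Nat.zero_le N₀) le_rfl
    · by_cases hnN : n ≤ N₀
      · exact not_le.1 (Nat.findGreatest_is_greatest hn hnN)
      · exact (hN₀ n (by omega)).trans (half_lt_self ha0)
  obtain ⟨M, hM, hMn⟩ : ∃ M < a 0, ∀ n > N, a n ≤ M := by
    refine ⟨max (a 0 / 2) ((Finset.range (N₀ + 1)).sup' Finset.nonempty_range_add_one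
      fun n => if N < n then a n else 0), max_lt (half_lt_self ha0) ?_, fun n hn => ?_⟩
    · rw [Finset.sup'_lt_iff]
      intro n _
      split_ifs with h
      · exact hmax n h
      · exact ha0
    · by_cases hnN : n ≤ N₀
      · refine le_max_of_le_right ?_
        have := Finset.le_sup' (fun n => if N < n then a n else 0)
          (Finset.mem_range.2 (Nat.lt_succ_of_le hnN))
        simp only [if_pos hn] at this
        exact this
      · exact le_max_of_le_left (hN₀ n (by omega)).le
  have hinv : ∀ k n, S^[k] (S'^[k + n] v) = S'^[n] v := fun k n => by
    rw [Function.iterate_add_apply]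
    exact (Function.LeftInverse.iterate (f := S') (g := S) hSS k) _
  refine ⟨(a N + M) / 2, (a N - M) / 2, by linarith, fun L => ⟨S'^[L + N] v, fun i hi => ?_, ?_⟩⟩
  · have h1 := hMn (L - i + N) (by omega)
    rw [show L + N = i + (L - i + N) by omega, hinv]
    simp only [ha] at h1 ⊢
    linarith
  · rw [hinv]
    simp only [ha]
    linarith

end SpecOfSplitting

section Torus

open scoped Matrix.Norms.Operator

variable {d : ℕ}

/-- The projection from `ℝ^d` to the torus. -/
noncomputable def torusMk (d : ℕ) : (Fin d → ℝ) →+ Torus d where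
  toFun v i := (v i : AddCircle (1 : ℝ))
  map_zero' := by ext i; simp
  map_add' v w := by ext i; simp

theorem norm_torusMk_le (v : Fin d → ℝ) : ‖torusMk d v‖ ≤ ‖v‖ := by
  refine (pi_norm_le_iff_of_nonneg (norm_nonneg _)).2 fun i => le_trans ?_ (norm_le_pi_norm v i)
  exact QuotientAddGroup.norm_mk_le_norm

theorem exists_torusMk_eq (z : Torus d) : ∃ w, ‖w‖ ≤ 1 ∧ torusMk d w = z := by
  have : Fact ((0 : ℝ) < 1) := ⟨one_pos⟩
  refine ⟨fun i => (AddCircle.equivIco (1 : ℝ) 0 (z i) : ℝ), ?_, ?_⟩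
  · refine (pi_norm_le_iff_of_nonneg zero_le_one).2 fun i => ?_
    have h := (AddCircle.equivIco (1 : ℝ) 0 (z i)).2
    rw [Real.norm_eq_abs, abs_le]
    constructor <;> linarith [h.1, h.2]
  · funext i
    exact AddCircle.coe_equivIco

theorem torusMk_ne_zero {v : Fin d → ℝ} (hv : v ≠ 0) (hv1 : ‖v‖ < 1) : torusMk d v ≠ 0 := by
  intro h
  refine hv (funext fun i => ?_)
  have h1 : ((v i : ℝ) : AddCircle (1 : ℝ)) = 0 := congrFun h i
  obtain ⟨n, hn⟩ := AddCircle.coe_eq_zero_iff (1 : ℝ) |>.1 h1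
  have h2 : |v i| < 1 := (norm_le_pi_norm v i).trans_lt hv1
  rw [← hn] at h2 ⊢
  rw [zsmul_eq_mul, mul_one] at h2 ⊢
  have h3 : |n| < 1 := by exact_mod_cast h2
  rw [Int.abs_lt_one_iff.1 h3]
  simp

theorem toralAut_torusMk (M : Matrix (Fin d) (Fin d) ℤ) (v : Fin d → ℝ) :
    toralAut M (torusMk d v) = torusMk d (Matrix.mulVec (intMatrixCast ℝ M) v) := by
  funext i
  change ∑ j, M i j • ((v j : ℝ) : AddCircle (1 : ℝ))
    = ((∑ j, ((M i j : ℤ) : ℝ) * v j : ℝ) : AddCircle (1 : ℝ))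
  have h : ∀ f : Fin d → ℝ, ((∑ j, f j : ℝ) : AddCircle (1 : ℝ)) = ∑ j, (f j : AddCircle (1 : ℝ)) :=
    fun f => map_sum (QuotientAddGroup.mk' (AddSubgroup.zmultiples (1 : ℝ))) f Finset.univ
  rw [h]
  refine Finset.sum_congr rfl fun j _ => ?_
  rw [← zsmul_eq_mul]
  rfl

/-- The endomorphism of the torus induced by an integer matrix. -/
noncomputable def toralHom (M : Matrix (Fin d) (Fin d) ℤ) : Torus d →+ Torus d where
  toFun := toralAut M
  map_zero' := by funext i; simp [toralAut]
  map_add' x y := by funext i; simp [toralAut, Finset.sum_add_distrib]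

theorem toralAut_mul (M N : Matrix (Fin d) (Fin d) ℤ) (x : Torus d) :
    toralAut (M * N) x = toralAut M (toralAut N x) := by
  obtain ⟨v, -, rfl⟩ := exists_torusMk_eq x
  rw [toralAut_torusMk, toralAut_torusMk, toralAut_torusMk, map_mul, Matrix.mulVec_mulVec]

theorem toralAut_one (x : Torus d) : toralAut 1 x = x := by
  obtain ⟨v, -, rfl⟩ := exists_torusMk_eq x
  rw [toralAut_torusMk, map_one, Matrix.one_mulVec]

theorem toralAut_iterate (M : Matrix (Fin d) (Fin d) ℤ) (n : ℕ) (x : Torus d) :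
    (toralAut M)^[n] x = toralAut (M ^ n) x := by
  induction n with
  | zero => rw [pow_zero, toralAut_one]; rfl
  | succ n ih => rw [Function.iterate_succ_apply', ih, pow_succ', toralAut_mul]

theorem continuous_toralAut (M : Matrix (Fin d) (Fin d) ℤ) : Continuous (toralAut M) :=
  continuous_pi fun _ => continuous_finsetSum _ fun j _ => (continuous_apply j).zsmul _

theorem toralAut_toralAut_inv {A : Matrix (Fin d) (Fin d) ℤ} (hA : IsUnit A.det) (x : Torus d) :
    toralAut A (toralAut A⁻¹ x) = x := by
  rw [← toralAut_mul, Matrix.mul_nonsing_inv A hA, toralAut_one]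

/-- A unimodular integer matrix as a homeomorphism of the torus. -/
noncomputable def toralHomeo (A : Matrix (Fin d) (Fin d) ℤ) (hA : IsUnit A.det) :
    Torus d ≃ₜ Torus d where
  toFun := toralAut A
  invFun := toralAut A⁻¹
  left_inv x := by rw [← toralAut_mul, Matrix.nonsing_inv_mul A hA, toralAut_one]
  right_inv := toralAut_toralAut_inv hA
  continuous_toFun := continuous_toralAut A
  continuous_invFun := continuous_toralAut A⁻¹

/-- The image of the unit ball under a nonsingular integer matrix covers the torus. -/
theorem exists_torusMk_mulVec_eq {M : Matrix (Fin d) (Fin d) ℤ} (hM : M.det ≠ 0) (z : Torus d) :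
    ∃ w, ‖w‖ ≤ 1 ∧ torusMk d (Matrix.mulVec (intMatrixCast ℝ M) w) = z := by
  obtain ⟨v, -, rfl⟩ := exists_torusMk_eq z
  have hdet : IsUnit (intMatrixCast ℝ M).det := by
    rw [← RingHom.map_det, isUnit_iff_ne_zero]
    simpa using hM
  obtain ⟨w, hw, hwv⟩ := exists_torusMk_eq (torusMk d (Matrix.mulVec (intMatrixCast ℝ M)⁻¹ v))
  refine ⟨w, hw, ?_⟩
  rw [← toralAut_torusMk, hwv, toralAut_torusMk, Matrix.mulVec_mulVec,
    Matrix.mul_nonsing_inv _ hdet, Matrix.one_mulVec]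

theorem hasSpec_toralAut {A : Matrix (Fin d) (Fin d) ℤ} (hA : IsUnit A.det)
    (hQH : QuasiHyperbolic A) : HasSpec (toralAut A) := by
  obtain ⟨Pu, Pc, B, l, b, K₀, hl0, hl1, hb, hsum, hB, hu, hc⟩ := exists_real_splitting hA hQH
  have hK₀ : 0 ≤ K₀ := by
    have := (norm_nonneg _).trans (hu 0 0)
    simpa using this
  refine hasSpec_of_splitting (S := toralHom A) (S' := toralHom A⁻¹) (toralAut_toralAut_inv hA)
    hl0 hl1 hb hK₀ fun r hr => ?_
  obtain ⟨K, hK⟩ := hc r hr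
  refine ⟨K, by simpa using (norm_nonneg _).trans (hK 0 0), fun j z => ?_⟩
  obtain ⟨w, hw, rfl⟩ := exists_torusMk_mulVec_eq (M := B ^ j)
    (by rw [Matrix.det_pow]; exact pow_ne_zero _ hB) z
  have hbound : ∀ (N M : Matrix (Fin d) (Fin d) ℤ) (P : Matrix (Fin d) (Fin d) ℝ) (C : ℝ),
      ‖intMatrixCast ℝ (N * M) * P‖ ≤ C →
      ‖toralAut N (torusMk d (Matrix.mulVec (intMatrixCast ℝ M * P) w))‖ ≤ C := by
    intro N M P C h
    rw [toralAut_torusMk, Matrix.mulVec_mulVec, ← mul_assoc, ← map_mul]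
    refine (norm_torusMk_le _).trans ((Matrix.linfty_opNorm_mulVec _ _).trans ?_)
    have := mul_le_mul h hw (norm_nonneg _) ((norm_nonneg _).trans h)
    rwa [mul_one] at this
  refine ⟨torusMk d (Matrix.mulVec (intMatrixCast ℝ (B ^ j) * Pu) w),
    torusMk d (Matrix.mulVec (intMatrixCast ℝ (B ^ j) * Pc) w), ?_, fun n => ?_, fun i => ?_⟩
  · rw [← map_add, ← Matrix.add_mulVec, ← mul_add, hsum, mul_one]
  · change ‖(toralAut A⁻¹)^[n] _‖ ≤ _
    rw [toralAut_iterate]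
    exact hbound _ _ _ _ (hu n j)
  · change ‖(toralAut A)^[i] _‖ ≤ _
    rw [toralAut_iterate]
    exact hbound _ _ _ _ (hK i j)

theorem hasMarker_toralAut (hd : 0 < d) {A : Matrix (Fin d) (Fin d) ℤ} (hA : IsUnit A.det)
    (hQH : QuasiHyperbolic A) : ∃ r η₀, 0 < η₀ ∧ HasMarker (toralAut A) 0 r η₀ := by
  obtain ⟨Pu, Pc, B, l, b, K₀, hl0, hl1, hb, hsum, hB, hu, hc⟩ := exists_real_splitting hA hQH
  have hPu : Pu ≠ 0 := by
    rintro rfl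
    rw [zero_add] at hsum
    obtain ⟨K, hK⟩ := hc 2 one_lt_two
    have h1 : Tendsto (fun j : ℕ => K * (1 / 2 : ℝ) ^ j) atTop (nhds (K * 0)) :=
      (tendsto_pow_atTop_nhds_zero_of_lt_one (by norm_num) (by norm_num)).const_mul K
    rw [mul_zero] at h1
    obtain ⟨j, hj⟩ := (h1.eventually_lt_const one_pos).exists
    have h2 : ‖intMatrixCast ℝ (B ^ j)‖ < 1 := by
      have := hK 0 j
      rw [pow_zero, pow_zero, one_mul, hsum, mul_one, mul_one] at this
      exact this.trans_lt hj
    have h3 : B ^ j = 0 := by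
      ext i k
      have h4 : ‖intMatrixCast ℝ (B ^ j) i k‖ < 1 := by
        have h5 := Matrix.linfty_opNorm_mulVec (intMatrixCast ℝ (B ^ j)) (Pi.single k 1)
        rw [Matrix.mulVec_single_one, Pi.norm_single, norm_one, mul_one] at h5
        exact (norm_le_pi_norm _ i).trans_lt (h5.trans_lt h2)
      have h5 : |(B ^ j) i k| < 1 := by
        have : |(((B ^ j) i k : ℤ) : ℝ)| < 1 := h4
        exact_mod_cast this
      rw [Int.abs_lt_one_iff.1 h5, Matrix.zero_apply]
    refine pow_ne_zero j hB ?_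
    have : Nonempty (Fin d) := ⟨⟨0, hd⟩⟩
    rw [← Matrix.det_pow, h3, Matrix.det_zero]
  obtain ⟨e, he⟩ : ∃ e, Matrix.mulVec Pu e ≠ 0 := by
    by_contra! h
    refine hPu (Matrix.ext_of_mulVec_single fun i => ?_)
    rw [h, Matrix.zero_mulVec]
  set c : ℝ := (‖Matrix.mulVec Pu e‖ + 1)⁻¹ with hcdef
  have hn : 0 < ‖Matrix.mulVec Pu e‖ := norm_pos_iff.2 he
  have hc0 : 0 < c := by positivity
  have hv : torusMk d (Matrix.mulVec Pu (c • e)) ≠ 0 := by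
    rw [Matrix.mulVec_smul]
    refine torusMk_ne_zero (smul_ne_zero hc0.ne' he) ?_
    rw [norm_smul, Real.norm_of_nonneg hc0.le, hcdef, inv_mul_lt_iff₀ (by positivity)]
    linarith
  refine hasMarker_of_tendsto (toralAut_toralAut_inv hA) hv ?_
  have h1 : Tendsto (fun n : ℕ => K₀ * ‖c • e‖ * l ^ n) atTop (nhds (K₀ * ‖c • e‖ * 0)) :=
    (tendsto_pow_atTop_nhds_zero_of_lt_one hl0.le hl1).const_mul _
  rw [mul_zero] at h1
  refine squeeze_zero_norm (fun n => ?_) h1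
  rw [toralAut_iterate, toralAut_torusMk, Matrix.mulVec_mulVec]
  refine (norm_torusMk_le _).trans ((Matrix.linfty_opNorm_mulVec _ _).trans ?_)
  have h2 := hu n 0
  rw [pow_zero, pow_zero, mul_one, mul_one] at h2
  calc _ ≤ K₀ * l ^ n * ‖c • e‖ := by gcongr
    _ = _ := by ring

end Torus

/-- **Quasi-hyperbolic toral automorphisms are fully universal.** -/
theorem quasiHyperbolic_toral_automorphisms_fully_universal {d : ℕ}
    (A : Matrix (Fin d) (Fin d) ℤ) (hA : IsUnit A.det) (hQH : QuasiHyperbolic A) :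
    FullyUniversal (toralAut A) := by
  intro X _ μ T _ _ hna hT hlt
  have : NullSingletonClass μ := hna
  have : Fact ((0 : ℝ) < 1) := ⟨one_pos⟩
  obtain ⟨h₁, hk, hh⟩ := EReal.lt_iff_exists_real_btwn.1 hlt
  have hfin : ksEntropy μ T ≠ ⊤ := by
    intro h
    rw [h] at hk
    simp at hk
  have hk' : (ksEntropy μ T).toReal < h₁ := by
    rwa [← EReal.coe_lt_coe_iff, EReal.coe_ennreal_toReal hfin]
  obtain ⟨ε, hε, hsep⟩ := exists_hasSep_of_lt_topEntropy hh
  have hd : 0 < d := by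
    by_contra hd
    obtain rfl : d = 0 := by omega
    obtain ⟨ℓ, ⟨E, hE, -⟩, hℓ⟩ := (hsep.and_eventually (eventually_ge_atTop 1)).exists
    have h1 : E.card ≤ 1 := Finset.card_le_one_of_subsingleton E
    have h2 : 0 < (ℓ : ℝ) * h₁ :=
      mul_pos (by exact_mod_cast hℓ) (ENNReal.toReal_nonneg.trans_lt hk')
    have h3 : (E.card : ℝ) ≤ 1 := by exact_mod_cast h1
    linarith [Real.one_lt_exp_iff.2 h2]
  obtain ⟨r, η₀, hη₀, hmark⟩ := hasMarker_toralAut hd hA hQH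
  exact exists_isMeasEmbedding_fullSupport hT hfin (toralHomeo A hA) (hasSpec_toralAut hA hQH)
    (o := 0) (map_zero (toralHom A)) hη₀ hmark hε hsep hk'
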